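/- Displacement energy of a product of a polydisk and a ball in a cylinder (Theorem 1.3 / thm:hindbi): Let n ≥ 2, let k be an integer with 1 ≤ k < n, let S > 1 and 0 < ε < 1. Let D = D²(1)^{n−k} × B^{2k}(kS), where D²(1) = {z ∈ ℂ : π|z|² < 1} and B^{2k}(kS) = {z ∈ ℂᵏ : π(|z₁|² + ⋯ + |z_k|²) < kS}, and let Z = Z_{n−k,k}(1+ε) = D²(1+ε)^{n−k} × ℂᵏ ⊆ ℂⁿ. Then for every smooth Hamiltonian H : [0,1] × ℂⁿ → ℝ whose support is compact and contained in [0,1] × Z, if the time-one map ψ = φ_H^1 of its Hamiltonian isotopy satisfies ψ(D) ∩ closure(D) = ∅, then ‖H‖ ≥ S. Equivalently, the displacement energy of D²(1)^{n−k} × B^{2k}(kS) inside the cylinder Z_{n−k,k}(1+ε) is at least S. -/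

import Mathlib

open MeasureTheory Set Filter

noncomputable section

abbrev CE (n : ℕ) : Type := EuclideanSpace ℂ (Fin n)

/-- The standard symplectic form `ω(v, w) = ⟨i • v, w⟩_ℝ` on `ℂⁿ ≅ ℝ²ⁿ`. -/
def symp {n : ℕ} (v w : CE n) : ℝ := inner (𝕜 := ℝ) ((Complex.I : ℂ) • v) w

/-- The Hamiltonian vector field `X_{H_t}(x) = -i ∇H_t(x)`. -/
def hamVF {n : ℕ} (H : ℝ → CE n → ℝ) (t : ℝ) (x : CE n) : CE n :=
  (-Complex.I : ℂ) • gradient (H t) x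

/-- ∂u/∂τ. -/
def d1 {n : ℕ} (u : ℝ × ℝ → CE n) (p : ℝ × ℝ) : CE n := deriv (fun s => u (s, p.2)) p.1

/-- ∂u/∂t. -/
def d2 {n : ℕ} (u : ℝ × ℝ → CE n) (p : ℝ × ℝ) : CE n := deriv (fun s => u (p.1, s)) p.2

/-- The strip `ℝ × [0,1]`. -/
def strip : Set (ℝ × ℝ) := Set.univ ×ˢ Set.Icc (0 : ℝ) 1

/-- The energy density `|∂u/∂τ|² + |∂u/∂t − ρ(τ) X_{H_t}(u)|²`. -/
def enDensity {n : ℕ} (H : ℝ → CE n → ℝ) (ρ : ℝ → ℝ) (u : ℝ × ℝ → CE n) (p : ℝ × ℝ) : ℝ :=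
  ‖d1 u p‖ ^ 2 + ‖d2 u p - ρ p.1 • hamVF H p.2 (u p)‖ ^ 2

/-- The energy `E_{(H,ρ)}(u)`. -/
def energy {n : ℕ} (H : ℝ → CE n → ℝ) (ρ : ℝ → ℝ) (u : ℝ × ℝ → CE n) : ℝ :=
  (1 / 2) * ∫ p in strip, enDensity H ρ u p

/-- The symplectic area `∫ u*ω`. -/
def area {n : ℕ} (u : ℝ × ℝ → CE n) : ℝ := ∫ p in strip, symp (d1 u p) (d2 u p)

def Eplus {n : ℕ} (H : ℝ → CE n → ℝ) : ℝ := ∫ t in (0:ℝ)..1, ⨆ x : CE n, H t x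
def Eminus {n : ℕ} (H : ℝ → CE n → ℝ) : ℝ := -∫ t in (0:ℝ)..1, ⨅ x : CE n, H t x
def hoferNorm {n : ℕ} (H : ℝ → CE n → ℝ) : ℝ := Eplus H + Eminus H

/-- An elongation function of type `ρ₊`. -/
structure IsElongationPlus (ρ : ℝ → ℝ) : Prop where
  smooth : ContDiff ℝ (⊤ : ℕ∞) ρ
  mono : Monotone ρ
  mem : ∀ τ : ℝ, ρ τ ∈ Set.Icc (0:ℝ) 1
  zero : ∀ τ : ℝ, τ ≤ 0 → ρ τ = 0
  one : ∀ τ : ℝ, 1 ≤ τ → ρ τ = 1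

/-- An elongation function of type `ρ_K`. -/
structure IsElongationK (K : ℝ) (ρ : ℝ → ℝ) : Prop where
  smooth : ContDiff ℝ (⊤ : ℕ∞) ρ
  mem : ∀ τ : ℝ, ρ τ ∈ Set.Icc (0:ℝ) 1
  zero : ∀ τ : ℝ, K ≤ |τ| → ρ τ = 0
  one : ∀ τ : ℝ, |τ| ≤ K - 1 → ρ τ = 1
  incr : ∀ τ ∈ Set.Icc (-K) (-K + 1), 0 ≤ deriv ρ τ
  decr : ∀ τ ∈ Set.Icc (K - 1) K, deriv ρ τ ≤ 0

/-- `u` solves the `ρ`-perturbed Cauchy–Riemann equation on `ℝ × [0,1]`. -/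
def SolvesCR {n : ℕ} (H : ℝ → CE n → ℝ) (ρ : ℝ → ℝ) (u : ℝ × ℝ → CE n) : Prop :=
  ∀ p : ℝ × ℝ, p.2 ∈ Set.Icc (0:ℝ) 1 →
    d1 u p + (Complex.I : ℂ) • (d2 u p - ρ p.1 • hamVF H p.2 (u p)) = 0

/-- `φ` is the Hamiltonian flow of `H`. -/
structure IsHamFlow {n : ℕ} (H : ℝ → CE n → ℝ) (φ : ℝ → CE n ≃ CE n) : Prop where
  init : ∀ x, φ 0 x = x
  isFlow : ∀ t x, HasDerivAt (fun s => φ s x) (hamVF H t (φ t x)) t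
  smooth : ContDiff ℝ (⊤ : ℕ∞) fun p : ℝ × CE n => φ p.1 p.2
  smooth_symm : ContDiff ℝ (⊤ : ℕ∞) fun p : ℝ × CE n => (φ p.1).symm p.2

set_option linter.unusedSectionVars false

namespace DispEnergy

theorem exists_root_of_odd_natDegree (n : ℕ) :
    ∀ p : Polynomial ℝ, p.natDegree = n → Odd n → ∃ x, p.IsRoot x := by
  induction n using Nat.strong_induction_on with
  | _ n ih =>
    intro p hp hn
    have hp0 : p ≠ 0 := by rintro rfl; simp at hp; subst hp; simp at hn
    have hu : ¬ IsUnit p := by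
      intro h
      have := Polynomial.natDegree_eq_zero_of_isUnit h
      rw [hp] at this; subst this; simp at hn
    obtain ⟨q, hq, r, rfl⟩ := WfDvdMonoid.exists_irreducible_factor hu hp0
    have hq0 : q ≠ 0 := hq.ne_zero
    have hr0 : r ≠ 0 := right_ne_zero_of_mul hp0
    have hdeg := Polynomial.natDegree_mul hq0 hr0
    have h2 : q.natDegree ≤ 2 := Polynomial.natDegree_le_of_degree_le hq.degree_le_two
    have h1 : 0 < q.natDegree := hq.natDegree_pos
    have h12 : q.natDegree = 1 ∨ q.natDegree = 2 := by omega
    rcases h12 with h | h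
    · obtain ⟨x, hx⟩ := Polynomial.exists_root_of_degree_eq_one
        (Polynomial.degree_eq_iff_natDegree_eq hq0 |>.2 h)
      exact ⟨x, by simp [Polynomial.IsRoot, hx.eq_zero]⟩
    · obtain ⟨x, hx⟩ := ih r.natDegree (by omega) r rfl (by
        have : n = r.natDegree + 2 := by omega
        rw [this] at hn
        exact (Nat.odd_add.1 hn).2 (by decide))
      exact ⟨x, by simp [Polynomial.IsRoot, hx.eq_zero]⟩

/-- A commuting family of endomorphisms of an odd-dimensional real vector space has a common
eigenvector. -/
theorem exists_common_eigenvector (n : ℕ) : ∀ (V : Type) [AddCommGroup V] [Module ℝ V]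
    [FiniteDimensional ℝ V] (J : Type) (f : J → Module.End ℝ V),
    (∀ i j, Commute (f i) (f j)) → Module.finrank ℝ V = n → Odd n →
    ∃ v : V, v ≠ 0 ∧ ∀ j, ∃ c : ℝ, f j v = c • v := by
  induction n using Nat.strong_induction_on with
  | _ n ih =>
    intro V _ _ _ J f hf hV hn
    by_cases hsc : ∀ j, ∃ c : ℝ, ∀ v, f j v = c • v
    · have : Nontrivial V := Module.nontrivial_of_finrank_pos (R := ℝ) (by rw [hV]; exact hn.pos)
      obtain ⟨v, hv⟩ := exists_ne (0 : V)
      exact ⟨v, hv, fun j => (hsc j).imp fun c hc => hc v⟩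
    · push Not at hsc
      obtain ⟨j, hj⟩ := hsc
      obtain ⟨c, hc⟩ := exists_root_of_odd_natDegree n (f j).charpoly
        (by rw [LinearMap.charpoly_natDegree, hV]) hn
      have hev := (Module.End.hasEigenvalue_iff_isRoot_charpoly (f j) c).2 hc
      set g : Module.End ℝ V := f j - c • 1 with hg
      have hker : LinearMap.ker g ≠ ⊥ := by
        obtain ⟨v, hv⟩ := hev.exists_hasEigenvector
        intro h
        apply hv.2
        rw [← Submodule.mem_bot ℝ, ← h, LinearMap.mem_ker]
        simp [hg, hv.apply_eq_smul]
      have hker' : LinearMap.ker g ≠ ⊤ := by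
        intro h
        obtain ⟨v, hv⟩ := hj c
        apply hv
        have : v ∈ LinearMap.ker g := by rw [h]; trivial
        rw [LinearMap.mem_ker] at this
        simpa [hg, sub_eq_zero] using this
      have hcomm : ∀ i, Commute (f i) g := fun i =>
        (hf i j).sub_right ((Commute.one_right _).smul_right c)
      have hrn := LinearMap.finrank_range_add_finrank_ker g
      have hkpos : 0 < Module.finrank ℝ (LinearMap.ker g) := by
        rw [Module.finrank_pos_iff]
        exact Submodule.nontrivial_iff_ne_bot.2 hker
      have hklt := Submodule.finrank_lt hker'
      have key : ∀ W : Submodule ℝ V, (∀ i, ∀ w ∈ W, f i w ∈ W) →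
          Module.finrank ℝ W < n → Odd (Module.finrank ℝ W) →
          ∃ v : V, v ≠ 0 ∧ ∀ j, ∃ c : ℝ, f j v = c • v := by
        intro W hW hlt hodd
        obtain ⟨v, hv, h⟩ := ih _ hlt W J (fun i => (f i).restrict (hW i))
          (fun i j => by
            ext x
            have := LinearMap.congr_fun (hf i j).eq (x : V)
            simpa using this) rfl hodd
        refine ⟨v, by simpa using hv, fun j => ?_⟩
        obtain ⟨c, hc⟩ := h j
        exact ⟨c, by simpa using congrArg Subtype.val hc⟩
      rw [hV] at hrn
      rcases Nat.even_or_odd (Module.finrank ℝ (LinearMap.ker g)) with he | ho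
      · refine key (LinearMap.range g) ?_ (by omega) ?_
        · rintro i _ ⟨w, rfl⟩
          exact ⟨f i w, (LinearMap.congr_fun (hcomm i).eq w).symm⟩
        · rw [← hrn] at hn
          by_contra h
          rw [Nat.not_odd_iff_even] at h
          exact (Nat.not_odd_iff_even.2 (h.add he)) hn
      · refine key (LinearMap.ker g) ?_ (by omega) ho
        intro i w hw
        rw [LinearMap.mem_ker] at hw ⊢
        have := LinearMap.congr_fun (hcomm i).eq w
        simp only [Module.End.mul_apply, hw, map_zero] at this
        exact this.symm

/-- A family that is unitriangular for a weight function with respect to a basis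
is linearly independent and spans. -/
theorem triangular_basis {σ V : Type} [AddCommGroup V] [Module ℝ V] (b : Module.Basis σ ℝ V)
    (wt : σ → ℕ) (p : σ → V)
    (h1 : ∀ s, b.repr (p s) s = 1)
    (h2 : ∀ s t, t ≠ s → b.repr (p s) t ≠ 0 → wt t < wt s) :
    LinearIndependent ℝ p ∧ ⊤ ≤ Submodule.span ℝ (Set.range p) := by
  classical
  constructor
  · rw [linearIndependent_iff]
    intro l hl
    by_contra hne
    obtain ⟨s, hs, hmax⟩ := l.support.exists_max_image wt (Finsupp.support_nonempty_iff.2 hne)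
    have := congrArg (fun v => b.repr v s) hl
    simp only [map_zero, Finsupp.coe_zero, Pi.zero_apply] at this
    rw [Finsupp.linearCombination_apply, Finsupp.sum, map_sum, Finsupp.finsetSum_apply,
      Finset.sum_eq_single_of_mem s hs] at this
    · simp [h1] at this
      exact (Finsupp.mem_support_iff.1 hs) this
    · intro t ht hts
      have : b.repr (p t) s = 0 := by
        by_contra h
        exact absurd (h2 t s hts.symm h) (not_lt.2 (hmax t ht))
      simp [this]
  · have key : ∀ n s, wt s = n → b s ∈ Submodule.span ℝ (Set.range p) := by
      intro n
      induction n using Nat.strong_induction_on with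
      | _ n ih =>
        intro s hs
        have hsum := b.linearCombination_repr (p s)
        rw [Finsupp.linearCombination_apply, Finsupp.sum] at hsum
        have hmem : s ∈ (b.repr (p s)).support := by simp [h1]
        rw [← Finset.add_sum_erase _ _ hmem, h1, one_smul] at hsum
        rw [eq_sub_of_add_eq hsum]
        refine Submodule.sub_mem _ (Submodule.subset_span ⟨s, rfl⟩) (Submodule.sum_mem _ ?_)
        intro t ht
        rw [Finset.mem_erase] at ht
        exact Submodule.smul_mem _ _ (ih _ (hs ▸ h2 s t ht.1 (by simpa using ht.2)) t rfl)
    rw [← b.span_eq, Submodule.span_le]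
    rintro _ ⟨s, rfl⟩
    exact key _ s rfl

section Algebra

open MvPolynomial

variable {κ ι : Type} [Fintype κ] [Fintype ι] [DecidableEq κ] [DecidableEq ι]

/-- The real number `±1` attached to a sign. -/
def sgn (u : ℤˣ) : ℝ := ((u : ℤ) : ℝ)

theorem sgn_mul_self (u : ℤˣ) : sgn u * sgn u = 1 := by
  rcases Int.units_eq_one_or u with rfl | rfl <;> simp [sgn]

theorem sgn_mul (u v : ℤˣ) : sgn (u * v) = sgn u * sgn v := by simp [sgn]

theorem sgn_one : sgn 1 = 1 := by simp [sgn]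

theorem sgn_neg_one : sgn (-1) = -1 := by simp [sgn]

theorem sgn_pow_even (u : ℤˣ) {n : ℕ} (hn : Even n) : sgn u ^ n = 1 := by
  obtain ⟨m, rfl⟩ := hn
  rw [← two_mul, pow_mul, sq, sgn_mul_self, one_pow]

theorem sgn_pow_odd (u : ℤˣ) {n : ℕ} (hn : Odd n) : sgn u ^ n = sgn u := by
  obtain ⟨m, rfl⟩ := hn
  rw [pow_succ, sgn_pow_even u (even_two_mul m), one_mul]

/-- Change the sign of the variables block by block. -/
def flipAlg (blk : κ → ι) (η : ι → ℤˣ) : MvPolynomial κ ℝ →ₐ[ℝ] MvPolynomial κ ℝ :=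
  aeval fun c => C (sgn (η (blk c))) * X c

theorem eval_flipAlg (blk : κ → ι) (η : ι → ℤˣ) (p : MvPolynomial κ ℝ) (y : κ → ℝ) :
    eval y (flipAlg blk η p) = eval (fun c => sgn (η (blk c)) * y c) p := by
  induction p using MvPolynomial.induction_on with
  | C a => simp [flipAlg]
  | add p q hp hq => simp [hp, hq]
  | mul_X p c hp => rw [map_mul, map_mul, hp, map_mul]; simp [flipAlg]

theorem flipAlg_flipAlg (blk : κ → ι) (η θ : ι → ℤˣ) (p : MvPolynomial κ ℝ) :
    flipAlg blk η (flipAlg blk θ p) = flipAlg blk (η * θ) p := by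
  apply MvPolynomial.funext
  intro y
  simp only [eval_flipAlg, Pi.mul_apply, sgn_mul]
  congr 2
  ext c
  ring

/-- All monomials of `p` have weight less than `n`. -/
def Low (wt : κ → ℕ) (n : ℕ) (p : MvPolynomial κ ℝ) : Prop :=
  ∀ t ∈ p.support, Finsupp.weight wt t < n

/-- `p` is the monomial `s` plus terms of smaller weight. -/
def LeadMon (wt : κ → ℕ) (p : MvPolynomial κ ℝ) (s : κ →₀ ℕ) : Prop :=
  Low wt (Finsupp.weight wt s) (p - monomial s 1)

theorem Low.add {wt : κ → ℕ} {n : ℕ} {p q : MvPolynomial κ ℝ} (hp : Low wt n p)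
    (hq : Low wt n q) : Low wt n (p + q) := fun t ht =>
  (Finset.mem_union.1 (support_add ht)).elim (hp t) (hq t)

theorem Low.mul {wt : κ → ℕ} {m n : ℕ} {p q : MvPolynomial κ ℝ} (hp : Low wt n p)
    (hq : Low wt (m + 1) q) : Low wt (n + m) (p * q) := by
  intro t ht
  obtain ⟨u, hu, v, hv, rfl⟩ := Finset.mem_add.1 (support_mul p q ht)
  have := hp u hu
  have := hq v hv
  rw [map_add]
  omega

theorem Low.mono {wt : κ → ℕ} {m n : ℕ} {p : MvPolynomial κ ℝ} (hp : Low wt n p)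
    (h : n ≤ m) : Low wt m p := fun t ht => (hp t ht).trans_le h

theorem low_monomial (wt : κ → ℕ) (s : κ →₀ ℕ) (a : ℝ) :
    Low wt (Finsupp.weight wt s + 1) (monomial s a) := by
  intro t ht
  have := Finset.mem_singleton.1 (support_monomial_subset ht)
  subst this
  omega

theorem LeadMon.mul {wt : κ → ℕ} {p q : MvPolynomial κ ℝ} {s t : κ →₀ ℕ}
    (hp : LeadMon wt p s) (hq : LeadMon wt q t) : LeadMon wt (p * q) (s + t) := by
  have e : p * q - monomial (s + t) 1 =
      (p - monomial s 1) * monomial t 1 + (q - monomial t 1) * monomial s 1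
        + (p - monomial s 1) * (q - monomial t 1) := by
    have : (monomial (s + t) 1 : MvPolynomial κ ℝ) = monomial s 1 * monomial t 1 := by simp
    rw [this]; ring
  unfold LeadMon
  rw [e, map_add]
  refine ((Low.mul hp (low_monomial wt t 1)).add ?_).add
    (Low.mul hp (Low.mono hq (Nat.le_succ _)))
  rw [add_comm]
  exact Low.mul hq (low_monomial wt s 1)

theorem leadMon_monomial (wt : κ → ℕ) (s : κ →₀ ℕ) : LeadMon wt (monomial s 1) s := by
  intro t ht; simp at ht

theorem LeadMon.pow {wt : κ → ℕ} {p : MvPolynomial κ ℝ} {s : κ →₀ ℕ}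
    (hp : LeadMon wt p s) (n : ℕ) : LeadMon wt (p ^ n) (n • s) := by
  induction n with
  | zero => simpa using leadMon_monomial wt 0
  | succ n ih => rw [pow_succ, succ_nsmul]; exact ih.mul hp

theorem leadMon_prod {wt : κ → ℕ} {p : κ → MvPolynomial κ ℝ} {s : κ → (κ →₀ ℕ)}
    (A : Finset κ) (hp : ∀ c ∈ A, LeadMon wt (p c) (s c)) :
    LeadMon wt (∏ c ∈ A, p c) (∑ c ∈ A, s c) := by
  induction A using Finset.induction_on with
  | empty => simpa using leadMon_monomial wt 0
  | insert a A ha ih =>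
    rw [Finset.prod_insert ha, Finset.sum_insert ha]
    exact (hp a (by simp)).mul (ih fun c hc => hp c (by simp [hc]))

/-- The products `x^a g^b`, indexed by `a + d b`. -/
def stdMon (g : κ → MvPolynomial κ ℝ) (d : κ → ℕ) (s : κ →₀ ℕ) : MvPolynomial κ ℝ :=
  ∏ c, X c ^ (s c % d c) * g c ^ (s c / d c)

theorem leadMon_stdMon {wt : κ → ℕ} {g : κ → MvPolynomial κ ℝ} {d : κ → ℕ}
    (hg : ∀ c, LeadMon wt (g c) (Finsupp.single c (d c))) (s : κ →₀ ℕ) :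
    LeadMon wt (stdMon g d s) s := by
  have : s = ∑ c, Finsupp.single c (s c) := (Finsupp.univ_sum_single s).symm
  conv => arg 3; rw [this]
  refine leadMon_prod _ fun c _ => ?_
  have h1 : LeadMon wt (X c : MvPolynomial κ ℝ) (Finsupp.single c 1) := leadMon_monomial _ _
  have := (h1.pow (s c % d c)).mul ((hg c).pow (s c / d c))
  convert this using 1
  rw [Finsupp.smul_single, Finsupp.smul_single, ← Finsupp.single_add]
  congr 1
  simp only [smul_eq_mul, mul_one]
  rw [mul_comm (s c / d c)]
  exact (Nat.mod_add_div _ _).symm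

theorem exists_basis_stdMon {wt : κ → ℕ} {g : κ → MvPolynomial κ ℝ} {d : κ → ℕ}
    (hg : ∀ c, LeadMon wt (g c) (Finsupp.single c (d c))) :
    ∃ b : Module.Basis (κ →₀ ℕ) ℝ (MvPolynomial κ ℝ), ∀ s, b s = stdMon g d s := by
  have hc : ∀ (p : MvPolynomial κ ℝ) t, (basisMonomials κ ℝ).repr p t = coeff t p :=
    fun p t => rfl
  have hlow : ∀ s t, t ≠ s → coeff t (stdMon g d s) ≠ 0 →
      Finsupp.weight wt t < Finsupp.weight wt s := by
    intro s t hts h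
    apply leadMon_stdMon hg s t
    rw [mem_support_iff, coeff_sub, coeff_monomial, if_neg hts.symm, sub_zero]
    exact h
  have h1 : ∀ s, coeff s (stdMon g d s) = 1 := by
    intro s
    by_contra h
    have := leadMon_stdMon hg s s (by
      rw [mem_support_iff, coeff_sub, coeff_monomial, if_pos rfl]
      exact sub_ne_zero.2 h)
    exact lt_irrefl _ this
  obtain ⟨hli, hsp⟩ := triangular_basis (basisMonomials κ ℝ) (fun s => Finsupp.weight wt s)
    (stdMon g d) h1 hlow
  exact ⟨Module.Basis.mk hli hsp, fun s => by simp⟩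

/-- Each block of `s` has even total degree. -/
def EvenBlocks (blk : κ → ι) (s : κ →₀ ℕ) : Prop :=
  ∀ i, Even (∑ c with blk c = i, s c)

theorem prod_sgn_pow (blk : κ → ι) (η : ι → ℤˣ) (s : κ →₀ ℕ) :
    ∏ c, sgn (η (blk c)) ^ s c = ∏ i, sgn (η i) ^ (∑ c with blk c = i, s c) := by
  rw [← Finset.prod_fiberwise Finset.univ blk]
  refine Finset.prod_congr rfl fun i _ => ?_
  rw [← Finset.prod_pow_eq_pow_sum]
  refine Finset.prod_congr rfl fun c hc => ?_
  rw [(Finset.mem_filter.1 hc).2]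

theorem prod_sgn_pow_of_evenBlocks {blk : κ → ι} {s : κ →₀ ℕ} (hs : EvenBlocks blk s)
    (η : ι → ℤˣ) : ∏ c, sgn (η (blk c)) ^ s c = 1 := by
  rw [prod_sgn_pow]
  exact Finset.prod_eq_one fun i _ => sgn_pow_even _ (hs i)

theorem exists_prod_sgn_pow_eq_neg_one {blk : κ → ι} {s : κ →₀ ℕ} (hs : ¬ EvenBlocks blk s) :
    ∃ η : ι → ℤˣ, ∏ c, sgn (η (blk c)) ^ s c = -1 := by
  unfold EvenBlocks at hs
  push Not at hs
  obtain ⟨i, hi⟩ := hs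
  rw [Nat.not_even_iff_odd] at hi
  refine ⟨Pi.mulSingle i (-1), ?_⟩
  rw [prod_sgn_pow, Finset.prod_eq_single i]
  · rw [Pi.mulSingle_eq_same, sgn_pow_odd _ hi, sgn_neg_one]
  · intro j _ hj
    rw [Pi.mulSingle_eq_of_ne hj, sgn_one, one_pow]
  · simp

theorem flipAlg_monomial (blk : κ → ι) (η : ι → ℤˣ) (s : κ →₀ ℕ) (a : ℝ) :
    flipAlg blk η (monomial s a) = C (∏ c, sgn (η (blk c)) ^ s c) * monomial s a := by
  apply MvPolynomial.funext
  intro y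
  rw [eval_flipAlg, map_mul, eval_C, eval_monomial, eval_monomial, Finsupp.prod_fintype _ _ (by simp),
    Finsupp.prod_fintype _ _ (by simp)]
  simp_rw [mul_pow, Finset.prod_mul_distrib]
  ring

end Algebra

section Algebra

open MvPolynomial

variable {κ ι : Type} [Fintype κ] [Fintype ι] [DecidableEq κ] [DecidableEq ι]

/-- The hypotheses on the system `g` used in the algebraic Borsuk-Ulam theorem. -/
structure OddSystem (blk : κ → ι) (τ : ι → κ) (wt d : κ → ℕ) (g : κ → MvPolynomial κ ℝ) :
    Prop where
  blk_sec : ∀ i, blk (τ i) = i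
  lead : ∀ c, LeadMon wt (g c) (Finsupp.single c (d c))
  two : ∀ i, d (τ i) = 2
  odd : ∀ c, c ∉ Set.range τ → Odd (d c)
  sphere : ∀ i, g (τ i) = (∑ c with blk c = i, X c ^ 2) - 1
  flip : ∀ c, c ∉ Set.range τ → ∀ η, flipAlg blk η (g c) = C (sgn (η (blk c))) * g c

variable {blk : κ → ι} {τ : ι → κ} {wt d : κ → ℕ} {g : κ → MvPolynomial κ ℝ}

theorem OddSystem.d_pos (h : OddSystem blk τ wt d g) (c : κ) : 0 < d c := by
  by_cases hc : c ∈ Set.range τ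
  · obtain ⟨i, rfl⟩ := hc; rw [h.two]; norm_num
  · exact (h.odd c hc).pos

theorem OddSystem.flip_sphere (h : OddSystem blk τ wt d g) (i : ι) (η : ι → ℤˣ) :
    flipAlg blk η (g (τ i)) = g (τ i) := by
  rw [h.sphere]
  simp only [map_sub, map_sum, map_one, map_pow]
  congr 1
  refine Finset.sum_congr rfl fun c _ => ?_
  simp only [flipAlg, aeval_X, mul_pow, ← map_pow, sgn_pow_even _ even_two, map_one, one_mul]

theorem OddSystem.flip_stdMon (h : OddSystem blk τ wt d g) (s : κ →₀ ℕ) (η : ι → ℤˣ) :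
    flipAlg blk η (stdMon g d s) = C (∏ c, sgn (η (blk c)) ^ s c) * stdMon g d s := by
  unfold stdMon
  rw [map_prod, map_prod, ← Finset.prod_mul_distrib]
  refine Finset.prod_congr rfl fun c _ => ?_
  have hX : flipAlg blk η (X c) = C (sgn (η (blk c))) * X c := by simp [flipAlg]
  have hs := Nat.mod_add_div (s c) (d c)
  by_cases hc : c ∈ Set.range τ
  · obtain ⟨i, rfl⟩ := hc
    rw [map_mul, map_pow, map_pow, hX, h.flip_sphere, mul_pow, mul_assoc]
    congr 1
    rw [← map_pow]
    congr 1
    conv_rhs => rw [← hs, h.two, pow_add, pow_mul, sgn_pow_even _ even_two, one_pow, mul_one]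
    rw [h.two]
  · rw [map_mul, map_pow, map_pow, hX, h.flip c hc, mul_pow, mul_pow]
    have : sgn (η (blk c)) ^ s c = sgn (η (blk c)) ^ (s c % d c) * sgn (η (blk c)) ^ (s c / d c) := by
      conv_lhs => rw [← hs, pow_add, pow_mul, sgn_pow_odd _ (h.odd c hc)]
    rw [this, map_mul, map_pow, map_pow]
    ring

/-- The linear functionals that kill the ideal of `g` and are invariant under sign flips. -/
def invFunctionals (blk : κ → ι) (g : κ → MvPolynomial κ ℝ) :
    Submodule ℝ (Module.Dual ℝ (MvPolynomial κ ℝ)) where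
  carrier := {l | (∀ c q, l (g c * q) = 0) ∧ ∀ η q, l (flipAlg blk η q) = l q}
  add_mem' := by
    rintro a b ⟨h1, h2⟩ ⟨h3, h4⟩
    exact ⟨fun c q => by simp [h1, h3], fun η q => by simp [h2, h4]⟩
  zero_mem' := ⟨fun c q => rfl, fun η q => rfl⟩
  smul_mem' := by
    rintro r a ⟨h1, h2⟩
    exact ⟨fun c q => by simp [h1], fun η q => by simp [h2]⟩

/-- Exponents of the reduced monomials invariant under sign flips. -/
def RedEven (blk : κ → ι) (d : κ → ℕ) (s : κ →₀ ℕ) : Prop :=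
  (∀ c, s c < d c) ∧ EvenBlocks blk s

theorem OddSystem.apply_stdMon_eq_zero (h : OddSystem blk τ wt d g)
    {l : Module.Dual ℝ (MvPolynomial κ ℝ)} (hl : l ∈ invFunctionals blk g) {s : κ →₀ ℕ}
    (hs : ¬ RedEven blk d s) : l (stdMon g d s) = 0 := by
  obtain ⟨h1, h2⟩ := hl
  by_cases hs1 : ∀ c, s c < d c
  · have hs2 : ¬ EvenBlocks blk s := fun h' => hs ⟨hs1, h'⟩
    obtain ⟨η, hη⟩ := exists_prod_sgn_pow_eq_neg_one hs2
    have := h2 η (stdMon g d s)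
    rw [h.flip_stdMon, hη] at this
    have e : C (-1 : ℝ) * stdMon g d s = - stdMon g d s := by simp
    rw [e, map_neg] at this
    linarith
  · push Not at hs1
    obtain ⟨c, hc⟩ := hs1
    have : g c ∣ stdMon g d s := by
      unfold stdMon
      refine Dvd.dvd.trans ?_ (Finset.dvd_prod_of_mem _ (Finset.mem_univ c))
      refine Dvd.dvd.trans (dvd_pow_self _ ?_) (Dvd.intro_left _ rfl)
      exact (Nat.div_pos hc (h.d_pos c)).ne'
    obtain ⟨q, hq⟩ := this
    rw [hq]; exact h1 c q

theorem stdMon_mul_eq (c : κ) (s : κ →₀ ℕ) (hd : 0 < d c) :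
    g c * stdMon g d s = stdMon g d (s + Finsupp.single c (d c)) := by
  unfold stdMon
  rw [← Finset.mul_prod_erase _ _ (Finset.mem_univ c),
    ← Finset.mul_prod_erase _ _ (Finset.mem_univ c)]
  have : ∀ e ∈ Finset.univ.erase c, (s + Finsupp.single c (d c)) e = s e := by
    intro e he
    rw [Finset.mem_erase] at he
    simp [Finsupp.single_eq_of_ne he.1]
  rw [← mul_assoc]
  congr 1
  · simp only [Finsupp.coe_add, Pi.add_apply, Finsupp.single_eq_same, Nat.add_mod_right,
      Nat.add_div_right _ hd, pow_succ]
    ring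
  · refine Finset.prod_congr rfl fun e he => ?_
    rw [this e he]

theorem sum_block (hτ : ∀ i, blk (τ i) = i) (s : κ → ℕ) (i : ι) :
    ∑ c with blk c = i, s c = s (τ i) + ∑ c with blk c = i ∧ c ≠ τ i, s c := by
  rw [← Finset.add_sum_erase _ _ (show τ i ∈ ({c | blk c = i} : Finset κ) by simp [hτ])]
  congr 1
  refine Finset.sum_congr ?_ fun _ _ => rfl
  ext c
  simp [and_comm]

theorem OddSystem.odd_card (h : OddSystem blk τ wt d g) :
    ∃ _ : Fintype {s // RedEven blk d s}, Odd (Fintype.card {s // RedEven blk d s}) := by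
  classical
  let F : {s // RedEven blk d s} → ((c : {c // c ∉ Set.range τ}) → Fin (d c)) :=
    fun s c => ⟨s.1 c, s.2.1 c⟩
  have hne : ∀ {c i}, blk c = i → c ≠ τ i → c ∉ Set.range τ := by
    rintro c i hc hne ⟨j, rfl⟩
    rw [h.blk_sec] at hc
    exact hne (by rw [hc])
  have hF : Function.Bijective F := by
    constructor
    · rintro ⟨s, hs1, hs2⟩ ⟨t, ht1, ht2⟩ hst
      have hst' : ∀ c, c ∉ Set.range τ → s c = t c := fun c hc =>
        congrArg Fin.val (congrFun hst ⟨c, hc⟩)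
      refine Subtype.ext (Finsupp.ext fun c => ?_)
      change s c = t c
      by_cases hc : c ∈ Set.range τ
      · obtain ⟨i, rfl⟩ := hc
        have e1 := hs2 i
        have e2 := ht2 i
        rw [sum_block h.blk_sec] at e1 e2
        have e3 : ∑ c with blk c = i ∧ c ≠ τ i, s c = ∑ c with blk c = i ∧ c ≠ τ i, t c :=
          Finset.sum_congr rfl fun c hc => hst' c (by
            obtain ⟨hc1, hc2⟩ := (Finset.mem_filter.1 hc).2
            exact hne hc1 hc2)
        rw [e3] at e1
        have l1 := hs1 (τ i)
        have l2 := ht1 (τ i)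
        rw [h.two] at l1 l2
        rw [Nat.even_iff] at e1 e2
        omega
      · exact hst' c hc
    · intro a
      let a' : κ → ℕ := fun c => if hc : c ∉ Set.range τ then a ⟨c, hc⟩ else 0
      let s : κ → ℕ := fun c => if c ∈ Set.range τ then
        (∑ e with blk e = blk c ∧ e ≠ τ (blk c), a' e) % 2 else a' c
      have hs : ∀ c, c ∉ Set.range τ → s c = a' c := fun c hc => if_neg hc
      have ha' : ∀ c (hc : c ∉ Set.range τ), a' c = a ⟨c, hc⟩ := fun c hc => dif_pos hc
      have hsτ : ∀ i, s (τ i) = (∑ e with blk e = i ∧ e ≠ τ i, a' e) % 2 := by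
        intro i
        simp only [s, Set.mem_range_self, if_true, h.blk_sec]
      refine ⟨⟨Finsupp.equivFunOnFinite.symm s, ?_, ?_⟩, ?_⟩
      · intro c
        simp only [Finsupp.equivFunOnFinite_symm_apply_apply]
        by_cases hc : c ∈ Set.range τ
        · obtain ⟨i, rfl⟩ := hc
          rw [hsτ, h.two]
          exact Nat.mod_lt _ (by norm_num)
        · rw [hs c hc, ha' c hc]
          exact (a ⟨c, hc⟩).2
      · intro i
        simp only [Finsupp.equivFunOnFinite_symm_apply_apply]
        rw [sum_block h.blk_sec, hsτ]
        have : ∑ c with blk c = i ∧ c ≠ τ i, s c = ∑ c with blk c = i ∧ c ≠ τ i, a' c :=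
          Finset.sum_congr rfl fun c hc => hs c (by
            obtain ⟨hc1, hc2⟩ := (Finset.mem_filter.1 hc).2
            exact hne hc1 hc2)
        rw [this, Nat.even_iff]
        omega
      · funext c
        apply Fin.ext
        simp only [F, Finsupp.equivFunOnFinite_symm_apply_apply]
        rw [hs c c.2, ha' c c.2]
  let e := Equiv.ofBijective F hF
  refine ⟨Fintype.ofEquiv _ e.symm, ?_⟩
  let := Fintype.ofEquiv _ e.symm
  rw [Fintype.card_congr e, Fintype.card_pi]
  refine Finset.prod_induction _ Odd (fun _ _ => Odd.mul) odd_one fun c _ => ?_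
  rw [Fintype.card_fin]
  exact h.odd c c.2

theorem OddSystem.finrank_invFunctionals (h : OddSystem blk τ wt d g) :
    FiniteDimensional ℝ (invFunctionals blk g) ∧
      Odd (Module.finrank ℝ (invFunctionals blk g)) := by
  classical
  obtain ⟨_, hodd⟩ := h.odd_card
  obtain ⟨b, hb⟩ := exists_basis_stdMon h.lead
  let L : invFunctionals blk g →ₗ[ℝ] ({s // RedEven blk d s} → ℝ) :=
    { toFun := fun l s => l.1 (stdMon g d s)
      map_add' := fun _ _ => rfl
      map_smul' := fun _ _ => rfl }
  have hL : Function.Bijective L := by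
    constructor
    · rintro ⟨l, hl⟩ ⟨l', hl'⟩ hll
      refine Subtype.ext (b.ext fun s => ?_)
      rw [hb]
      by_cases hs : RedEven blk d s
      · exact congrFun hll ⟨s, hs⟩
      · exact (h.apply_stdMon_eq_zero hl hs).trans (h.apply_stdMon_eq_zero hl' hs).symm
    · intro a
      let l : Module.Dual ℝ (MvPolynomial κ ℝ) :=
        b.constr ℝ fun s => if hs : RedEven blk d s then a ⟨s, hs⟩ else 0
      have hl : ∀ s, l (stdMon g d s) = if hs : RedEven blk d s then a ⟨s, hs⟩ else 0 := by
        intro s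
        rw [← hb, Module.Basis.constr_basis]
      refine ⟨⟨l, ?_, ?_⟩, ?_⟩
      · intro c q
        have : l ∘ₗ LinearMap.mulLeft ℝ (g c) = 0 := by
          refine b.ext fun s => ?_
          rw [hb, LinearMap.comp_apply, LinearMap.mulLeft_apply, stdMon_mul_eq c s (h.d_pos c), hl,
            dif_neg]
          · rfl
          · intro hs
            have := hs.1 c
            simp at this
        exact LinearMap.congr_fun this q
      · intro η q
        have : l ∘ₗ (flipAlg blk η).toLinearMap = l := by
          refine b.ext fun s => ?_
          rw [hb, LinearMap.comp_apply, AlgHom.toLinearMap_apply, h.flip_stdMon, ← smul_eq_C_mul,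
            map_smul, hl]
          by_cases hs : RedEven blk d s
          · rw [prod_sgn_pow_of_evenBlocks hs.2, one_smul]
          · rw [dif_neg hs, smul_zero]
        exact LinearMap.congr_fun this q
      · funext s
        change l (stdMon g d s) = a s
        rw [hl, dif_pos s.2]
  let e := LinearEquiv.ofBijective L hL
  refine ⟨Module.Finite.equiv e.symm, ?_⟩
  rw [e.finrank_eq, Module.finrank_fintype_fun_eq_card]
  exact hodd

end Algebra

section Algebra

open MvPolynomial

variable {κ ι : Type} [Fintype κ] [Fintype ι] [DecidableEq κ] [DecidableEq ι]

variable {blk : κ → ι} {τ : ι → κ} {wt d : κ → ℕ} {g : κ → MvPolynomial κ ℝ}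

theorem flip_X_mul_X (η : ι → ℤˣ) {c e : κ} (hce : blk c = blk e) :
    flipAlg blk η (X c * X e) = X c * X e := by
  have : (C (sgn (η (blk e))) * C (sgn (η (blk e))) : MvPolynomial κ ℝ) = 1 := by
    rw [← map_mul, sgn_mul_self, map_one]
  simp only [map_mul, flipAlg, aeval_X, hce]
  linear_combination (X c * X e) * this

/-- A common eigenvector of the multiplication operators on invariant functionals. -/
theorem OddSystem.exists_character (h : OddSystem blk τ wt d g) :
    ∃ l ∈ invFunctionals blk g, l ≠ 0 ∧ ∃ M : κ → κ → ℝ, ∀ c e, blk c = blk e →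
      ∀ q, l (X c * X e * q) = M c e * l q := by
  obtain ⟨_, hodd⟩ := h.finrank_invFunctionals
  let J := {p : κ × κ // blk p.1 = blk p.2}
  let m : J → (invFunctionals blk g →ₗ[ℝ] invFunctionals blk g) := fun p =>
    { toFun := fun l => ⟨l.1 ∘ₗ LinearMap.mulLeft ℝ (X p.1.1 * X p.1.2), by
        refine ⟨fun c q => ?_, fun η q => ?_⟩
        · simp only [LinearMap.comp_apply, LinearMap.mulLeft_apply]
          rw [mul_left_comm]
          exact l.2.1 _ _
        · simp only [LinearMap.comp_apply, LinearMap.mulLeft_apply]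
          rw [← flip_X_mul_X η p.2, ← map_mul, l.2.2, flip_X_mul_X η p.2]⟩
      map_add' := fun _ _ => rfl
      map_smul' := fun _ _ => rfl }
  obtain ⟨l, hl, hM⟩ := exists_common_eigenvector _ (invFunctionals blk g) J m
    (fun p q => LinearMap.ext fun l => Subtype.ext (LinearMap.ext fun r => by
      change l.1 (_ * (_ * r)) = l.1 (_ * (_ * r))
      rw [mul_left_comm])) rfl hodd
  choose M hM using hM
  refine ⟨l.1, l.2, fun h0 => hl (Subtype.ext h0),
    fun c e => if hce : blk c = blk e then M ⟨(c, e), hce⟩ else 0, fun c e hce q => ?_⟩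
  beta_reduce
  rw [dif_pos hce]
  exact LinearMap.congr_fun (congrArg Subtype.val (hM ⟨(c, e), hce⟩)) q

theorem exists_rank_one (s : Finset κ) (M : κ → κ → ℝ)
    (hM : ∀ c ∈ s, ∀ e ∈ s, ∀ c' ∈ s, ∀ e' ∈ s, M c c' * M e e' = M c e * M c' e')
    (hs : ∑ c ∈ s, M c c = 1) : ∃ y : κ → ℝ, ∀ c ∈ s, ∀ e ∈ s, y c * y e = M c e := by
  have hnn : ∀ c ∈ s, 0 ≤ M c c := by
    intro c hc
    have : M c c = ∑ e ∈ s, M c c * M e e := by rw [← Finset.mul_sum, hs, mul_one]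
    rw [this]
    refine Finset.sum_nonneg fun e he => ?_
    rw [hM c hc e he c hc e he]
    exact mul_self_nonneg _
  obtain ⟨e, he, hpos⟩ : ∃ e ∈ s, 0 < M e e := by
    by_contra! hcon
    have := Finset.sum_nonpos hcon
    linarith
  refine ⟨fun c => M c e / √(M e e), fun c hc c' hc' => ?_⟩
  rw [div_mul_div_comm, Real.mul_self_sqrt hpos.le, ← hM c hc e he c' hc' e he]
  field_simp

theorem eval_of_character {l : Module.Dual ℝ (MvPolynomial κ ℝ)} {y : κ → ℝ}
    (hl : ∀ c e, blk c = blk e → ∀ q, l (X c * X e * q) = y c * y e * l q) (n : ℕ) :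
    ∀ s : κ →₀ ℕ, s.degree = n → EvenBlocks blk s →
      ∀ q, l (monomial s 1 * q) = eval y (monomial s 1) * l q := by
  induction n using Nat.strong_induction_on with
  | _ n ih =>
    intro s hsn hs q
    by_cases h0 : s = 0
    · subst h0; simp
    · obtain ⟨c, hc⟩ : ∃ c, s c ≠ 0 := by
        by_contra! hcon
        exact h0 (Finsupp.ext hcon)
      have hcs : Finsupp.single c 1 ≤ s := by
        rw [Finsupp.single_le_iff]; omega
      obtain ⟨t, rfl⟩ := exists_add_of_le hcs
      obtain ⟨e, hce, he⟩ : ∃ e, blk e = blk c ∧ t e ≠ 0 := by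
        by_contra! hcon
        have := hs (blk c)
        simp only [Finsupp.coe_add, Pi.add_apply, Finset.sum_add_distrib] at this
        rw [Finset.sum_eq_zero (f := fun x => t x) (fun x hx => hcon x (by simpa using hx)), add_zero,
          Finset.sum_eq_single c (fun b _ hb => Finsupp.single_eq_of_ne hb) (by simp)] at this
        simp at this
      have het : Finsupp.single e 1 ≤ t := by
        rw [Finsupp.single_le_iff]; omega
      obtain ⟨u, rfl⟩ := exists_add_of_le het
      have hu : EvenBlocks blk u := by
        intro i
        have := hs i
        have hsingle : ∀ x, ∑ z with blk z = i, (Finsupp.single x 1 : κ →₀ ℕ) z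
            = if blk x = i then 1 else 0 := by
          intro x
          simp [Finsupp.single_apply]
        simp only [Finsupp.coe_add, Pi.add_apply, Finset.sum_add_distrib] at this
        rw [hsingle, hsingle, hce] at this
        split_ifs at this with hi
        · rw [Nat.even_iff] at this ⊢; omega
        · simpa using this
      have e1 : (monomial (Finsupp.single c 1 + (Finsupp.single e 1 + u)) 1 : MvPolynomial κ ℝ)
          = X c * X e * monomial u 1 := by
        simp [X, monomial_mul, add_assoc]
      simp only [map_add, Finsupp.degree_single] at hsn
      rw [e1, mul_assoc, hl c e hce.symm, ih _ (by omega) u rfl hu, map_mul, map_mul, eval_X, eval_X]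
      ring

theorem support_evenBlocks_of_flip {p : MvPolynomial κ ℝ} (hp : ∀ η, flipAlg blk η p = p)
    {s : κ →₀ ℕ} (hs : s ∈ p.support) : EvenBlocks blk s := by
  by_contra hcon
  obtain ⟨η, hη⟩ := exists_prod_sgn_pow_eq_neg_one hcon
  have key : ∀ q : MvPolynomial κ ℝ, coeff s (flipAlg blk η q) = - coeff s q := by
    intro q
    induction q using MvPolynomial.induction_on' with
    | add p q hp hq => rw [map_add, coeff_add, coeff_add, hp, hq]; ring
    | monomial t a =>
      rw [flipAlg_monomial, coeff_C_mul, coeff_monomial]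
      split_ifs with h
      · rw [h, hη]; ring
      · simp
  have := key p
  rw [hp] at this
  exact (mem_support_iff.1 hs) (by linarith)

theorem OddSystem.exists_zero (h : OddSystem blk τ wt d g) :
    ∃ y : κ → ℝ, (∀ i, ∑ c with blk c = i, y c ^ 2 = 1) ∧
      ∀ c, c ∉ Set.range τ → eval y (g c) = 0 := by
  obtain ⟨l, hl, hl0, M, hM⟩ := h.exists_character
  obtain ⟨q, hq⟩ : ∃ q, l q ≠ 0 := by
    by_contra! hcon
    exact hl0 (LinearMap.ext hcon)
  have hy : ∀ i, ∃ y : κ → ℝ, ∀ c ∈ ({c | blk c = i} : Finset κ),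
      ∀ e ∈ ({c | blk c = i} : Finset κ), y c * y e = M c e := by
    intro i
    refine exists_rank_one _ M ?_ ?_
    · intro c hc e he c' hc' e' he'
      simp only [Finset.mem_filter, Finset.mem_univ, true_and] at hc he hc' he'
      apply mul_right_cancel₀ hq
      have e1 := hM c c' (by rw [hc, hc']) (X e * X e' * q)
      have e2 := hM c e (by rw [hc, he]) (X c' * X e' * q)
      rw [hM e e' (by rw [he, he'])] at e1
      rw [hM c' e' (by rw [he', hc'])] at e2
      rw [mul_assoc, ← e1, mul_assoc (M c e), ← e2]
      congr 1
      ring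
    · have h1 := hl.1 (τ i) q
      rw [h.sphere, sub_mul, one_mul, map_sub, Finset.sum_mul, map_sum, sub_eq_zero] at h1
      apply mul_right_cancel₀ hq
      rw [Finset.sum_mul, one_mul]
      refine Eq.trans (Finset.sum_congr rfl fun c _ => ?_) h1
      rw [← hM c c rfl, sq]
  choose Y hY using hy
  set y : κ → ℝ := fun c => Y (blk c) c with hydef
  have hyM : ∀ c e, blk c = blk e → y c * y e = M c e := by
    intro c e hce
    simp only [hydef, hce]
    exact hY (blk e) c (by simp [hce]) e (by simp)
  have hle : ∀ c e, blk c = blk e → ∀ q, l (X c * X e * q) = y c * y e * l q := by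
    intro c e hce q
    rw [hM c e hce, hyM c e hce]
  have heval : ∀ p : MvPolynomial κ ℝ, (∀ η, flipAlg blk η p = p) →
      l (p * q) = eval y p * l q := by
    intro p hp
    conv_lhs => rw [p.as_sum]
    conv_rhs => rw [p.as_sum]
    rw [Finset.sum_mul, map_sum, map_sum, Finset.sum_mul]
    refine Finset.sum_congr rfl fun s hs => ?_
    have := eval_of_character hle _ s rfl (support_evenBlocks_of_flip hp hs) q
    have e1 : (monomial s (coeff s p) : MvPolynomial κ ℝ) = coeff s p • monomial s 1 := by
      rw [smul_monomial, smul_eq_mul, mul_one]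
    rw [e1, smul_mul_assoc, map_smul, this, smul_eval]
    simp only [smul_eq_mul]; ring
  have hsph : ∀ i, ∑ c with blk c = i, y c ^ 2 = 1 := by
    intro i
    have h2 := heval (g (τ i)) (h.flip_sphere i)
    rw [hl.1] at h2
    have h3 := (mul_eq_zero.1 h2.symm).resolve_right hq
    rw [h.sphere] at h3
    simp only [map_sub, map_sum, map_pow, eval_X, map_one] at h3
    linarith
  refine ⟨y, hsph, fun c hc => ?_⟩
  obtain ⟨e, he, hye⟩ : ∃ e, blk e = blk c ∧ y e ≠ 0 := by
    by_contra! hcon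
    have := hsph (blk c)
    rw [Finset.sum_eq_zero] at this
    · norm_num at this
    · intro e he
      rw [hcon e (by simpa using he)]; norm_num
  have h2 := heval (g c * X e) (fun η => by
    rw [map_mul, h.flip c hc]
    have : (C (sgn (η (blk c))) * C (sgn (η (blk c))) : MvPolynomial κ ℝ) = 1 := by
      rw [← map_mul, sgn_mul_self, map_one]
    simp only [flipAlg, aeval_X, he]
    linear_combination (g c * X e) * this)
  rw [mul_assoc, hl.1] at h2
  have h3 := (mul_eq_zero.1 h2.symm).resolve_right hq
  rw [map_mul, eval_X] at h3
  exact (mul_eq_zero.1 h3).resolve_right hye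

/-- Polynomial Borsuk-Ulam for products of spheres, approximate form. -/
theorem exists_small_of_poly (blk : κ → ι) (τ : ι → κ) (hτ : ∀ i, blk (τ i) = i)
    (p : κ → MvPolynomial κ ℝ)
    (hp : ∀ c, c ∉ Set.range τ → ∀ η, flipAlg blk η (p c) = C (sgn (η (blk c))) * p c)
    (K : ℝ) (hK : 0 < K) :
    ∃ y : κ → ℝ, (∀ i, ∑ c with blk c = i, y c ^ 2 = 1) ∧
      ∀ c, c ∉ Set.range τ → |eval y (p c)| ≤ 1 / K := by
  classical
  let wt : κ → ℕ := fun c => if c ∈ Set.range τ then 2 else 1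
  have hwt1 : ∀ c, c ∉ Set.range τ → wt c = 1 := fun c hc => if_neg hc
  have hwt2 : ∀ i, wt (τ i) = 2 := fun i => if_pos ⟨i, rfl⟩
  obtain ⟨D, hD⟩ : ∃ D : ℕ, ∀ c, ∀ t ∈ (p c).support, Finsupp.weight wt t < D := by
    refine ⟨(Finset.univ.sup fun c => (p c).support.sup fun t => Finsupp.weight wt t) + 1,
      fun c t ht => Nat.lt_succ_of_le ?_⟩
    exact (Finset.le_sup (f := fun t => Finsupp.weight wt t) ht).trans
      (Finset.le_sup (f := fun c => (p c).support.sup fun t => Finsupp.weight wt t)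
        (Finset.mem_univ c))
  let d : κ → ℕ := fun c => if c ∈ Set.range τ then 2 else 2 * D + 1
  have hd1 : ∀ c, c ∉ Set.range τ → d c = 2 * D + 1 := fun c hc => if_neg hc
  have hd2 : ∀ i, d (τ i) = 2 := fun i => if_pos ⟨i, rfl⟩
  let g : κ → MvPolynomial κ ℝ := fun c => if c ∈ Set.range τ then
    (∑ e with blk e = blk c, X e ^ 2) - 1 else X c ^ (2 * D + 1) + C K * p c
  have hg1 : ∀ c, c ∉ Set.range τ → g c = X c ^ (2 * D + 1) + C K * p c := fun c hc => if_neg hc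
  have hg2 : ∀ i, g (τ i) = (∑ e with blk e = i, X e ^ 2) - 1 := fun i => by
    simp only [g, Set.mem_range_self, if_true, hτ]
  have hodd : Odd (2 * D + 1) := ⟨D, rfl⟩
  have hsys : OddSystem blk τ wt d g := by
    refine ⟨hτ, ?_, hd2, fun c hc => by rw [hd1 c hc]; exact hodd, hg2, ?_⟩
    · intro c
      by_cases hc : c ∈ Set.range τ
      · obtain ⟨i, rfl⟩ := hc
        intro t ht
        rw [Finsupp.weight_single, hd2, hwt2]
        rw [hg2, ← Finset.add_sum_erase _ _ (show τ i ∈ ({c | blk c = i} : Finset κ) by simp [hτ]),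
          hd2, show (monomial (Finsupp.single (τ i) 2) 1 : MvPolynomial κ ℝ) = X (τ i) ^ 2 by
            rw [X_pow_eq_monomial], add_sub_assoc, add_sub_cancel_left] at ht
        rcases Finset.mem_union.1 (support_sub κ _ _ ht) with ht | ht
        · obtain ⟨e, he, ht⟩ := Finset.mem_biUnion.1 (support_sum ht)
          rw [X_pow_eq_monomial] at ht
          have := Finset.mem_singleton.1 (support_monomial_subset ht)
          subst this
          rw [Finsupp.weight_single, hwt1 e]
          · norm_num
          · rintro ⟨j, rfl⟩
            simp only [Finset.mem_erase, Finset.mem_filter, Finset.mem_univ, true_and, hτ] at he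
            exact he.1 (by rw [he.2])
        · rw [← C_1, C_apply] at ht
          have := Finset.mem_singleton.1 (support_monomial_subset ht)
          subst this
          simp
      · intro t ht
        rw [Finsupp.weight_single, hd1 c hc, hwt1 c hc]
        rw [hg1 c hc, hd1 c hc, show (monomial (Finsupp.single c (2 * D + 1)) 1 : MvPolynomial κ ℝ)
          = X c ^ (2 * D + 1) by rw [X_pow_eq_monomial], add_sub_cancel_left] at ht
        have ht' : t ∈ (p c).support := by
          rw [mem_support_iff, coeff_C_mul] at ht
          exact mem_support_iff.2 (right_ne_zero_of_mul ht)
        have := hD c t ht'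
        simp only [smul_eq_mul]
        omega
    · intro c hc η
      rw [hg1 c hc, map_add, map_mul, hp c hc η, map_pow]
      have : flipAlg blk η (C K) = C K := by simp [flipAlg]
      rw [this]
      have hX : flipAlg blk η (X c) = C (sgn (η (blk c))) * X c := by simp [flipAlg]
      rw [hX, mul_pow, ← map_pow, sgn_pow_odd _ hodd]
      ring
  obtain ⟨y, hy1, hy2⟩ := hsys.exists_zero
  refine ⟨y, hy1, fun c hc => ?_⟩
  have h1 := hy2 c hc
  rw [hg1 c hc] at h1
  simp only [map_add, map_pow, map_mul, eval_X, eval_C] at h1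
  have h2 : |y c| ≤ 1 := by
    rw [abs_le_one_iff_mul_self_le_one, ← hy1 (blk c), ← sq]
    exact Finset.single_le_sum (f := fun e => y e ^ 2) (fun e _ => sq_nonneg _) (by simp)
  have h3 : |y c ^ (2 * D + 1)| ≤ 1 := by rw [abs_pow]; exact pow_le_one₀ (abs_nonneg _) h2
  rw [le_div_iff₀ hK, ← abs_of_pos hK, ← abs_mul, mul_comm, eq_neg_of_add_eq_zero_right h1, abs_neg]
  exact h3

end Algebra

section BorsukUlam

variable {κ ι : Type} [Fintype κ] [Fintype ι] [DecidableEq κ] [DecidableEq ι]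

/-- The product of unit spheres associated with a partition of the coordinates into blocks. -/
def sphProd (blk : κ → ι) : Set (κ → ℝ) := {y | ∀ i, ∑ c with blk c = i, y c ^ 2 = 1}

theorem isCompact_sphProd (blk : κ → ι) : IsCompact (sphProd blk) := by
  refine Metric.isCompact_of_isClosed_isBounded ?_ ?_
  · simp only [sphProd, Set.ofPred_forall]
    exact isClosed_iInter fun i => isClosed_eq (by fun_prop) continuous_const
  · refine (Metric.isBounded_closedBall (x := (0 : κ → ℝ)) (r := 1)).subset fun y hy => ?_
    rw [mem_closedBall_zero_iff, pi_norm_le_iff_of_nonneg zero_le_one]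
    intro c
    rw [Real.norm_eq_abs, abs_le_one_iff_mul_self_le_one, ← hy (blk c), ← sq]
    exact Finset.single_le_sum (f := fun e => y e ^ 2) (fun e _ => sq_nonneg _) (by simp)

theorem sgn_sq (u : ℤˣ) : sgn u ^ 2 = 1 := by rw [sq, sgn_mul_self]

theorem abs_sgn (u : ℤˣ) : |sgn u| = 1 := by
  rw [← sq_eq_sq₀ (abs_nonneg _) zero_le_one, sq_abs, sgn_sq, one_pow]

theorem flip_mem_sphProd {blk : κ → ι} {y : κ → ℝ} (hy : y ∈ sphProd blk) (η : ι → ℤˣ) :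
    (fun c => sgn (η (blk c)) * y c) ∈ sphProd blk := fun i => by
  simp only [mul_pow, sgn_sq, one_mul]
  exact hy i

open MvPolynomial in
theorem exists_poly_near {X : Set (κ → ℝ)} (hX : IsCompact X) {f : (κ → ℝ) → ℝ}
    (hf : ContinuousOn f X) {ε : ℝ} (hε : 0 < ε) :
    ∃ p : MvPolynomial κ ℝ, ∀ y ∈ X, |eval y p - f y| < ε := by
  have : CompactSpace X := isCompact_iff_compactSpace.1 hX
  let co : κ → C(X, ℝ) := fun c => ⟨fun y => y.1 c, (continuous_apply c).comp continuous_subtype_val⟩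
  let A : Subalgebra ℝ C(X, ℝ) := (aeval co : MvPolynomial κ ℝ →ₐ[ℝ] C(X, ℝ)).range
  have hA : A.SeparatesPoints := by
    intro x y hxy
    obtain ⟨c, hc⟩ : ∃ c, x.1 c ≠ y.1 c := by
      by_contra! h
      exact hxy (Subtype.ext (funext h))
    exact ⟨co c, ⟨co c, ⟨MvPolynomial.X c, by simp⟩, rfl⟩, hc⟩
  obtain ⟨⟨_, p, rfl⟩, hp⟩ :=
    ContinuousMap.exists_mem_subalgebra_near_continuous_of_separatesPoints A hA
      (X.domRestrict f) (continuousOn_iff_continuous_domRestrict.1 hf) ε hε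
  refine ⟨p, fun y hy => ?_⟩
  have h1 := hp ⟨y, hy⟩
  have h2 : ∀ q : MvPolynomial κ ℝ, (aeval co q : C(X, ℝ)) ⟨y, hy⟩ = eval y q := by
    intro q
    induction q using MvPolynomial.induction_on with
    | C a => simp
    | add p q hp hq => simp [hp, hq]
    | mul_X p c hp => simp [hp, co]
  rw [← h2]
  exact h1

open MvPolynomial in
theorem exists_odd_poly_near (blk : κ → ι) {f : (κ → ℝ) → ℝ} {i : ι}
    (hf : ContinuousOn f (sphProd blk))
    (hodd : ∀ y ∈ sphProd blk, ∀ η : ι → ℤˣ,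
      f (fun c => sgn (η (blk c)) * y c) = sgn (η i) * f y) {ε : ℝ} (hε : 0 < ε) :
    ∃ p : MvPolynomial κ ℝ, (∀ y ∈ sphProd blk, |eval y p - f y| ≤ ε) ∧
      ∀ η, flipAlg blk η p = C (sgn (η i)) * p := by
  obtain ⟨p, hp⟩ := exists_poly_near (isCompact_sphProd blk) hf hε
  set N : ℝ := ((Fintype.card (ι → ℤˣ) : ℕ) : ℝ) with hN
  have hNpos : 0 < N := by rw [hN]; exact_mod_cast Fintype.card_pos
  refine ⟨C N⁻¹ * ∑ η : ι → ℤˣ, C (sgn (η i)) * flipAlg blk η p, fun y hy => ?_, fun θ => ?_⟩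
  · have e : eval y (C N⁻¹ * ∑ η : ι → ℤˣ, C (sgn (η i)) * flipAlg blk η p) - f y =
        N⁻¹ * ∑ η : ι → ℤˣ, sgn (η i) * (eval (fun c => sgn (η (blk c)) * y c) p
          - f (fun c => sgn (η (blk c)) * y c)) := by
      simp only [hodd y hy, map_mul, map_sum, eval_C, eval_flipAlg, mul_sub, Finset.sum_sub_distrib,
        ← mul_assoc, sgn_mul_self, one_mul, Finset.sum_const, Finset.card_univ, nsmul_eq_mul]
      rw [← hN, inv_mul_cancel₀ hNpos.ne', one_mul]
    rw [e, abs_mul, abs_of_pos (inv_pos.2 hNpos), inv_mul_le_iff₀ hNpos]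
    refine (Finset.abs_sum_le_sum_abs _ _).trans ?_
    refine (Finset.sum_le_card_nsmul _ _ ε fun η _ => ?_).trans (by
      rw [Finset.card_univ, nsmul_eq_mul])
    rw [abs_mul, abs_sgn, one_mul]
    exact (hp _ (flip_mem_sphProd hy η)).le
  · have hC : ∀ a : ℝ, flipAlg blk θ (C a) = C a := fun a => by simp [flipAlg]
    rw [map_mul, map_sum, hC, mul_left_comm]
    congr 1
    rw [Finset.mul_sum, ← Equiv.sum_comp (Equiv.mulLeft θ) fun η =>
      C (sgn (θ i)) * (C (sgn (η i)) * flipAlg blk η p)]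
    refine Finset.sum_congr rfl fun η _ => ?_
    rw [Equiv.coe_mulLeft]
    beta_reduce
    rw [map_mul, hC, flipAlg_flipAlg, Pi.mul_apply, sgn_mul, map_mul, ← mul_assoc,
      ← mul_assoc, ← map_mul C, ← map_mul C, sgn_mul_self, one_mul]

/-- The Borsuk-Ulam theorem for products of spheres. -/
theorem borsuk_ulam_sphProd (blk : κ → ι) (τ : ι → κ) (hτ : ∀ i, blk (τ i) = i)
    (f : κ → (κ → ℝ) → ℝ)
    (hf : ∀ c, c ∉ range τ → ContinuousOn (f c) (sphProd blk))
    (hodd : ∀ c, c ∉ range τ → ∀ y ∈ sphProd blk, ∀ η : ι → ℤˣ,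
      f c (fun e => sgn (η (blk e)) * y e) = sgn (η (blk c)) * f c y) :
    ∃ y ∈ sphProd blk, ∀ c, c ∉ range τ → f c y = 0 := by
  classical
  have happ : ∀ n : ℕ, ∃ y ∈ sphProd blk, ∀ c, c ∉ range τ → |f c y| ≤ 2 / (n + 1) := by
    intro n
    have hn : (0 : ℝ) < 1 / (n + 1) := by positivity
    have : ∀ c, ∃ p : MvPolynomial κ ℝ, c ∉ range τ →
        (∀ y ∈ sphProd blk, |MvPolynomial.eval y p - f c y| ≤ 1 / (n + 1)) ∧
        ∀ η, flipAlg blk η p = MvPolynomial.C (sgn (η (blk c))) * p := by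
      intro c
      by_cases hc : c ∈ range τ
      · exact ⟨0, fun h => (h hc).elim⟩
      · obtain ⟨p, hp⟩ := exists_odd_poly_near blk (hf c hc) (hodd c hc) hn
        exact ⟨p, fun _ => hp⟩
    choose p hp using this
    obtain ⟨y, hy, hyp⟩ := exists_small_of_poly blk τ hτ p (fun c hc => (hp c hc).2) (n + 1)
      (by positivity)
    refine ⟨y, hy, fun c hc => ?_⟩
    have h1 := (hp c hc).1 y hy
    have h2 := hyp c hc
    have e : (2 : ℝ) / (n + 1) = 1 / (n + 1) + 1 / (n + 1) := by ring
    rw [e]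
    rw [abs_le] at *
    constructor <;> linarith
  obtain ⟨y0, hy0, -⟩ := happ 0
  set S : Finset κ := {c | c ∉ range τ} with hS
  have hcont : ContinuousOn (fun y => ∑ c ∈ S, |f c y|) (sphProd blk) :=
    continuousOn_finsetSum _ fun c hc => (hf c (by simpa [hS] using hc)).abs
  obtain ⟨y, hy, hmin⟩ := (isCompact_sphProd blk).exists_isMinOn ⟨y0, hy0⟩ hcont
  refine ⟨y, hy, ?_⟩
  have hle : ∀ n : ℕ, ∑ c ∈ S, |f c y| ≤ S.card * 2 / (n + 1) := by
    intro n
    obtain ⟨z, hz, hzf⟩ := happ n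
    refine (hmin hz).trans ?_
    refine (Finset.sum_le_card_nsmul _ _ _ fun c hc => hzf c (by simpa [hS] using hc)).trans ?_
    rw [nsmul_eq_mul, mul_div_assoc]
  have hlim : Tendsto (fun n : ℕ => (S.card * 2 / (n + 1) : ℝ)) atTop (nhds 0) :=
    by
      have := (tendsto_const_div_atTop_nhds_zero_nat (S.card * 2 : ℝ)).comp (tendsto_add_atTop_nat 1)
      refine this.congr fun n => ?_
      simp
  have h0 := ge_of_tendsto' hlim hle
  have h1 : ∑ c ∈ S, |f c y| = 0 := le_antisymm h0 (Finset.sum_nonneg fun _ _ => abs_nonneg _)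
  rw [Finset.sum_eq_zero_iff_of_nonneg fun _ _ => abs_nonneg _] at h1
  intro c hc
  exact abs_eq_zero.1 (h1 c (by simpa [hS] using hc))

theorem continuousOn_mul_of_bounded {Z : Type} [TopologicalSpace Z] {X : Set Z} {t G : Z → ℝ}
    (ht : Continuous t) (hG : ContinuousOn G (X ∩ {z | t z ≠ 0})) {C : ℝ}
    (hb : ∀ z ∈ X, |G z| ≤ C) : ContinuousOn (fun z => t z * G z) X := by
  intro z hz
  by_cases h : t z = 0
  · rw [ContinuousWithinAt, h, zero_mul]
    refine squeeze_zero_norm' (a := fun z => |t z| * C) ?_ ?_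
    · filter_upwards [self_mem_nhdsWithin] with w hw
      rw [norm_mul, Real.norm_eq_abs, Real.norm_eq_abs]
      exact mul_le_mul_of_nonneg_left (hb w hw) (abs_nonneg _)
    · have : Tendsto (fun z => |t z| * C) (nhds z) (nhds (|t z| * C)) :=
        (ht.abs.mul continuous_const).tendsto z
      rw [h, abs_zero, zero_mul] at this
      exact this.mono_left nhdsWithin_le_nhds
  · refine ht.continuousWithinAt.mul ?_
    have h1 := hG z ⟨hz, h⟩
    have ho : {z | t z ≠ 0} ∈ nhds z := (isOpen_ne_fun ht continuous_const).mem_nhds h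
    exact (continuousWithinAt_inter ho).1 h1

/-- A Borsuk-Ulam theorem on the product of spheres and a vector space, for maps that are a bounded
perturbation of the identity in the vector space directions. -/
theorem borsuk_ulam_sphProd_prod {δ : Type} [Fintype δ] [DecidableEq δ]
    (blk : κ → ι) (τ : ι → κ) (hτ : ∀ i, blk (τ i) = i)
    (F : κ → (κ → ℝ) × (δ → ℝ) → ℝ) (G : δ → (κ → ℝ) × (δ → ℝ) → ℝ) (C : ℝ)
    (hF : ∀ c, c ∉ range τ → ContinuousOn (F c) (sphProd blk ×ˢ univ))
    (hG : ∀ j, ContinuousOn (G j) (sphProd blk ×ˢ univ))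
    (hFodd : ∀ c, c ∉ range τ → ∀ u ∈ sphProd blk, ∀ y, ∀ η : ι → ℤˣ,
      F c (fun e => sgn (η (blk e)) * u e, y) = sgn (η (blk c)) * F c (u, y))
    (hGeven : ∀ j, ∀ u ∈ sphProd blk, ∀ y, ∀ η : ι → ℤˣ,
      G j (fun e => sgn (η (blk e)) * u e, y) = G j (u, y))
    (hFb : ∀ c, c ∉ range τ → ∀ u ∈ sphProd blk, ∀ y, |F c (u, y)| ≤ C)
    (hGb : ∀ j, ∀ u ∈ sphProd blk, ∀ y, |G j (u, y) - y j| ≤ C) :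
    ∃ u ∈ sphProd blk, ∃ y, (∀ c, c ∉ range τ → F c (u, y) = 0) ∧ ∀ j, G j (u, y) = 0 := by
  classical
  let blk' : κ ⊕ Option δ → Option ι := Sum.elim (fun c => some (blk c)) fun _ => none
  let τ' : Option ι → κ ⊕ Option δ := fun i => i.elim (Sum.inr none) fun i => Sum.inl (τ i)
  have hτ' : ∀ i, blk' (τ' i) = i := by
    rintro (_ | i)
    · rfl
    · simp [blk', τ', hτ]
  let t : (κ ⊕ Option δ → ℝ) → ℝ := fun z => z (Sum.inr none)
  let P : (κ ⊕ Option δ → ℝ) → (κ → ℝ) × (δ → ℝ) := fun z =>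
    (fun c => z (Sum.inl c), fun j => z (Sum.inr (some j)) / t z)
  let f : κ ⊕ Option δ → (κ ⊕ Option δ → ℝ) → ℝ := fun c z =>
    c.elim (fun c => t z * (t z * F c (P z))) fun j => j.elim 0 fun j =>
      z (Sum.inr (some j)) + t z * (G j (P z) - z (Sum.inr (some j)) / t z)
  have ht : Continuous t := by fun_prop
  have hP : ContinuousOn P {z | t z ≠ 0} := by
    refine ContinuousOn.prodMk (by fun_prop) (continuousOn_pi.2 fun j => ?_)
    exact ContinuousOn.div (by fun_prop) ht.continuousOn fun z hz => hz
  have hXs : ∀ z ∈ sphProd blk', (fun c => z (Sum.inl c)) ∈ sphProd blk := by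
    intro z hz i
    have := hz (some i)
    simpa [Finset.sum_filter, blk'] using this
  have hXn : ∀ z ∈ sphProd blk', t z ^ 2 + ∑ j, z (Sum.inr (some j)) ^ 2 = 1 := by
    intro z hz
    have := hz none
    simpa [Finset.sum_filter, blk', Fintype.sum_option] using this
  have hXP : MapsTo P (sphProd blk' ∩ {z | t z ≠ 0}) (sphProd blk ×ˢ univ) :=
    fun z hz => ⟨hXs z hz.1, trivial⟩
  have hr : ∀ c, Sum.inl c ∉ range τ' → c ∉ range τ := by
    rintro c hc ⟨i, rfl⟩
    exact hc ⟨some i, rfl⟩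
  have ht1 : ∀ z ∈ sphProd blk', |t z| ≤ 1 := by
    intro z hz
    rw [abs_le_one_iff_mul_self_le_one, ← sq, ← hXn z hz]
    have := Finset.sum_nonneg fun (j : δ) (_ : j ∈ Finset.univ) => sq_nonneg (z (Sum.inr (some j)))
    linarith
  have hPflip : ∀ z (η : Option ι → ℤˣ), P (fun e => sgn (η (blk' e)) * z e) =
      (fun e => sgn (η (some (blk e))) * (P z).1 e, (P z).2) := by
    intro z η
    refine Prod.ext rfl (funext fun j => ?_)
    have : sgn (η none) ≠ 0 := fun h => by have := sgn_sq (η none); rw [h] at this; norm_num at this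
    exact mul_div_mul_left _ _ this
  have hcont : ∀ c, c ∉ range τ' → ContinuousOn (f c) (sphProd blk') := by
    rintro (c | _ | j) hc
    · simp only [f, Sum.elim_inl]
      refine continuousOn_mul_of_bounded ht (C := C) ?_ ?_
      · exact ht.continuousOn.mul
          ((hF c (hr c hc)).comp (hP.mono inter_subset_right) hXP)
      · intro z hz
        rw [abs_mul]
        have h1 := hFb c (hr c hc) _ (hXs z hz) (P z).2
        have h2 := mul_le_mul (ht1 z hz) h1 (abs_nonneg _) zero_le_one
        rw [one_mul] at h2
        exact h2
    · exact (hc ⟨none, rfl⟩).elim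
    · simp only [f, Sum.elim_inr, Option.elim_some]
      refine ContinuousOn.add (by fun_prop) (continuousOn_mul_of_bounded ht (C := C) ?_ ?_)
      · refine ((hG j).comp (hP.mono inter_subset_right) hXP).sub ?_
        exact ContinuousOn.div (by fun_prop) ht.continuousOn fun z hz => hz.2
      · exact fun z hz => hGb j _ (hXs z hz) (P z).2
  have hodd : ∀ c, c ∉ range τ' → ∀ y ∈ sphProd blk', ∀ η : Option ι → ℤˣ,
      f c (fun e => sgn (η (blk' e)) * y e) = sgn (η (blk' c)) * f c y := by
    rintro (c | _ | j) hc z hz η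
    · simp only [f, Sum.elim_inl, hPflip]
      rw [hFodd c (hr c hc) _ (hXs z hz) (P z).2 (fun i => η (some i))]
      change sgn (η none) * t z * (sgn (η none) * t z * _) = sgn (η (some (blk c))) * _
      have := sgn_mul_self (η none)
      linear_combination (t z * t z * sgn (η (some (blk c))) * F c (P z)) * this
    · exact (hc ⟨none, rfl⟩).elim
    · simp only [f, Sum.elim_inr, Option.elim_some, hPflip]
      rw [hGeven j _ (hXs z hz) (P z).2 (fun i => η (some i))]
      change sgn (η none) * _ + sgn (η none) * t z * (_ - sgn (η none) * _ / (sgn (η none) * t z))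
        = sgn (η none) * _
      have : sgn (η none) ≠ 0 := fun h => by have := sgn_sq (η none); rw [h] at this; norm_num at this
      rw [mul_div_mul_left _ _ this]
      ring
  obtain ⟨z, hz, hzero⟩ := borsuk_ulam_sphProd blk' τ' hτ' f hcont hodd
  have htz : t z ≠ 0 := by
    intro h0
    have h1 : ∀ j, z (Sum.inr (some j)) = 0 := by
      intro j
      have := hzero (Sum.inr (some j)) (by rintro ⟨_ | i, hi⟩ <;> simp [τ'] at hi)
      simpa [f, h0] using this
    have := hXn z hz
    simp [h0, h1] at this
  refine ⟨(P z).1, hXs z hz, (P z).2, fun c hc => ?_, fun j => ?_⟩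
  · have := hzero (Sum.inl c) (by
      rintro ⟨_ | i, hi⟩
      · simp [τ'] at hi
      · exact hc ⟨i, by simpa [τ'] using hi⟩)
    simpa [f, htz] using this
  · have := hzero (Sum.inr (some j)) (by rintro ⟨_ | i, hi⟩ <;> simp [τ'] at hi)
    simp only [f, Sum.elim_inr, Option.elim_some] at this
    rw [mul_sub, mul_div_cancel₀ _ htz, add_sub_cancel] at this
    exact (mul_eq_zero.1 this).resolve_left htz

end BorsukUlam

section Euler

variable {Λ ι : Type} [Fintype Λ] [Fintype ι] [DecidableEq ι]

/-- The inner product restricted to the `i`-th block of coordinates. -/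
def blockInner (blk : Λ → Option ι) (i : ι) (x y : EuclideanSpace ℝ Λ) : ℝ :=
  ∑ α, if blk α = some i then x α * y α else 0

/-- The diagonal operator with eigenvalues `ω`. -/
def diagMul (ω : Λ → ℝ) (x : EuclideanSpace ℝ Λ) : EuclideanSpace ℝ Λ :=
  WithLp.toLp 2 fun α => ω α * x α

/-- Multiplication of each block by a sign. -/
def blockFlip (blk : Λ → Option ι) (η : ι → ℤˣ) (x : EuclideanSpace ℝ Λ) : EuclideanSpace ℝ Λ :=
  WithLp.toLp 2 fun α => (blk α).elim 1 (fun i => sgn (η i)) * x α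

/-- The Lagrange multiplier of the `i`-th sphere. -/
def multiplier (blk : Λ → Option ι) (R : ℝ) (D x : EuclideanSpace ℝ Λ) (i : ι) : ℝ :=
  blockInner blk i D x / max (blockInner blk i x x) R

/-- The component of `D` tangent to the product of spheres through `x`. -/
def tangential (blk : Λ → Option ι) (R : ℝ) (D x : EuclideanSpace ℝ Λ) : EuclideanSpace ℝ Λ :=
  WithLp.toLp 2 fun α => D α - (blk α).elim 0 (multiplier blk R D x) * x α

/-- The sum of the absolute values of the quadratic actions of the blocks. -/
def blockAction (blk : Λ → Option ι) (ω : Λ → ℝ) (x : EuclideanSpace ℝ Λ) : ℝ :=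
  ∑ i, |blockInner blk i (diagMul ω x) x / 2|

/-- Continuous cutoff, equal to `1` below `C` and to `0` above `2 C`. -/
def ramp (C q : ℝ) : ℝ := max 0 (min 1 ((2 * C - q) / C))

/-- The deformation vector field. -/
def deformField (blk : Λ → Option ι) (ω : Λ → ℝ) (R μ C : ℝ) (B : EuclideanSpace ℝ Λ → ℝ)
    (D : EuclideanSpace ℝ Λ → EuclideanSpace ℝ Λ) (x : EuclideanSpace ℝ Λ) : EuclideanSpace ℝ Λ :=
  (-(ramp C (blockAction blk ω x) * B x) / (max ‖tangential blk R (D x) x‖ μ) ^ 2) •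
    tangential blk R (D x) x

variable {blk : Λ → Option ι} {ω : Λ → ℝ} {R : ℝ}

theorem blockInner_add_left (i : ι) (x y z : EuclideanSpace ℝ Λ) :
    blockInner blk i (x + y) z = blockInner blk i x z + blockInner blk i y z := by
  simp only [blockInner, ← Finset.sum_add_distrib, PiLp.add_apply]
  refine Finset.sum_congr rfl fun α _ => ?_
  split_ifs <;> ring

theorem blockInner_smul_left (i : ι) (c : ℝ) (x z : EuclideanSpace ℝ Λ) :
    blockInner blk i (c • x) z = c * blockInner blk i x z := by
  simp only [blockInner, Finset.mul_sum, PiLp.smul_apply, smul_eq_mul]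
  refine Finset.sum_congr rfl fun α _ => ?_
  split_ifs <;> ring

theorem blockInner_comm (i : ι) (x y : EuclideanSpace ℝ Λ) :
    blockInner blk i x y = blockInner blk i y x := by
  simp only [blockInner, mul_comm]

theorem blockInner_add_right (i : ι) (x y z : EuclideanSpace ℝ Λ) :
    blockInner blk i z (x + y) = blockInner blk i z x + blockInner blk i z y := by
  rw [blockInner_comm, blockInner_add_left, blockInner_comm, blockInner_comm i y]

theorem blockInner_smul_right (i : ι) (c : ℝ) (x z : EuclideanSpace ℝ Λ) :
    blockInner blk i z (c • x) = c * blockInner blk i z x := by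
  rw [blockInner_comm, blockInner_smul_left, blockInner_comm]

theorem blockInner_self_nonneg (i : ι) (x : EuclideanSpace ℝ Λ) : 0 ≤ blockInner blk i x x :=
  Finset.sum_nonneg fun α _ => by split_ifs; exacts [mul_self_nonneg _, le_rfl]

theorem inner_eq_sum_mul (x y : EuclideanSpace ℝ Λ) : inner ℝ x y = ∑ α, x α * y α := by
  rw [PiLp.inner_apply]
  exact Finset.sum_congr rfl fun α _ => by simp [mul_comm]

theorem sum_ite_blk_le (a : Λ → ℝ) (ha : ∀ α, 0 ≤ a α) :
    ∑ i : ι, ∑ α, (if blk α = some i then a α else 0) ≤ ∑ α, a α := by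
  rw [Finset.sum_comm]
  refine Finset.sum_le_sum fun α _ => ?_
  rcases h : blk α with _ | i
  · simpa using ha α
  · simp

theorem blockInner_self_le (i : ι) (x : EuclideanSpace ℝ Λ) : blockInner blk i x x ≤ ‖x‖ ^ 2 := by
  rw [EuclideanSpace.real_norm_sq_eq]
  refine Finset.sum_le_sum fun α _ => ?_
  split_ifs
  · rw [sq]
  · positivity

theorem sum_abs_blockInner_le (x y : EuclideanSpace ℝ Λ) :
    ∑ i, |blockInner blk i x y| ≤ ‖x‖ * ‖y‖ := by
  calc ∑ i, |blockInner blk i x y|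
      ≤ ∑ i, ∑ α, (if blk α = some i then |x α| * |y α| else 0) := by
        refine Finset.sum_le_sum fun i _ => (Finset.abs_sum_le_sum_abs _ _).trans
          (Finset.sum_le_sum fun α _ => ?_)
        split_ifs <;> simp [abs_mul]
    _ ≤ ∑ α, |x α| * |y α| := sum_ite_blk_le (blk := blk) (fun α => |x α| * |y α|) fun α => by positivity
    _ ≤ √(∑ α, |x α| ^ 2) * √(∑ α, |y α| ^ 2) := Real.sum_mul_le_sqrt_mul_sqrt _ _ _
    _ = ‖x‖ * ‖y‖ := by rw [EuclideanSpace.norm_eq, EuclideanSpace.norm_eq]; rfl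

theorem blockInner_tangential (hR : 0 < R) (D x : EuclideanSpace ℝ Λ) (i : ι)
    (hx : R ≤ blockInner blk i x x) : blockInner blk i (tangential blk R D x) x = 0 := by
  have h1 : blockInner blk i (tangential blk R D x) x
      = blockInner blk i D x - multiplier blk R D x i * blockInner blk i x x := by
    simp only [blockInner, tangential, Finset.mul_sum, ← Finset.sum_sub_distrib]
    refine Finset.sum_congr rfl fun α _ => ?_
    split_ifs with h
    · simp only [h, Option.elim]; ring
    · simp
  rw [h1, multiplier, max_eq_left hx, div_mul_cancel₀ _ (by linarith), sub_self]

theorem inner_tangential (hR : 0 < R) (D x : EuclideanSpace ℝ Λ)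
    (hx : ∀ i : ι, R ≤ blockInner blk i x x) :
    inner ℝ D (tangential blk R D x) = ‖tangential blk R D x‖ ^ 2 := by
  have key : inner ℝ (D - tangential blk R D x) (tangential blk R D x) = 0 := by
    rw [inner_eq_sum_mul]
    have : ∀ α, (D - tangential blk R D x) α * tangential blk R D x α
        = ∑ i : ι, if blk α = some i then
          multiplier blk R D x i * (tangential blk R D x α * x α) else 0 := by
      intro α
      have h0 : (D - tangential blk R D x) α = (blk α).elim 0 (multiplier blk R D x) * x α := by
        rw [PiLp.sub_apply, tangential]; exact sub_sub_cancel _ _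
      rw [h0]
      rcases h : blk α with _ | i
      · simp
      · simp only [Option.elim, Option.some.injEq, Finset.sum_ite_eq, Finset.mem_univ, if_true]
        ring
    rw [Finset.sum_congr rfl fun α _ => this α, Finset.sum_comm]
    refine Finset.sum_eq_zero fun i _ => ?_
    have h2 := blockInner_tangential hR D x i (hx i)
    have : multiplier blk R D x i * blockInner blk i (tangential blk R D x) x = 0 := by rw [h2, mul_zero]
    refine Eq.trans ?_ this
    rw [blockInner, Finset.mul_sum]
    refine Finset.sum_congr rfl fun α _ => ?_
    split_ifs <;> ring
  rw [inner_sub_left, real_inner_self_eq_norm_sq] at key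
  linarith

theorem blockInner_diagMul_comm (i : ι) (x y : EuclideanSpace ℝ Λ) :
    blockInner blk i (diagMul ω x) y = blockInner blk i (diagMul ω y) x := by
  simp only [blockInner, diagMul]
  refine Finset.sum_congr rfl fun α _ => ?_
  split_ifs <;> ring

theorem diagMul_add (x y : EuclideanSpace ℝ Λ) : diagMul ω (x + y) = diagMul ω x + diagMul ω y := by
  ext α; simp [diagMul, mul_add]

theorem diagMul_smul (c : ℝ) (x : EuclideanSpace ℝ Λ) : diagMul ω (c • x) = c • diagMul ω x := by
  ext α; simp [diagMul]; ring

theorem norm_diagMul_le {W : ℝ} (hω : ∀ α, |ω α| ≤ W) (hW : 0 ≤ W) (x : EuclideanSpace ℝ Λ) :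
    ‖diagMul ω x‖ ≤ W * ‖x‖ := by
  refine abs_le_of_sq_le_sq' ?_ (by positivity) |>.2
  rw [mul_pow, EuclideanSpace.real_norm_sq_eq, EuclideanSpace.real_norm_sq_eq, Finset.mul_sum]
  refine Finset.sum_le_sum fun α _ => ?_
  simp only [diagMul, mul_pow]
  exact mul_le_mul_of_nonneg_right (sq_le_sq' (abs_le.1 (hω α)).1 (abs_le.1 (hω α)).2) (sq_nonneg _)

theorem ramp_nonneg (C q : ℝ) : 0 ≤ ramp C q := le_max_left _ _
theorem ramp_le_one (C q : ℝ) : ramp C q ≤ 1 := max_le zero_le_one (min_le_left _ _)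
theorem ramp_eq_one {C q : ℝ} (hC : 0 < C) (h : q ≤ C) : ramp C q = 1 := by
  have : 1 ≤ (2 * C - q) / C := by rw [le_div_iff₀ hC]; linarith
  simp [ramp, min_eq_left this]
theorem lt_of_ramp_ne_zero {C q : ℝ} (hC : 0 < C) (h : ramp C q ≠ 0) : q < 2 * C := by
  by_contra! h1
  apply h
  have : (2 * C - q) / C ≤ 0 := div_nonpos_of_nonpos_of_nonneg (by linarith) hC.le
  exact max_eq_left ((min_le_right _ _).trans this)


section Step

variable {μ C M Bm K : ℝ} {f : EuclideanSpace ℝ Λ → EuclideanSpace ℝ Λ}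
  {B : EuclideanSpace ℝ Λ → ℝ}

theorem norm_deformField_le (hμ : 0 < μ) (hB : ∀ x, 0 ≤ B x ∧ B x ≤ Bm)
    (D : EuclideanSpace ℝ Λ → EuclideanSpace ℝ Λ) (x : EuclideanSpace ℝ Λ) :
    ‖deformField blk ω R μ C B D x‖ ≤ Bm / μ := by
  have hm : 0 < max ‖tangential blk R (D x) x‖ μ := lt_max_of_lt_right hμ
  have h1 : 0 ≤ ramp C (blockAction blk ω x) := ramp_nonneg _ _
  have h2 : ramp C (blockAction blk ω x) ≤ 1 := ramp_le_one _ _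
  have hBx := hB x
  have hBm : 0 ≤ Bm := hBx.1.trans hBx.2
  rw [deformField, norm_smul, Real.norm_eq_abs, abs_div, abs_neg,
    abs_of_nonneg (mul_nonneg h1 hBx.1), abs_of_pos (pow_pos hm 2)]
  set m := max ‖tangential blk R (D x) x‖ μ
  calc ramp C (blockAction blk ω x) * B x / m ^ 2 * ‖tangential blk R (D x) x‖
      ≤ 1 * Bm / m ^ 2 * m := by
        gcongr
        · exact hBx.1
        · exact hBx.2
        · exact le_max_left _ _
    _ = Bm / m := by field_simp
    _ ≤ Bm / μ := by gcongr; exact le_max_right _ _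

/-- A nonzero deformation vector is the expected multiple of the tangential gradient. -/
theorem deformField_cases (hC : 0 < C)
    (D : EuclideanSpace ℝ Λ → EuclideanSpace ℝ Λ) (x : EuclideanSpace ℝ Λ)
    (hgrad : blockAction blk ω x ≤ 2 * C → B x ≠ 0 → μ ≤ ‖tangential blk R (D x) x‖) :
    (ramp C (blockAction blk ω x) * B x = 0 ∧ deformField blk ω R μ C B D x = 0) ∨
    (μ ≤ ‖tangential blk R (D x) x‖ ∧ deformField blk ω R μ C B D x =
      (-(ramp C (blockAction blk ω x) * B x) / ‖tangential blk R (D x) x‖ ^ 2) •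
        tangential blk R (D x) x) := by
  by_cases h : ramp C (blockAction blk ω x) * B x = 0
  · left; exact ⟨h, by simp [deformField, h]⟩
  · right
    have h1 := hgrad (lt_of_ramp_ne_zero hC (left_ne_zero_of_mul h)).le (right_ne_zero_of_mul h)
    exact ⟨h1, by rw [deformField, max_eq_left h1]⟩

theorem blockInner_deformField (hR : 0 < R) (D : EuclideanSpace ℝ Λ → EuclideanSpace ℝ Λ)
    (x : EuclideanSpace ℝ Λ) (i : ι) (hx : R ≤ blockInner blk i x x) :
    blockInner blk i x (deformField blk ω R μ C B D x) = 0 := by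
  rw [deformField, blockInner_smul_right, blockInner_comm, blockInner_tangential hR _ _ _ hx, mul_zero]

theorem inner_deformField (hR : 0 < R) (hμ : 0 < μ) (hC : 0 < C)
    (D : EuclideanSpace ℝ Λ → EuclideanSpace ℝ Λ)
    (x : EuclideanSpace ℝ Λ) (hx : ∀ i : ι, R ≤ blockInner blk i x x)
    (hgrad : blockAction blk ω x ≤ 2 * C → B x ≠ 0 → μ ≤ ‖tangential blk R (D x) x‖) :
    inner ℝ (D x) (deformField blk ω R μ C B D x) = -(ramp C (blockAction blk ω x) * B x) := by
  rcases deformField_cases hC D x hgrad with ⟨h1, h2⟩ | ⟨h1, h2⟩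
  · rw [h1, h2, inner_zero_right, neg_zero]
  · have : ‖tangential blk R (D x) x‖ ≠ 0 := by linarith
    rw [h2, inner_smul_right, inner_tangential hR _ _ hx, div_mul_cancel₀ _ (by positivity)]

theorem sum_abs_blockInner_diagMul_deformField (hR : 0 < R) (hμ : 0 < μ) (hC : 0 < C)
    (hB : ∀ x, 0 ≤ B x ∧ B x ≤ Bm) (f : EuclideanSpace ℝ Λ → EuclideanSpace ℝ Λ)
    (x : EuclideanSpace ℝ Λ) (hf : ‖f x‖ ≤ M) (hx : ∀ i : ι, R ≤ blockInner blk i x x)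
    (hgrad : blockAction blk ω x ≤ 2 * C → B x ≠ 0 →
      μ ≤ ‖tangential blk R (f x + diagMul ω x) x‖) :
    ∑ i, |blockInner blk i (diagMul ω x)
      (deformField blk ω R μ C B (fun x => f x + diagMul ω x) x)| ≤ Bm * (1 + M / μ) := by
  set V := deformField blk ω R μ C B (fun x => f x + diagMul ω x) x with hV
  set T := tangential blk R (f x + diagMul ω x) x with hT
  have hVn : ‖V‖ ≤ Bm / μ := norm_deformField_le hμ hB _ x
  have hBm : 0 ≤ Bm := (hB x).1.trans (hB x).2
  have hM : 0 ≤ M := (norm_nonneg _).trans hf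
  have hdec : ∀ i, blockInner blk i (diagMul ω x) V
      = blockInner blk i T V - blockInner blk i (f x) V := by
    intro i
    have h0 : blockInner blk i T V = blockInner blk i (f x + diagMul ω x) V
        - multiplier blk R (f x + diagMul ω x) x i * blockInner blk i x V := by
      simp only [hT, blockInner, tangential, Finset.mul_sum, ← Finset.sum_sub_distrib]
      refine Finset.sum_congr rfl fun α _ => ?_
      split_ifs with h
      · simp only [h, Option.elim]; ring
      · simp
    rw [h0, hV, blockInner_deformField hR _ _ _ (hx i), blockInner_add_left]
    ring
  have hTV : ∑ i, |blockInner blk i T V| ≤ Bm := by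
    rcases deformField_cases (B := B) (ω := ω) hC (fun x => f x + diagMul ω x) x hgrad with ⟨h1, h2⟩ | ⟨h1, h2⟩
    · rw [hV, h2]
      simpa [blockInner] using hBm
    · have hT0 : 0 < ‖T‖ := hμ.trans_le h1
      rw [hV, h2]
      simp only [blockInner_smul_right, abs_mul]
      rw [← Finset.mul_sum, abs_div, abs_neg, abs_of_nonneg (mul_nonneg (ramp_nonneg _ _) (hB x).1),
        abs_of_pos (pow_pos hT0 2)]
      calc ramp C (blockAction blk ω x) * B x / ‖T‖ ^ 2 * ∑ i, |blockInner blk i T T|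
          ≤ 1 * Bm / ‖T‖ ^ 2 * (‖T‖ * ‖T‖) := by
            gcongr
            · exact (hB x).1
            · exact ramp_le_one _ _
            · exact (hB x).2
            · exact sum_abs_blockInner_le T T
        _ = Bm := by field_simp
  calc ∑ i, |blockInner blk i (diagMul ω x) V|
      ≤ ∑ i, (|blockInner blk i T V| + |blockInner blk i (f x) V|) := by
        refine Finset.sum_le_sum fun i _ => ?_
        rw [hdec]; exact abs_sub _ _
    _ ≤ Bm + M * (Bm / μ) := by
        rw [Finset.sum_add_distrib]
        refine add_le_add hTV ((sum_abs_blockInner_le _ _).trans ?_)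
        gcongr
    _ = Bm * (1 + M / μ) := by ring

/-- Effect of an Euler step on the quadratic block actions. -/
theorem blockAction_step {W : ℝ} (hω : ∀ α, |ω α| ≤ W) (hW : 0 ≤ W) {h : ℝ} (hh : 0 ≤ h)
    (x V : EuclideanSpace ℝ Λ) :
    blockAction blk ω (x + h • V) ≤ blockAction blk ω x
      + h * ∑ i : ι, |blockInner blk i (diagMul ω x) V| + h ^ 2 * (W * ‖V‖ ^ 2) := by
  have key : ∀ i : ι, |blockInner blk i (diagMul ω (x + h • V)) (x + h • V) / 2| ≤
      |blockInner blk i (diagMul ω x) x / 2| + h * |blockInner blk i (diagMul ω x) V|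
        + h ^ 2 * |blockInner blk i (diagMul ω V) V| := by
    intro i
    have : blockInner blk i (diagMul ω (x + h • V)) (x + h • V) / 2 =
        blockInner blk i (diagMul ω x) x / 2 + h * blockInner blk i (diagMul ω x) V
          + h ^ 2 * (blockInner blk i (diagMul ω V) V / 2) := by
      simp only [diagMul_add, diagMul_smul, blockInner_add_left, blockInner_add_right,
        blockInner_smul_left, blockInner_smul_right]
      rw [blockInner_diagMul_comm i V x]
      ring
    rw [this]
    refine (abs_add_three _ _ _).trans ?_
    rw [abs_mul, abs_mul, abs_of_nonneg hh, abs_of_nonneg (sq_nonneg h)]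
    refine add_le_add le_rfl (mul_le_mul_of_nonneg_left ?_ (sq_nonneg h))
    rw [abs_div]
    exact div_le_self (abs_nonneg _) (by norm_num)
  calc blockAction blk ω (x + h • V) ≤ ∑ i : ι, (|blockInner blk i (diagMul ω x) x / 2|
        + h * |blockInner blk i (diagMul ω x) V| + h ^ 2 * |blockInner blk i (diagMul ω V) V|) :=
        Finset.sum_le_sum fun i _ => key i
    _ = blockAction blk ω x + h * ∑ i : ι, |blockInner blk i (diagMul ω x) V|
          + h ^ 2 * ∑ i : ι, |blockInner blk i (diagMul ω V) V| := by
        rw [Finset.sum_add_distrib, Finset.sum_add_distrib, Finset.mul_sum, Finset.mul_sum]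
        rfl
    _ ≤ _ := by
        gcongr
        refine (sum_abs_blockInner_le _ _).trans ?_
        rw [sq, ← mul_assoc]
        gcongr
        exact norm_diagMul_le hω hW V

end Step


theorem blockInner_blockFlip (η : ι → ℤˣ) (i : ι) (x y : EuclideanSpace ℝ Λ) :
    blockInner blk i (blockFlip blk η x) (blockFlip blk η y) = blockInner blk i x y := by
  simp only [blockInner, blockFlip]
  refine Finset.sum_congr rfl fun α _ => ?_
  split_ifs with h
  · simp only [h, Option.elim]
    linear_combination (x α * y α) * sgn_sq (η i)
  · rfl

theorem blockFlip_add (η : ι → ℤˣ) (x y : EuclideanSpace ℝ Λ) :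
    blockFlip blk η (x + y) = blockFlip blk η x + blockFlip blk η y := by
  ext α; simp [blockFlip, mul_add]

theorem blockFlip_smul (η : ι → ℤˣ) (c : ℝ) (x : EuclideanSpace ℝ Λ) :
    blockFlip blk η (c • x) = c • blockFlip blk η x := by
  ext α; simp [blockFlip]; ring

theorem diagMul_blockFlip (η : ι → ℤˣ) (x : EuclideanSpace ℝ Λ) :
    diagMul ω (blockFlip blk η x) = blockFlip blk η (diagMul ω x) := by
  ext α; simp [blockFlip, diagMul]; ring

theorem norm_blockFlip (η : ι → ℤˣ) (x : EuclideanSpace ℝ Λ) : ‖blockFlip blk η x‖ = ‖x‖ := by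
  rw [← sq_eq_sq₀ (norm_nonneg _) (norm_nonneg _), EuclideanSpace.real_norm_sq_eq,
    EuclideanSpace.real_norm_sq_eq]
  refine Finset.sum_congr rfl fun α _ => ?_
  simp only [blockFlip, mul_pow]
  rcases blk α with _ | i
  · simp
  · simp [sgn_sq]

theorem blockAction_blockFlip (η : ι → ℤˣ) (x : EuclideanSpace ℝ Λ) :
    blockAction blk ω (blockFlip blk η x) = blockAction blk ω x := by
  simp only [blockAction, diagMul_blockFlip, blockInner_blockFlip]

theorem tangential_blockFlip (η : ι → ℤˣ) (D x : EuclideanSpace ℝ Λ) :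
    tangential blk R (blockFlip blk η D) (blockFlip blk η x)
      = blockFlip blk η (tangential blk R D x) := by
  have : multiplier blk R (blockFlip blk η D) (blockFlip blk η x) = multiplier blk R D x := by
    funext i; simp only [multiplier, blockInner_blockFlip]
  ext α
  simp only [tangential, this]
  simp only [blockFlip]
  ring

theorem deformField_blockFlip {μ C : ℝ} {B : EuclideanSpace ℝ Λ → ℝ}
    {D : EuclideanSpace ℝ Λ → EuclideanSpace ℝ Λ} (η : ι → ℤˣ)
    (hB : ∀ x, B (blockFlip blk η x) = B x)
    (hD : ∀ x, D (blockFlip blk η x) = blockFlip blk η (D x)) (x : EuclideanSpace ℝ Λ) :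
    deformField blk ω R μ C B D (blockFlip blk η x)
      = blockFlip blk η (deformField blk ω R μ C B D x) := by
  simp only [deformField, hD, hB, tangential_blockFlip, norm_blockFlip, blockAction_blockFlip,
    blockFlip_smul]

theorem continuous_blockInner (i : ι) {f g : EuclideanSpace ℝ Λ → EuclideanSpace ℝ Λ}
    (hf : Continuous f) (hg : Continuous g) : Continuous fun x => blockInner blk i (f x) (g x) := by
  refine continuous_finsetSum _ fun α _ => ?_
  split_ifs
  · fun_prop
  · fun_prop

theorem continuous_diagMul : Continuous (diagMul ω) := by
  unfold diagMul; fun_prop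

theorem continuous_tangential (hR : 0 < R) {D : EuclideanSpace ℝ Λ → EuclideanSpace ℝ Λ}
    (hD : Continuous D) : Continuous fun x => tangential blk R (D x) x := by
  have hm : ∀ i, Continuous fun x => multiplier blk R (D x) x i := fun i =>
    (continuous_blockInner i hD continuous_id).div
      ((continuous_blockInner i continuous_id continuous_id).max continuous_const)
      fun x => (lt_max_of_lt_right hR).ne'
  refine (PiLp.continuous_toLp 2 _).comp (continuous_pi fun α => ?_)
  rcases h : blk α with _ | i
  · simp only [Option.elim]; fun_prop
  · simp only [Option.elim]
    have := hm i
    fun_prop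

theorem continuous_deformField {μ C : ℝ} (hR : 0 < R) (hμ : 0 < μ)
    {B : EuclideanSpace ℝ Λ → ℝ} (hB : Continuous B)
    {D : EuclideanSpace ℝ Λ → EuclideanSpace ℝ Λ}
    (hD : Continuous D) : Continuous (deformField blk ω R μ C B D) := by
  have hT := continuous_tangential (blk := blk) hR hD
  have hQ : Continuous (blockAction blk ω) := by
    unfold blockAction
    refine continuous_finsetSum _ fun i _ => ?_
    exact ((continuous_blockInner i continuous_diagMul continuous_id).div_const 2).abs
  have hr : Continuous fun x => ramp C (blockAction blk ω x) := by
    unfold ramp; fun_prop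
  refine Continuous.smul (Continuous.div (hr.mul hB).neg
    ((hT.norm.max continuous_const).pow 2) fun x => ?_) hT
  exact (pow_pos (lt_max_of_lt_right hμ) 2).ne'

/-- The explicit Euler scheme with step `h`. -/
def eulerMap {E : Type*} [AddCommGroup E] [Module ℝ E] (V : ℝ → E → E) (h : ℝ) : ℕ → E → E
  | 0, x => x
  | j + 1, x => eulerMap V h j x + h • V (j * h) (eulerMap V h j x)

set_option maxHeartbeats 1000000 in
theorem exists_deformation {μ M Bm δ₀ K LB : ℝ} (hR : 0 < R) (hμ : 0 < μ) (hM : 0 ≤ M)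
    (hδ₀ : 0 < δ₀) (A₀ B : EuclideanSpace ℝ Λ → ℝ)
    (f : ℝ → EuclideanSpace ℝ Λ → EuclideanSpace ℝ Λ)
    (hA : ∀ s ∈ Icc (0 : ℝ) 1, ∀ x v, A₀ (x + v) + s * B (x + v) ≤
      A₀ x + s * B x + inner ℝ (f s x + diagMul ω x) v + K * ‖v‖ ^ 2)
    (hf : ∀ s ∈ Icc (0 : ℝ) 1, ∀ x, ‖f s x‖ ≤ M) (hfc : ∀ s, Continuous (f s))
    (hB : ∀ x, 0 ≤ B x ∧ B x ≤ Bm) (hBl : ∀ x v, B (x + v) ≤ B x + LB * ‖v‖)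
    (hBc : Continuous B)
    (hfe : ∀ s (η : ι → ℤˣ) x, f s (blockFlip blk η x) = blockFlip blk η (f s x))
    (hBe : ∀ (η : ι → ℤˣ) x, B (blockFlip blk η x) = B x)
    (hgrad : ∀ s ∈ Icc (0 : ℝ) 1, ∀ x,
      (∀ i : ι, R ≤ blockInner blk i x x ∧ blockInner blk i x x ≤ R + δ₀) →
      blockAction blk ω x ≤ 2 * (Bm * (1 + M / μ) + 1 + Bm) → B x ≠ 0 →
      μ ≤ ‖tangential blk R (f s x + diagMul ω x) x‖)
    {e : ℝ} (he : 0 < e) :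
    ∃ Θ : EuclideanSpace ℝ Λ → EuclideanSpace ℝ Λ, Continuous Θ ∧
      (∀ (η : ι → ℤˣ) x, Θ (blockFlip blk η x) = blockFlip blk η (Θ x)) ∧
      (∀ x, ‖Θ x - x‖ ≤ Bm / μ) ∧
      ∀ x c, (∀ i : ι, blockInner blk i x x = R) → A₀ x + blockAction blk ω x ≤ c →
        A₀ (Θ x) + B (Θ x) ≤ c + e := by
  have hBm : 0 ≤ Bm := (hB 0).1.trans (hB 0).2
  obtain ⟨W, hW, hω⟩ : ∃ W : ℝ, 0 ≤ W ∧ ∀ α, |ω α| ≤ W :=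
    ⟨∑ α, |ω α|, by positivity, fun α =>
      Finset.single_le_sum (f := fun α => |ω α|) (fun α _ => abs_nonneg _) (Finset.mem_univ α)⟩
  set C₂ := Bm * (1 + M / μ) with hC₂
  have hC₂0 : 0 ≤ C₂ := by positivity
  set C₁ := C₂ + 1 + Bm with hC₁
  have hC₁0 : 0 < C₁ := by linarith
  set Vm := Bm / μ with hVm
  have hVm0 : 0 ≤ Vm := by positivity
  set c := |K| * Vm ^ 2 + |LB| * Vm with hc
  have hc0 : 0 ≤ c := by positivity
  obtain ⟨L, hL⟩ := exists_nat_gt (max (max (Vm ^ 2 / δ₀) (c / e)) (max (W * Vm ^ 2) 1))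
  simp only [max_lt_iff] at hL
  obtain ⟨⟨hL1, hL2⟩, hL3, hL4⟩ := hL
  have hL0 : (0 : ℝ) < L := by linarith
  set h : ℝ := 1 / L with hh
  have hh0 : 0 < h := by positivity
  have hLh : L * h = 1 := by rw [hh]; field_simp
  have hh1 : h * Vm ^ 2 ≤ δ₀ := by
    rw [hh, one_div_mul_eq_div, div_le_iff₀ hL0]
    rw [div_lt_iff₀ hδ₀] at hL1; linarith
  have hh2 : c * h ≤ e := by
    rw [hh, mul_one_div, div_le_iff₀ hL0]
    rw [div_lt_iff₀ he] at hL2; linarith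
  have hh3 : h * (W * Vm ^ 2) ≤ 1 := by
    rw [hh, one_div_mul_eq_div, div_le_iff₀ hL0]; linarith
  set V : ℝ → EuclideanSpace ℝ Λ → EuclideanSpace ℝ Λ :=
    fun s => deformField blk ω R μ C₁ B (fun x => f s x + diagMul ω x) with hV
  have hVn : ∀ s x, ‖V s x‖ ≤ Vm := fun s x => norm_deformField_le hμ hB _ x
  have hVc : ∀ s, Continuous (V s) := fun s =>
    continuous_deformField hR hμ hBc ((hfc s).add continuous_diagMul)
  have hVe : ∀ s (η : ι → ℤˣ) x, V s (blockFlip blk η x) = blockFlip blk η (V s x) :=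
    fun s η x => deformField_blockFlip η (hBe η)
      (fun y => by rw [hfe, diagMul_blockFlip, blockFlip_add]) x
  have hj1 : ∀ j : ℕ, j ≤ L → (j : ℝ) * h ≤ 1 := fun j hj => by
    rw [← hLh]; gcongr
  have hdist : ∀ (j : ℕ) x, ‖eulerMap V h j x - x‖ ≤ j * h * Vm := by
    intro j x
    induction j with
    | zero => simp [eulerMap]
    | succ j ih =>
      rw [eulerMap, add_sub_right_comm]
      refine (norm_add_le _ _).trans ?_
      rw [norm_smul, Real.norm_of_nonneg hh0.le]
      have := mul_le_mul_of_nonneg_left (hVn (j * h) (eulerMap V h j x)) hh0.le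
      push_cast
      linarith
  have hstep : ∀ s ∈ Icc (0 : ℝ) 1, s + h ∈ Icc (0 : ℝ) 1 → ∀ x,
      (∀ i : ι, R ≤ blockInner blk i x x ∧ blockInner blk i x x ≤ R + δ₀) →
      (∀ i : ι, blockInner blk i x x ≤ blockInner blk i (x + h • V s x) (x + h • V s x) ∧
        blockInner blk i (x + h • V s x) (x + h • V s x)
          ≤ blockInner blk i x x + h ^ 2 * Vm ^ 2) ∧
      blockAction blk ω (x + h • V s x) ≤ blockAction blk ω x + h * (C₂ + 1) ∧
      A₀ (x + h • V s x) + (s + h) * B (x + h • V s x) ≤ A₀ x + s * B x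
        + h * ((1 - ramp C₁ (blockAction blk ω x)) * B x) + c * h ^ 2 := by
    intro s hs hsh x hx
    have hg := hgrad s hs x hx
    have hxR : ∀ i : ι, R ≤ blockInner blk i x x := fun i => (hx i).1
    refine ⟨fun i => ?_, ?_, ?_⟩
    · have h0 : blockInner blk i x (V s x) = 0 := blockInner_deformField hR _ x i (hxR i)
      have h1 : blockInner blk i (x + h • V s x) (x + h • V s x)
          = blockInner blk i x x + h ^ 2 * blockInner blk i (V s x) (V s x) := by
        simp only [blockInner_add_left, blockInner_add_right, blockInner_smul_left,
          blockInner_smul_right, h0, blockInner_comm i (V s x) x]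
        ring
      have h2 := blockInner_self_nonneg (blk := blk) i (V s x)
      have h3 : blockInner blk i (V s x) (V s x) ≤ Vm ^ 2 :=
        (blockInner_self_le i _).trans (pow_le_pow_left₀ (norm_nonneg _) (hVn s x) 2)
      rw [h1]
      constructor
      · have := mul_nonneg (sq_nonneg h) h2
        linarith
      · gcongr
    · have h1 := blockAction_step (blk := blk) hω hW hh0.le x (V s x)
      have h2 : ∑ i : ι, |blockInner blk i (diagMul ω x) (V s x)| ≤ C₂ :=
        sum_abs_blockInner_diagMul_deformField hR hμ hC₁0 hB (f s) x (hf s hs x) hxR hg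
      have h3 : W * ‖V s x‖ ^ 2 ≤ W * Vm ^ 2 := by
        gcongr; exact hVn s x
      have h4 : h * (h * (W * ‖V s x‖ ^ 2)) ≤ h * 1 := by
        gcongr
        exact (mul_le_mul_of_nonneg_left h3 hh0.le).trans hh3
      have h5 := mul_le_mul_of_nonneg_left h2 hh0.le
      nlinarith
    · have h1 := hA s hs x (h • V s x)
      have h2 : inner ℝ (f s x + diagMul ω x) (V s x)
          = -(ramp C₁ (blockAction blk ω x) * B x) :=
        inner_deformField hR hμ hC₁0 (fun x => f s x + diagMul ω x) x hxR hg
      rw [inner_smul_right, h2, norm_smul, Real.norm_of_nonneg hh0.le] at h1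
      have h3 := hBl x (h • V s x)
      rw [norm_smul, Real.norm_of_nonneg hh0.le] at h3
      have h4 : K * (h * ‖V s x‖) ^ 2 ≤ |K| * Vm ^ 2 * h ^ 2 := by
        calc K * (h * ‖V s x‖) ^ 2 ≤ |K| * (h * Vm) ^ 2 := by
              gcongr
              · exact le_abs_self K
              · exact hVn s x
          _ = _ := by ring
      have h5 : LB * (h * ‖V s x‖) ≤ |LB| * (h * Vm) := by
        gcongr
        · exact le_abs_self _
        · exact hVn s x
      have h6 := mul_le_mul_of_nonneg_left (h3.trans (add_le_add_right h5 _)) hh0.le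
      rw [hc]
      linarith
  have hinv : ∀ (j : ℕ), j ≤ L → ∀ x, (∀ i : ι, blockInner blk i x x = R) →
      (∀ i : ι, R ≤ blockInner blk i (eulerMap V h j x) (eulerMap V h j x) ∧
        blockInner blk i (eulerMap V h j x) (eulerMap V h j x) ≤ R + j * (h ^ 2 * Vm ^ 2)) ∧
      blockAction blk ω (eulerMap V h j x) ≤ blockAction blk ω x + j * h * (C₂ + 1) ∧
      A₀ (eulerMap V h j x) + j * h * B (eulerMap V h j x) ≤ A₀ x + j * h * Bm + j * h * (c * h) ∧
      (blockAction blk ω x ≤ Bm →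
        A₀ (eulerMap V h j x) + j * h * B (eulerMap V h j x) ≤ A₀ x + j * h * (c * h)) := by
    intro j
    induction j with
    | zero => intro _ x hx; simp [eulerMap, hx]
    | succ j ih =>
      intro hj x hx
      obtain ⟨i1, i2, i3, i4⟩ := ih (by omega) x hx
      have hjj := hj1 (j + 1) hj
      push_cast at hjj
      have hjj0 := hj1 j (by omega)
      have hjh0 : 0 ≤ (j : ℝ) * h := by positivity
      have hjb : (j : ℝ) * (h ^ 2 * Vm ^ 2) ≤ δ₀ := by
        calc (j : ℝ) * (h ^ 2 * Vm ^ 2) = (j * h) * (h * Vm ^ 2) := by ring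
          _ ≤ 1 * δ₀ := by gcongr
          _ = δ₀ := one_mul _
      obtain ⟨s1, s2, s3⟩ := hstep (j * h) ⟨hjh0, hjj0⟩ ⟨by positivity, by linarith⟩
        (eulerMap V h j x) fun i => ⟨(i1 i).1, (i1 i).2.trans (by linarith)⟩
      have hBy := hB (eulerMap V h j x)
      have hr0 := ramp_nonneg C₁ (blockAction blk ω (eulerMap V h j x))
      simp only [eulerMap]
      push_cast
      refine ⟨fun i => ⟨(i1 i).1.trans (s1 i).1, (s1 i).2.trans ?_⟩, ?_, ?_, fun hq => ?_⟩
      · linarith [(i1 i).2]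
      · linarith
      · have h1 : (1 - ramp C₁ (blockAction blk ω (eulerMap V h j x))) * B (eulerMap V h j x)
            ≤ Bm := by nlinarith
        have h2 := mul_le_mul_of_nonneg_left h1 hh0.le
        rw [show ((j : ℝ) + 1) * h = j * h + h by ring]
        linarith
      · have hq1 : blockAction blk ω (eulerMap V h j x) ≤ C₁ := by
          have := mul_le_mul_of_nonneg_right hjj0 (by linarith : 0 ≤ C₂ + 1)
          linarith
        rw [ramp_eq_one hC₁0 hq1, sub_self, zero_mul, mul_zero, add_zero] at s3
        have := i4 hq
        rw [show ((j : ℝ) + 1) * h = j * h + h by ring]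
        linarith
  refine ⟨eulerMap V h L, ?_, ?_, ?_, ?_⟩
  · have : ∀ j, Continuous (eulerMap V h j) := by
      intro j
      induction j with
      | zero => exact continuous_id
      | succ j ih => exact ih.add (((hVc _).comp ih).const_smul h)
    exact this L
  · intro η x
    have : ∀ j, eulerMap V h j (blockFlip blk η x) = blockFlip blk η (eulerMap V h j x) := by
      intro j
      induction j with
      | zero => rfl
      | succ j ih => rw [eulerMap, eulerMap, ih, hVe, blockFlip_add, blockFlip_smul]
    exact this L
  · intro x
    have := hdist L x
    rwa [hLh, one_mul] at this
  · intro x E hx hE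
    obtain ⟨-, -, i3, i4⟩ := hinv L le_rfl x hx
    rw [hLh] at i3 i4
    have hq0 : 0 ≤ blockAction blk ω x := Finset.sum_nonneg fun i _ => abs_nonneg _
    by_cases hq : blockAction blk ω x ≤ Bm
    · have := i4 hq; linarith
    · push Not at hq
      linarith

end Euler

/-- Phase space of the lifted problem: a pair of complex coordinates for each index in `ι`
(whose level sets are three-spheres), and one complex coordinate for each index in `β`. -/
abbrev VS (ι β : Type) : Type := EuclideanSpace ℂ ((ι × Bool) ⊕ β)

section VS
variable {ι β : Type} [Fintype ι] [Fintype β]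

/-- Squared norm of the `i`-th pair of coordinates. -/
def znorm (i : ι) (y : VS ι β) : ℝ := ‖y (.inl (i, false))‖ ^ 2 + ‖y (.inl (i, true))‖ ^ 2

/-- Squared norm of the unpaired coordinates. -/
def wnorm (y : VS ι β) : ℝ := ∑ l, ‖y (.inr l)‖ ^ 2

/-- Diagonal circle rotation of the pairs. -/
def rotV (c : ι → ℂ) (y : VS ι β) : VS ι β :=
  WithLp.toLp 2 (Sum.elim (fun a => c a.1 * y (.inl a)) fun l => y (.inr l))

/-- Infinitesimal rotation of the pairs. -/
def lamV (r : ι → ℝ) (y : VS ι β) : VS ι β :=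
  WithLp.toLp 2 (Sum.elim (fun a => (r a.1 : ℂ) * Complex.I * y (.inl a)) fun _ => 0)

theorem znorm_nonneg (i : ι) (y : VS ι β) : 0 ≤ znorm i y := by unfold znorm; positivity
theorem wnorm_nonneg (y : VS ι β) : 0 ≤ wnorm y := by unfold wnorm; positivity

theorem real_inner_VS (x y : VS ι β) : inner ℝ x y = ∑ c, inner ℝ (x c) (y c) := PiLp.inner_apply _ _

theorem norm_sq_VS (y : VS ι β) : ‖y‖ ^ 2 = ∑ i, znorm i y + wnorm y := by
  rw [EuclideanSpace.norm_sq_eq, Fintype.sum_sum_type, Fintype.sum_prod_type]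
  simp [znorm, wnorm, add_comm]

theorem norm_comp_le (y : VS ι β) (c) : ‖y c‖ ≤ ‖y‖ := PiLp.norm_apply_le y c

theorem inner_real_mul_I (r : ℝ) (z : ℂ) : inner ℝ z ((r : ℂ) * Complex.I * z) = 0 := by
  rw [Complex.inner]
  simp [Complex.mul_re, Complex.mul_im]
  ring

/-- If `|φ'| ≤ (1 + φ) ε` with `ε` of small integral then `φ` is nearly constant. -/
theorem abs_sub_le_of_deriv_le {φ φ' ε : ℝ → ℝ} {a b ν c t₀ : ℝ}
    (hφ : ∀ t ∈ Icc a b, HasDerivAt φ (φ' t) t) (hpos : ∀ t ∈ Icc a b, 0 ≤ φ t)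
    (hε : Continuous ε) (hε0 : ∀ t, 0 ≤ ε t)
    (hd : ∀ t ∈ Icc a b, |φ' t| ≤ (1 + φ t) * ε t) (hν : ∫ t in a..b, ε t ≤ ν) (hν2 : ν ≤ 1 / 2)
    (ht₀ : t₀ ∈ Icc a b) (hc : φ t₀ ≤ c) :
    ∀ t ∈ Icc a b, |φ t - φ t₀| ≤ 2 * (1 + c) * ν := by
  have hab : a ≤ b := ht₀.1.trans ht₀.2
  have hcont : ContinuousOn φ (Icc a b) := fun t ht => (hφ t ht).continuousAt.continuousWithinAt
  obtain ⟨tm, htm, hmax⟩ := isCompact_Icc.exists_isMaxOn ⟨t₀, ht₀⟩ hcont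
  set M := φ tm with hM
  have hM0 : 0 ≤ M := hpos tm htm
  have hν0 : 0 ≤ ν := (intervalIntegral.integral_nonneg hab fun t _ => hε0 t).trans hν
  have key : ∀ x ∈ Icc a b, ∀ y ∈ Icc a b, x ≤ y → |φ y - φ x| ≤ (1 + M) * ν := by
    intro x hx y hy hxy
    have hE : ∀ t, HasDerivAt (fun t => (1 + M) * ∫ u in x..t, ε u) ((1 + M) * ε t) t := fun t =>
      (intervalIntegral.integral_hasDerivAt_right (hε.intervalIntegrable _ _)
        (hε.stronglyMeasurableAtFilter _ _) hε.continuousAt).const_mul _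
    have h1 : ‖φ y - φ x‖ ≤ (1 + M) * ∫ u in x..y, ε u := by
      refine image_norm_le_of_norm_deriv_right_le_deriv_boundary (f := fun t => φ t - φ x)
        (f' := φ') (B := fun t => (1 + M) * ∫ u in x..t, ε u) (B' := fun t => (1 + M) * ε t)
        (a := x) (b := y) ?_ ?_ ?_ hE ?_ ⟨hxy, le_rfl⟩
      · exact (hcont.mono (Icc_subset_Icc hx.1 hy.2)).sub continuousOn_const
      · intro t ht
        exact ((hφ t ⟨hx.1.trans ht.1, ht.2.le.trans hy.2⟩).sub_const _).hasDerivWithinAt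
      · simp
      · intro t ht
        have ht' : t ∈ Icc a b := ⟨hx.1.trans ht.1, ht.2.le.trans hy.2⟩
        refine (hd t ht').trans ?_
        have : φ t ≤ M := hmax ht'
        have := hε0 t
        gcongr
    refine h1.trans ?_
    gcongr
    refine le_trans ?_ hν
    exact intervalIntegral.integral_mono_interval hx.1 hxy hy.2
      (Eventually.of_forall hε0) (hε.intervalIntegrable _ _)
  have key2 : ∀ x ∈ Icc a b, ∀ y ∈ Icc a b, |φ y - φ x| ≤ (1 + M) * ν := by
    intro x hx y hy
    rcases le_total x y with h | h
    · exact key x hx y hy h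
    · rw [abs_sub_comm]; exact key y hy x hx h
  have h1 := abs_le.1 (key2 t₀ ht₀ tm htm)
  have h2 : (1 + M) * ν ≤ (1 + M) * (1 / 2) := by gcongr
  have h3 : M ≤ 2 * c + 1 := by linarith [h1.2]
  intro t ht
  refine (key2 t₀ ht₀ t ht).trans ?_
  gcongr
  linarith

theorem hasDerivAt_comp_norm_sq {p : ℝ → VS ι β} {v : VS ι β} {t : ℝ} (hp : HasDerivAt p v t) (c) :
    HasDerivAt (fun t => ‖p t c‖ ^ 2) (2 * inner ℝ (p t c) (v c)) t := by
  have : HasDerivAt (fun t => p t c) (v c) t :=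
    ((EuclideanSpace.proj (𝕜 := ℂ) c).restrictScalars ℝ).hasFDerivAt.comp_hasDerivAt t hp
  exact this.norm_sq

section Path

variable {p f e : ℝ → VS ι β} {r : ι → ℝ} {δ ν : ℝ}

theorem abs_two_inner_le (a b : ℂ) : |2 * inner ℝ a b| ≤ (1 + ‖a‖ ^ 2) * ‖b‖ := by
  have h := abs_real_inner_le_norm a b
  rw [abs_mul, abs_two]
  nlinarith [norm_nonneg a, norm_nonneg b, sq_nonneg (‖a‖ - 1), mul_nonneg (sq_nonneg (‖a‖ - 1)) (norm_nonneg b)]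

theorem path_norm_comp
    (hp : ∀ t, HasDerivAt p (-(Complex.I • f t) + lamV r (p t) + e t) t)
    (he : Continuous e) (hν : ∫ t in (0:ℝ)..1, ‖e t‖ ≤ ν) (hν2 : ν ≤ 1 / 2) (hδ : 0 ≤ δ)
    (hf0 : ∀ t ∈ Icc 0 (1 - δ), ∀ a, f t (.inl a) = 0) (a : ι × Bool) {c t₀ : ℝ}
    (ht₀ : t₀ ∈ Icc 0 (1 - δ)) (hc : ‖p t₀ (.inl a)‖ ^ 2 ≤ c) :
    ∀ t ∈ Icc 0 (1 - δ), |‖p t (.inl a)‖ ^ 2 - ‖p t₀ (.inl a)‖ ^ 2| ≤ 2 * (1 + c) * ν := by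
  refine abs_sub_le_of_deriv_le (ε := fun t => ‖e t‖)
    (fun t _ => hasDerivAt_comp_norm_sq (hp t) (.inl a)) (fun t _ => sq_nonneg _) he.norm
    (fun t => norm_nonneg _) ?_ ?_ hν2 ht₀ hc
  · intro t ht
    have : inner ℝ (p t (.inl a)) ((-(Complex.I • f t) + lamV r (p t) + e t) (.inl a))
        = inner ℝ (p t (.inl a)) (e t (.inl a)) := by
      simp only [PiLp.add_apply, PiLp.neg_apply, PiLp.smul_apply, hf0 t ht, smul_zero, neg_zero,
        zero_add, lamV, Sum.elim_inl, inner_add_right, inner_real_mul_I]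
    rw [this]
    refine (abs_two_inner_le _ _).trans ?_
    gcongr
    exact norm_comp_le _ _
  · refine le_trans ?_ hν
    exact intervalIntegral.integral_mono_interval le_rfl (ht₀.1.trans ht₀.2) (by linarith)
      (Eventually.of_forall fun t => norm_nonneg _) (he.norm.intervalIntegrable _ _)

theorem abs_two_sum_inner_le {κ : Type*} (s : Finset κ) (a b : κ → ℂ) {m : ℝ} (hm : 0 ≤ m)
    (hb : ∑ l ∈ s, ‖b l‖ ^ 2 ≤ m ^ 2) :
    |∑ l ∈ s, 2 * inner ℝ (a l) (b l)| ≤ (1 + ∑ l ∈ s, ‖a l‖ ^ 2) * m := by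
  have h1 : |∑ l ∈ s, 2 * inner ℝ (a l) (b l)| ≤ 2 * ∑ l ∈ s, ‖a l‖ * ‖b l‖ := by
    rw [← Finset.mul_sum, abs_mul, abs_two]
    gcongr
    exact (Finset.abs_sum_le_sum_abs _ _).trans
      (Finset.sum_le_sum fun l _ => abs_real_inner_le_norm _ _)
  have h2 := Real.sum_mul_le_sqrt_mul_sqrt s (fun l => ‖a l‖) fun l => ‖b l‖
  have h3 : √(∑ l ∈ s, ‖b l‖ ^ 2) ≤ m := by
    rw [← Real.sqrt_sq hm]; exact Real.sqrt_le_sqrt hb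
  set A := ∑ l ∈ s, ‖a l‖ ^ 2 with hA
  have hA0 : 0 ≤ A := by positivity
  have h4 : 2 * √A ≤ 1 + A := by
    nlinarith [Real.sq_sqrt hA0, sq_nonneg (√A - 1)]
  calc _ ≤ 2 * (√A * √(∑ l ∈ s, ‖b l‖ ^ 2)) := h1.trans (by linarith)
    _ ≤ 2 * (√A * m) := by gcongr
    _ = 2 * √A * m := by ring
    _ ≤ _ := by gcongr

theorem path_wnorm
    (hp : ∀ t, HasDerivAt p (-(Complex.I • f t) + lamV r (p t) + e t) t)
    (he : Continuous e) (hν : ∫ t in (0:ℝ)..1, ‖e t‖ ≤ ν) (hν2 : ν ≤ 1 / 2) (hδ : 0 ≤ δ)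
    (hfw : ∀ t ∈ Icc 0 (1 - δ), ∃ q : ℝ, ∀ l, f t (.inr l) = q • p t (.inr l)) {c t₀ : ℝ}
    (ht₀ : t₀ ∈ Icc 0 (1 - δ)) (hc : wnorm (p t₀) ≤ c) :
    ∀ t ∈ Icc 0 (1 - δ), |wnorm (p t) - wnorm (p t₀)| ≤ 2 * (1 + c) * ν := by
  refine abs_sub_le_of_deriv_le (ε := fun t => ‖e t‖) (φ := fun t => wnorm (p t))
    (fun t _ => HasDerivAt.fun_sum fun l _ => hasDerivAt_comp_norm_sq (hp t) (.inr l))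
    (fun t _ => wnorm_nonneg _) he.norm
    (fun t => norm_nonneg _) ?_ ?_ hν2 ht₀ hc
  · intro t ht
    obtain ⟨q, hq⟩ := hfw t ht
    have : ∀ l, inner ℝ (p t (.inr l)) ((-(Complex.I • f t) + lamV r (p t) + e t) (.inr l))
        = inner ℝ (p t (.inr l)) (e t (.inr l)) := by
      intro l
      have h := inner_real_mul_I (-q) (p t (.inr l))
      have h2 : -(Complex.I • q • p t (.inr l)) = ((-q : ℝ) : ℂ) * Complex.I * p t (.inr l) := by
        rw [Complex.real_smul, smul_eq_mul]; push_cast; ring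
      simp only [PiLp.add_apply, PiLp.neg_apply, PiLp.smul_apply, hq, lamV, Sum.elim_inr, add_zero,
        inner_add_right, h2, h, zero_add]
    simp only [this]
    refine abs_two_sum_inner_le _ _ _ (norm_nonneg _) ?_
    have := norm_sq_VS (e t)
    have h2 : 0 ≤ ∑ i, znorm i (e t) := Finset.sum_nonneg fun i _ => znorm_nonneg _ _
    rw [wnorm] at this
    linarith
  · refine le_trans ?_ hν
    exact intervalIntegral.integral_mono_interval le_rfl (ht₀.1.trans ht₀.2) (by linarith)
      (Eventually.of_forall fun t => norm_nonneg _) (he.norm.intervalIntegrable _ _)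

theorem path_znorm [DecidableEq ι]
    (hp : ∀ t, HasDerivAt p (-(Complex.I • f t) + lamV r (p t) + e t) t)
    (he : Continuous e) (hν : ∫ t in (0:ℝ)..1, ‖e t‖ ≤ ν) (hν2 : ν ≤ 1 / 2) (i : ι)
    (hforth : ∀ t ∈ Icc (0 : ℝ) 1, inner ℝ (f t) (lamV (Pi.single i 1) (p t)) = 0) {c t₀ : ℝ}
    (ht₀ : t₀ ∈ Icc (0 : ℝ) 1) (hc : znorm i (p t₀) ≤ c) :
    ∀ t ∈ Icc (0 : ℝ) 1, |znorm i (p t) - znorm i (p t₀)| ≤ 2 * (1 + c) * ν := by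
  have hsum : ∀ t, znorm i (p t) = ∑ b, ‖p t (.inl (i, b))‖ ^ 2 := fun t => by
    simp [znorm, add_comm]
  refine abs_sub_le_of_deriv_le (ε := fun t => ‖e t‖) (φ := fun t => znorm i (p t))
    (φ' := fun t => ∑ b, 2 * inner ℝ (p t (.inl (i, b)))
      ((-(Complex.I • f t) + lamV r (p t) + e t) (.inl (i, b))))
    (fun t _ => ?_)
    (fun t _ => znorm_nonneg _ _) he.norm
    (fun t => norm_nonneg _) ?_ hν hν2 ht₀ hc
  · simp only [hsum]
    exact HasDerivAt.fun_sum fun b _ => hasDerivAt_comp_norm_sq (hp t) (.inl (i, b))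
  · intro t ht
    have h0 : ∑ b, inner ℝ (p t (.inl (i, b))) (-(Complex.I • f t (.inl (i, b)))) = 0 := by
      rw [← hforth t ht, real_inner_VS, Fintype.sum_sum_type, Fintype.sum_prod_type,
        Finset.sum_eq_single i]
      · simp only [lamV, Sum.elim_inl, Sum.elim_inr, inner_zero_right, Finset.sum_const_zero, add_zero]
        refine Finset.sum_congr rfl fun b _ => ?_
        simp only [Pi.single_eq_same, Complex.inner, smul_eq_mul]
        simp [Complex.mul_re, Complex.mul_im]
        ring
      · intro j _ hj
        simp [lamV, Pi.single_eq_of_ne hj]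
      · simp
    have h1 : ∑ b, 2 * inner ℝ (p t (.inl (i, b)))
      ((-(Complex.I • f t) + lamV r (p t) + e t) (.inl (i, b)))
      = ∑ b, 2 * inner ℝ (p t (.inl (i, b))) (e t (.inl (i, b))) := by
      rw [← Finset.mul_sum, ← Finset.mul_sum]
      congr 1
      simp only [PiLp.add_apply, PiLp.neg_apply, PiLp.smul_apply, lamV, Sum.elim_inl,
        inner_add_right, inner_real_mul_I, add_zero, Finset.sum_add_distrib, h0, zero_add]
    rw [h1, hsum]
    refine abs_two_sum_inner_le _ _ _ (norm_nonneg _) ?_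
    have := norm_sq_VS (e t)
    have h2 : znorm i (e t) ≤ ∑ i, znorm i (e t) :=
      Finset.single_le_sum (fun i _ => znorm_nonneg i (e t)) (Finset.mem_univ i)
    have h3 := wnorm_nonneg (e t)
    have h4 : ∑ b, ‖e t (.inl (i, b))‖ ^ 2 = znorm i (e t) := by simp [znorm, add_comm]
    rw [h4]
    linarith


theorem exists_le_of_integral_le {φ : ℝ → ℝ} (hφ : ContinuousOn φ (Icc 0 1)) {c : ℝ}
    (h : ∫ t in (0:ℝ)..1, φ t ≤ c) : ∃ t ∈ Icc (0 : ℝ) 1, φ t ≤ c := by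
  by_contra! hc
  obtain ⟨tm, htm, hmin⟩ := isCompact_Icc.exists_isMinOn (⟨0, by simp⟩ : (Icc (0:ℝ) 1).Nonempty) hφ
  have h1 : ∫ t in (0:ℝ)..1, φ tm ≤ ∫ t in (0:ℝ)..1, φ t := by
    refine intervalIntegral.integral_mono_on zero_le_one intervalIntegrable_const
      (ContinuousOn.intervalIntegrable (by rwa [uIcc_of_le zero_le_one])) fun t ht => hmin ht
  have h2 := hc tm htm
  simp at h1
  linarith

/-- Approximate solutions with small error stay close to the shell, and to the diagonal of the
boundary condition while no Hamiltonian acts on the pairs. -/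
theorem path_rigidity [DecidableEq ι] {R δ₀ ρ cw t₀ : ℝ} (hδ₀ : 0 ≤ δ₀) (hR : 0 ≤ R)
    (hp : ∀ t, HasDerivAt p (-(Complex.I • f t) + lamV r (p t) + e t) t)
    (he : Continuous e) (hν : ∫ t in (0:ℝ)..1, ‖e t‖ ≤ ν) (hν2 : ν ≤ 1 / 2)
    (hδ : 0 ≤ δ) (hδ1 : δ ≤ 1)
    (hforth : ∀ i, ∀ t ∈ Icc (0 : ℝ) 1, inner ℝ (f t) (lamV (Pi.single i 1) (p t)) = 0)
    (hf0 : ∀ t ∈ Icc 0 (1 - δ), ∀ a, f t (.inl a) = 0)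
    (hfw : ∀ t ∈ Icc 0 (1 - δ), ∃ q : ℝ, ∀ l, f t (.inr l) = q • p t (.inr l))
    (hb0 : ∀ i, ‖p 0 (.inl (i, true))‖ = ‖p 0 (.inl (i, false))‖)
    (hb1 : ∀ i, ‖p 1 (.inl (i, true))‖ = ‖p 1 (.inl (i, false))‖)
    (hbw : wnorm (p 1) = wnorm (p 0))
    (hm1 : ∀ i, R ≤ ∫ t in (0:ℝ)..1, znorm i (p t))
    (hm2 : ∀ i, ∫ t in (0:ℝ)..1, znorm i (p t) ≤ R + δ₀)
    (ht₀ : t₀ ∈ Icc 0 (1 - δ)) (hw : wnorm (p t₀) ≤ cw)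
    (hρ1 : 8 * (1 + R + δ₀) * ν + δ₀ ≤ ρ) (hρ2 : 2 * (1 + cw) * ν ≤ ρ) :
    (∀ t ∈ Icc (0 : ℝ) 1, ∀ i, |znorm i (p t) - R| ≤ ρ) ∧
    (∀ a, |‖p (1 - δ) (.inl a)‖ ^ 2 - R / 2| ≤ ρ) ∧ (∀ a, |‖p 1 (.inl a)‖ ^ 2 - R / 2| ≤ ρ) ∧
    wnorm (p (1 - δ)) ≤ cw + ρ ∧ wnorm (p 1) ≤ cw + ρ := by
  have hν0 : 0 ≤ ν := (intervalIntegral.integral_nonneg zero_le_one fun t _ => norm_nonneg _).trans hν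
  set k := 2 * (1 + R + δ₀) * ν with hk
  have hk0 : 0 ≤ k := by positivity
  have hk1 : k ≤ 1 + R + δ₀ := by nlinarith
  have hkρ : 4 * k + δ₀ ≤ ρ := by rw [hk]; linarith
  have hcont : ∀ i, ContinuousOn (fun t => znorm i (p t)) (Icc 0 1) := fun i t _ =>
    (((hasDerivAt_comp_norm_sq (hp t) (.inl (i, false))).add
      (hasDerivAt_comp_norm_sq (hp t) (.inl (i, true)))).continuousAt).continuousWithinAt
  have hz : ∀ i, ∀ t ∈ Icc (0 : ℝ) 1, R - 2 * k ≤ znorm i (p t) ∧ znorm i (p t) ≤ R + δ₀ + k := by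
    intro i t ht
    obtain ⟨s, hs, hs'⟩ := exists_le_of_integral_le (hcont i) (hm2 i)
    obtain ⟨u, hu, hu'⟩ := exists_le_of_integral_le (φ := fun t => -znorm i (p t)) (c := -R)
      (hcont i).neg (by
      have := hm1 i
      rw [intervalIntegral.integral_neg]; linarith)
    have h := path_znorm hp he hν hν2 i (hforth i) hs hs'
    rw [← add_assoc, ← hk] at h
    have h1 := abs_le.1 (h t ht)
    have h2 := abs_le.1 (h u hu)
    constructor <;> linarith
  have hz2 : ∀ t ∈ Icc (0 : ℝ) 1, (∀ i, ‖p t (.inl (i, true))‖ = ‖p t (.inl (i, false))‖) →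
      ∀ a, ‖p t (.inl a)‖ ^ 2 = znorm a.1 (p t) / 2 := by
    rintro t ht h ⟨i, b⟩
    simp only [znorm]
    cases b <;> rw [h] <;> ring
  have h0 : (0 : ℝ) ∈ Icc (0 : ℝ) 1 := by simp
  have h00 : (0 : ℝ) ∈ Icc (0 : ℝ) (1 - δ) := ⟨le_rfl, by linarith⟩
  have h01 : (1 - δ : ℝ) ∈ Icc (0 : ℝ) (1 - δ) := ⟨by linarith, le_rfl⟩
  have h1 : (1 : ℝ) ∈ Icc (0 : ℝ) 1 := by simp
  refine ⟨fun t ht i => ?_, fun a => ?_, fun a => ?_, ?_, ?_⟩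
  · have := hz i t ht
    rw [abs_le]; constructor <;> linarith
  · have e0 := hz2 0 h0 hb0 a
    have e1 := hz a.1 0 h0
    have e2 := abs_le.1 (path_norm_comp hp he hν hν2 hδ hf0 a (c := 1 + R + δ₀) h00
      (by rw [e0]; linarith) (1 - δ) h01)
    rw [e0] at e2
    have e3 : 2 * (1 + (1 + R + δ₀)) * ν ≤ 2 * k := by rw [hk]; nlinarith
    rw [abs_le]; constructor <;> linarith
  · have e0 := hz2 1 h1 hb1 a
    have e1 := hz a.1 1 h1
    rw [e0, abs_le]; constructor <;> linarith
  · have := abs_le.1 (path_wnorm hp he hν hν2 hδ hfw ht₀ hw (1 - δ) h01)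
    linarith
  · have := abs_le.1 (path_wnorm hp he hν hν2 hδ hfw ht₀ hw 0 h00)
    rw [hbw]
    linarith

end Path
end VS

section Modes
variable {ι β : Type} [Fintype ι] [Fintype β] [DecidableEq ι] [DecidableEq β]

/-- The real basis `1, i` of `ℂ`. -/
def cunit (b : Bool) : ℂ := if b then Complex.I else 1

/-- Frequencies of the eigenfunctions of `-i d/dt` for the boundary conditions in use: conjugate
coordinates at the end points for the pairs, and periodicity for the unpaired coordinates. -/
def freq (k : ι ⊕ β) (j : ℤ) : ℝ := Sum.elim (fun _ => Real.pi * j) (fun _ => 2 * Real.pi * j) k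

/-- Initial vectors of the eigenfunctions. -/
def modeVec (k : ι ⊕ β) (b : Bool) : VS ι β :=
  WithLp.toLp 2 (Sum.elim
    (fun a => if k = .inl a.1 then ((√2)⁻¹ : ℝ) * (if a.2 then (starRingEnd ℂ) (cunit b) else cunit b) else 0)
    (fun l => if k = .inr l then cunit b else 0))

/-- The eigenfunctions. -/
def mode (k : ι ⊕ β) (j : ℤ) (b : Bool) (t : ℝ) : VS ι β :=
  Complex.exp ((freq k j * t : ℝ) * Complex.I) • modeVec k b

theorem inner_mode_inl (i : ι) (j : ℤ) (b : Bool) (t : ℝ) (y : VS ι β) :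
    inner ℝ (mode (.inl i) j b t) y = (√2)⁻¹ * ((starRingEnd ℂ) (cunit b) *
      (Complex.exp (-(Real.pi * j * t : ℝ) * Complex.I) * y (.inl (i, false)) +
        Complex.exp ((Real.pi * j * t : ℝ) * Complex.I) * (starRingEnd ℂ) (y (.inl (i, true))))).re := by
  rw [real_inner_VS, Fintype.sum_sum_type, Fintype.sum_prod_type, Finset.sum_eq_single i]
  · have h0 : ∑ l, inner ℝ (mode (.inl i : ι ⊕ β) j b t (.inr l)) (y (.inr l)) = 0 :=
      Finset.sum_eq_zero fun l _ => by simp [mode, modeVec]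
    rw [h0, add_zero]
    simp only [mode, modeVec, freq, PiLp.smul_apply, Sum.elim_inl, if_true, Fintype.sum_bool,
      Complex.inner, smul_eq_mul, map_mul, ← Complex.exp_conj, Complex.conj_ofReal, Complex.conj_I,
      Bool.false_eq_true, if_false, Complex.conj_conj]
    rw [← Complex.re_ofReal_mul, ← Complex.add_re]
    set E := Complex.exp (↑(Real.pi * ↑j * t) * Complex.I) with hE
    have h1 : Complex.exp (↑(Real.pi * ↑j * t) * -Complex.I) = (starRingEnd ℂ) E := by
      rw [hE, ← Complex.exp_conj]; simp
    have h2 : Complex.exp (-↑(Real.pi * ↑j * t) * Complex.I) = (starRingEnd ℂ) E := by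
      rw [hE, ← Complex.exp_conj]; simp
    rw [h1, h2]
    simp only [Complex.add_re, Complex.mul_re, Complex.mul_im, Complex.conj_re, Complex.conj_im,
      Complex.add_im, Complex.ofReal_re, Complex.ofReal_im]
    ring
  · intro i' _ h
    simp [mode, modeVec, h.symm]
  · simp

theorem inner_mode_inr (l : β) (j : ℤ) (b : Bool) (t : ℝ) (y : VS ι β) :
    inner ℝ (mode (.inr l) j b t) y = ((starRingEnd ℂ) (cunit b) *
      (Complex.exp (-(2 * Real.pi * j * t : ℝ) * Complex.I) * y (.inr l))).re := by
  rw [real_inner_VS, Fintype.sum_sum_type]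
  rw [Finset.sum_eq_zero, zero_add, Finset.sum_eq_single l]
  · simp only [mode, modeVec, freq, PiLp.smul_apply, Sum.elim_inr, if_true,
      Complex.inner, smul_eq_mul, map_mul, ← Complex.exp_conj, Complex.conj_ofReal, Complex.conj_I]
    rw [mul_neg, ← neg_mul]
    congr 1
    ring
  · intro i' _ h
    simp [mode, modeVec, h.symm]
  · simp
  · intro a _
    simp [mode, modeVec]

theorem exp_neg_mul_exp (a c t : ℝ) : Complex.exp (-(a * t : ℝ) * Complex.I) *
    Complex.exp ((c * t : ℝ) * Complex.I) = Complex.cos ((c - a) * t) + Complex.sin ((c - a) * t) * Complex.I := by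
  rw [← Complex.exp_add, ← Complex.exp_mul_I]
  congr 1
  push_cast
  ring

theorem integral_cos_int {m : ℤ} (hm : m ≠ 0) : ∫ t in (0:ℝ)..1, Real.cos (Real.pi * m * t) = 0 := by
  have h : Real.pi * m ≠ 0 := mul_ne_zero Real.pi_ne_zero (by exact_mod_cast hm)
  rw [intervalIntegral.integral_comp_mul_left (fun t => Real.cos t) h, integral_cos]
  simp [mul_comm Real.pi, Real.sin_int_mul_pi]

theorem integral_sin_int (m : ℤ) : ∫ t in (0:ℝ)..1, Real.sin (2 * Real.pi * m * t) = 0 := by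
  rcases eq_or_ne m 0 with rfl | hm
  · simp
  have h : 2 * Real.pi * m ≠ 0 := mul_ne_zero (by positivity) (by exact_mod_cast hm)
  rw [intervalIntegral.integral_comp_mul_left (fun t => Real.sin t) h, integral_sin]
  have : Real.cos (2 * Real.pi * m) = 1 := by
    rw [mul_comm]; exact Real.cos_int_mul_two_pi m
  simp [this]

theorem integral_inner_mode (k k' : ι ⊕ β) (j j' : ℤ) (b b' : Bool) :
    ∫ t in (0:ℝ)..1, inner ℝ (mode k j b t) (mode k' j' b' t)
      = if k = k' ∧ j = j' ∧ b = b' then 1 else 0 := by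
  have hs : (√2)⁻¹ * (√2)⁻¹ = (1 / 2 : ℝ) := by
    rw [← mul_inv, Real.mul_self_sqrt (by norm_num)]; norm_num
  rcases k with i | l
  · by_cases hk : k' = .inl i
    · subst hk
      have key : ∀ t : ℝ, inner ℝ (mode (.inl i : ι ⊕ β) j b t) (mode (.inl i) j' b' t)
          = if b = b' then Real.cos (Real.pi * (j' - j : ℤ) * t) else 0 := by
        intro t
        rw [inner_mode_inl]
        simp only [mode, modeVec, freq, PiLp.smul_apply, Sum.elim_inl, if_true, smul_eq_mul, map_mul,
          Bool.false_eq_true, if_false, ← Complex.exp_conj, Complex.conj_ofReal, Complex.conj_I,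
          Complex.conj_conj]
        have e1 := exp_neg_mul_exp (Real.pi * j) (Real.pi * j') t
        have e2 := exp_neg_mul_exp (Real.pi * j') (Real.pi * j) t
        rw [show ((Real.pi * j' * t : ℝ) : ℂ) * -Complex.I = -((Real.pi * j' * t : ℝ) : ℂ) * Complex.I by ring]
        rw [← mul_assoc, e1, ← mul_assoc (Complex.exp ((Real.pi * j * t : ℝ) * Complex.I)),
          mul_comm (Complex.exp ((Real.pi * j * t : ℝ) * Complex.I)), e2]
        have e3 : (((Real.pi * j : ℝ) : ℂ) - ((Real.pi * j' : ℝ) : ℂ)) * t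
          = -((((Real.pi * j' : ℝ) : ℂ) - ((Real.pi * j : ℝ) : ℂ)) * t) := by ring
        rw [e3, Complex.cos_neg, Complex.sin_neg]
        have e4 : (((Real.pi * j' : ℝ) : ℂ) - ((Real.pi * j : ℝ) : ℂ)) * t
          = ((Real.pi * (j' - j : ℤ) * t : ℝ) : ℂ) := by push_cast; ring
        rw [e4, ← Complex.ofReal_cos, ← Complex.ofReal_sin]
        generalize Real.pi * (j' - j : ℤ) * t = x
        generalize (√2)⁻¹ = σ at hs
        generalize Real.cos x = u
        generalize Real.sin x = v
        cases b <;> cases b' <;> simp [cunit] <;> linear_combination (2 * u) * hs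
      simp only [key]
      by_cases hb : b = b'
      · by_cases hj : j = j'
        · simp [hb, hj]
        · simp only [hb, if_true]
          rw [integral_cos_int (sub_ne_zero.2 (Ne.symm hj))]
          simp [hj]
      · simp [hb]
    · rw [if_neg fun h => hk h.1.symm]
      have : ∀ t, inner ℝ (mode (.inl i : ι ⊕ β) j b t) (mode k' j' b' t) = 0 := fun t => by
        rw [inner_mode_inl]; simp [mode, modeVec, hk]
      simp [this]
  · by_cases hk : k' = .inr l
    · subst hk
      have key : ∀ t : ℝ, inner ℝ (mode (.inr l : ι ⊕ β) j b t) (mode (.inr l) j' b' t)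
          = (if b = b' then 1 else 0) * Real.cos (Real.pi * (2 * (j' - j) : ℤ) * t)
            + (if b = b' then 0 else if b then 1 else -1) * Real.sin (2 * Real.pi * (j' - j : ℤ) * t) := by
        intro t
        rw [inner_mode_inr]
        simp only [mode, modeVec, freq, PiLp.smul_apply, Sum.elim_inr, if_true, smul_eq_mul]
        have e1 := exp_neg_mul_exp (2 * Real.pi * j) (2 * Real.pi * j') t
        rw [← mul_assoc (Complex.exp _), e1]
        have e4 : (((2 * Real.pi * j' : ℝ) : ℂ) - ((2 * Real.pi * j : ℝ) : ℂ)) * t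
          = ((2 * Real.pi * (j' - j : ℤ) * t : ℝ) : ℂ) := by push_cast; ring
        rw [e4, ← Complex.ofReal_cos, ← Complex.ofReal_sin]
        have e5 : Real.pi * (2 * (j' - j) : ℤ) * t = 2 * Real.pi * (j' - j : ℤ) * t := by
          push_cast; ring
        rw [e5]
        generalize 2 * Real.pi * (j' - j : ℤ) * t = x
        generalize Real.cos x = u
        generalize Real.sin x = v
        cases b <;> cases b' <;> simp [cunit]
      simp only [key]
      rw [intervalIntegral.integral_add (Continuous.intervalIntegrable (by fun_prop) _ _)
        (Continuous.intervalIntegrable (by fun_prop) _ _), intervalIntegral.integral_const_mul,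
        intervalIntegral.integral_const_mul, integral_sin_int, mul_zero, add_zero]
      by_cases hj : j = j'
      · simp [hj]
      · rw [integral_cos_int (by omega)]
        simp [hj]
    · rw [if_neg fun h => hk h.1.symm]
      have : ∀ t, inner ℝ (mode (.inr l : ι ⊕ β) j b t) (mode k' j' b' t) = 0 := fun t => by
        rw [inner_mode_inr]; simp [mode, modeVec, hk]
      simp [this]

end Modes

theorem hasSum_of_eq {γ : Type} {f g : γ → ℝ} {a : ℝ} (h : HasSum g a) (e : ∀ j, f j = g j) :
    HasSum f a := (funext e) ▸ h

/-- The `L²` norm of two functions on `[0,1]` from the Fourier coefficients of their concatenation. -/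
theorem hasSum_sq_concat {u v : ℝ → ℂ} (hu : Continuous u) (hv : Continuous v) :
    HasSum (fun j : ℤ => ‖∫ t in (0:ℝ)..1, (Complex.exp (-(Real.pi * j * t : ℝ) * Complex.I) * u t +
      Complex.exp ((Real.pi * j * t : ℝ) * Complex.I) * v t)‖ ^ 2)
      (2 * ∫ t in (0:ℝ)..1, (‖u t‖ ^ 2 + ‖v t‖ ^ 2)) := by
  classical
  have hab : (-1 : ℝ) < 1 := by norm_num
  set F : ℝ → ℂ := (Ioi (0:ℝ)).piecewise u (fun t => v (-t)) with hF
  have hcm : ∀ g : ℝ → ℂ, Continuous g → MemLp g 2 (volume.restrict (Ioc (-1 : ℝ) 1)) := by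
    intro g hg
    obtain ⟨C, hC⟩ := (isCompact_Icc (a := (-1:ℝ)) (b := 1)).exists_bound_of_continuousOn hg.continuousOn
    refine MemLp.of_bound hg.aestronglyMeasurable C ?_
    filter_upwards [ae_restrict_mem measurableSet_Ioc] with t ht using hC t ⟨ht.1.le, ht.2⟩
  have hmem : MemLp F 2 (volume.restrict (Ioc (-1 : ℝ) 1)) :=
    MemLp.piecewise measurableSet_Ioi ((hcm u hu).mono_measure Measure.restrict_le_self)
      ((hcm _ (hv.comp continuous_neg)).mono_measure Measure.restrict_le_self)
  have hpos : ∀ t ∈ Ioc (0:ℝ) 1, F t = u t := fun t ht => by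
    rw [hF, piecewise_eq_of_mem _ _ _ (show t ∈ Ioi (0:ℝ) from ht.1)]
  have hneg : ∀ t ∈ Ioc (-1:ℝ) 0, F t = v (-t) := fun t ht => by
    rw [hF, piecewise_eq_of_notMem _ _ _ (show t ∉ Ioi (0:ℝ) from not_lt.2 ht.2)]
  have split : ∀ {G : Type} [NormedAddCommGroup G] [NormedSpace ℝ G] (Φ : ℝ → ℂ → G) (_ : Continuous fun p : ℝ × ℂ => Φ p.1 p.2),
      ∫ t in (-1:ℝ)..1, Φ t (F t) = ∫ t in (0:ℝ)..1, (Φ t (u t) + Φ (-t) (v t)) := by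
    intro G _ _ Φ hΦ
    have c1 : Continuous fun t => Φ t (u t) := hΦ.comp (continuous_id.prodMk hu)
    have c2 : Continuous fun t => Φ (-t) (v t) := hΦ.comp (continuous_neg.prodMk hv)
    have c3 : Continuous fun t => Φ t (v (-t)) := hΦ.comp (continuous_id.prodMk (hv.comp continuous_neg))
    have e1 : ∀ t ∈ Set.uIoc (0:ℝ) 1, Φ t (u t) = Φ t (F t) := fun t ht => by
      rw [uIoc_of_le zero_le_one] at ht
      rw [hpos t ht]
    have e2 : ∀ t ∈ Set.uIoc (-1:ℝ) 0, Φ t (v (-t)) = Φ t (F t) := fun t ht => by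
      rw [uIoc_of_le (by norm_num)] at ht
      rw [hneg t ht]
    have i1 : IntervalIntegrable (fun t => Φ t (F t)) volume 0 1 :=
      (c1.intervalIntegrable 0 1).congr e1
    have i2 : IntervalIntegrable (fun t => Φ t (F t)) volume (-1) 0 :=
      (c3.intervalIntegrable (-1) 0).congr e2
    rw [← intervalIntegral.integral_add_adjacent_intervals i2 i1,
      intervalIntegral.integral_add (c1.intervalIntegrable _ _) (c2.intervalIntegrable _ _),
      add_comm]
    congr 1
    · exact intervalIntegral.integral_congr_ae (.of_forall fun t ht => (e1 t ht).symm)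
    · rw [← intervalIntegral.integral_congr_ae (.of_forall fun t ht => e2 t ht)]
      have := intervalIntegral.integral_comp_neg (a := 0) (b := 1) (fun t => Φ t (v (-t)))
      simp only [neg_neg, neg_zero] at this
      exact this.symm
  have h := hasSum_sq_fourierCoeffOn hab hmem
  have h4 := h.mul_left (4:ℝ)
  have hval : 2 * ∫ t in (0:ℝ)..1, (‖u t‖ ^ 2 + ‖v t‖ ^ 2) = 4 * (((1:ℝ) - -1)⁻¹ • ∫ x in (-1:ℝ)..1, ‖F x‖ ^ 2) := by
    rw [split (fun t z => ‖z‖ ^ 2) (by fun_prop)]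
    simp only [smul_eq_mul]
    norm_num
    ring
  rw [hval]
  refine hasSum_of_eq h4 fun j => ?_
  · rw [fourierCoeffOn_eq_integral]
    have := split (G := ℂ) (fun (t : ℝ) (z : ℂ) => fourier (-j) (t : AddCircle ((1:ℝ) - -1)) • z) (by
      refine Continuous.smul (?_ : Continuous fun p : ℝ × ℂ => fourier (-j) (p.1 : AddCircle ((1:ℝ) - -1))) continuous_snd
      exact (fourier (T := (1:ℝ) - -1) (-j)).continuous.comp ((AddCircle.continuous_mk' ((1:ℝ) - -1)).comp continuous_fst))
    rw [this]
    have e : ∀ t : ℝ, fourier (-j) ((t:ℝ) : AddCircle ((1:ℝ) - -1)) = Complex.exp (-(Real.pi * j * t : ℝ) * Complex.I) := by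
      intro t
      rw [fourier_coe_apply]
      congr 1
      push_cast
      ring
    simp only [e, smul_eq_mul]
    rw [norm_smul, mul_pow]
    norm_num
    ring

theorem hasSum_sq_periodic {u : ℝ → ℂ} (hu : Continuous u) :
    HasSum (fun j : ℤ => ‖∫ t in (0:ℝ)..1, Complex.exp (-(2 * Real.pi * j * t : ℝ) * Complex.I) * u t‖ ^ 2)
      (∫ t in (0:ℝ)..1, ‖u t‖ ^ 2) := by
  have hmem : MemLp u 2 (volume.restrict (Ioc (0 : ℝ) 1)) := by
    obtain ⟨C, hC⟩ := (isCompact_Icc (a := (0:ℝ)) (b := 1)).exists_bound_of_continuousOn hu.continuousOn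
    refine MemLp.of_bound hu.aestronglyMeasurable C ?_
    filter_upwards [ae_restrict_mem measurableSet_Ioc] with t ht using hC t ⟨ht.1.le, ht.2⟩
  have h := hasSum_sq_fourierCoeffOn (zero_lt_one' ℝ) hmem
  convert h using 1
  · ext j
    rw [fourierCoeffOn_eq_integral]
    have e : ∀ t : ℝ, fourier (-j) ((t:ℝ) : AddCircle ((1:ℝ) - 0)) = Complex.exp (-(2 * Real.pi * j * t : ℝ) * Complex.I) := by
      intro t
      rw [fourier_coe_apply]
      congr 1
      push_cast
      ring
    simp only [e, smul_eq_mul]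
    norm_num
  · simp

section
variable {ι β : Type} [Fintype ι] [Fintype β] [DecidableEq ι] [DecidableEq β]

/-- Squared norm of one block of coordinates. -/
def blkNorm (k : ι ⊕ β) (y : VS ι β) : ℝ :=
  Sum.elim (fun i => znorm i y) (fun l => ‖y (.inr l)‖ ^ 2) k

theorem sum_blkNorm (y : VS ι β) : ∑ k, blkNorm k y = ‖y‖ ^ 2 := by
  rw [norm_sq_VS, Fintype.sum_sum_type]
  rfl

/-- Coefficients with respect to the eigenfunctions. -/
def coef (f : ℝ → VS ι β) (k : ι ⊕ β) (j : ℤ) (b : Bool) : ℝ :=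
  ∫ t in (0:ℝ)..1, inner ℝ (mode k j b t) (f t)

@[fun_prop]
theorem continuous_mode (k : ι ⊕ β) (j : ℤ) (b : Bool) : Continuous (mode k j b) := by
  unfold mode; fun_prop

theorem continuous_comp {f : ℝ → VS ι β} (hf : Continuous f) (c) : Continuous fun t => f t c :=
  (EuclideanSpace.proj (𝕜 := ℂ) c).continuous.comp hf

theorem continuous_blkNorm (k : ι ⊕ β) : Continuous (blkNorm k) := by
  have h : ∀ c, Continuous fun y : VS ι β => y c := fun c => (EuclideanSpace.proj (𝕜 := ℂ) c).continuous
  rcases k with i | l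
  · exact (((h _).norm.pow 2).add ((h _).norm.pow 2))
  · exact (h _).norm.pow 2

theorem sum_sq_re_cunit (z : ℂ) : ∑ b, (((starRingEnd ℂ) (cunit b)) * z).re ^ 2 = ‖z‖ ^ 2 := by
  rw [Fintype.sum_bool, Complex.sq_norm, Complex.normSq_apply]
  simp [cunit]
  ring

theorem hasSum_coef_sq (k : ι ⊕ β) {f : ℝ → VS ι β} (hf : Continuous f) :
    HasSum (fun j => ∑ b, coef f k j b ^ 2) (∫ t in (0:ℝ)..1, blkNorm k (f t)) := by
  have hre : ∀ (g : ℝ → ℂ), Continuous g → ∫ t in (0:ℝ)..1, (g t).re = (∫ t in (0:ℝ)..1, g t).re := by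
    intro g hg
    exact (Complex.reCLM.intervalIntegral_comp_comm (hg.intervalIntegrable 0 1))
  rcases k with i | l
  · have c0 := continuous_comp hf (.inl (i, false))
    have c1 := Complex.continuous_conj.comp (continuous_comp hf (.inl (i, true)))
    have h := (hasSum_sq_concat c0 c1).mul_left (1/2 : ℝ)
    have hval : ∫ t in (0:ℝ)..1, blkNorm (.inl i) (f t) = 1 / 2 * (2 * ∫ t in (0:ℝ)..1,
        (‖f t (.inl (i, false))‖ ^ 2 + ‖((starRingEnd ℂ) ∘ fun t => f t (.inl (i, true))) t‖ ^ 2)) := by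
      simp [blkNorm, znorm]
    rw [hval]
    refine hasSum_of_eq h fun j => ?_
    · rw [← sum_sq_re_cunit, Finset.mul_sum]
      refine Finset.sum_congr rfl fun b _ => ?_
      have : coef f (.inl i) j b = (√2)⁻¹ * ((starRingEnd ℂ) (cunit b) * ∫ t in (0:ℝ)..1,
          (Complex.exp (-(Real.pi * j * t : ℝ) * Complex.I) * f t (.inl (i, false)) +
            Complex.exp ((Real.pi * j * t : ℝ) * Complex.I) * (starRingEnd ℂ) (f t (.inl (i, true))))).re := by
        simp only [coef, inner_mode_inl]
        rw [intervalIntegral.integral_const_mul, hre, intervalIntegral.integral_const_mul]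
        simp only [Function.comp_def] at c1
        fun_prop
      rw [this, mul_pow, inv_pow, Real.sq_sqrt (by norm_num), one_div]
      rfl
  · have c0 := continuous_comp hf (.inr l)
    refine hasSum_of_eq (hasSum_sq_periodic c0) fun j => ?_
    rw [← sum_sq_re_cunit]
    refine Finset.sum_congr rfl fun b _ => ?_
    simp only [coef, inner_mode_inr]
    rw [hre, intervalIntegral.integral_const_mul]
    fun_prop

end

section Paths
variable {ι β : Type} [Fintype ι] [Fintype β] [DecidableEq ι] [DecidableEq β]

/-- Indices of the eigenfunctions of order at most `N`. -/
abbrev Lam (ι β : Type) (N : ℕ) : Type := (ι ⊕ β) × ↥(Finset.Icc (-(N : ℤ)) N) × Bool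

variable {N : ℕ}

/-- The block of an index. -/
def lblk (α : Lam ι β N) : Option ι := α.1.elim some fun _ => none

/-- The frequency of an index. -/
def lfreq (α : Lam ι β N) : ℝ := freq α.1 α.2.1

/-- The path with given coefficients. -/
def apath (x : EuclideanSpace ℝ (Lam ι β N)) (t : ℝ) : VS ι β := ∑ α, x α • mode α.1 α.2.1 α.2.2 t

/-- The low order coefficients of a path. -/
def pcoef (N : ℕ) (f : ℝ → VS ι β) : EuclideanSpace ℝ (Lam ι β N) :=
  WithLp.toLp 2 fun α => coef f α.1 α.2.1 α.2.2

@[fun_prop]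
theorem continuous_apath (x : EuclideanSpace ℝ (Lam ι β N)) : Continuous (apath x) := by
  unfold apath; fun_prop

theorem apath_add (x y : EuclideanSpace ℝ (Lam ι β N)) (t : ℝ) :
    apath (x + y) t = apath x t + apath y t := by
  simp [apath, add_smul, Finset.sum_add_distrib]

theorem apath_sub (x y : EuclideanSpace ℝ (Lam ι β N)) (t : ℝ) :
    apath (x - y) t = apath x t - apath y t := by
  simp [apath, sub_smul, Finset.sum_sub_distrib]

theorem coef_sub {f g : ℝ → VS ι β} (hf : Continuous f) (hg : Continuous g) (k j b) :
    coef (fun t => f t - g t) k j b = coef f k j b - coef g k j b := by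
  simp only [coef, inner_sub_right]
  exact intervalIntegral.integral_sub (Continuous.intervalIntegrable (by fun_prop) _ _)
    (Continuous.intervalIntegrable (by fun_prop) _ _)

theorem pcoef_sub {f g : ℝ → VS ι β} (hf : Continuous f) (hg : Continuous g) :
    pcoef N (fun t => f t - g t) = pcoef N f - pcoef N g := by
  ext α
  exact coef_sub hf hg _ _ _

theorem coef_apath (x : EuclideanSpace ℝ (Lam ι β N)) (k j b) :
    coef (apath x) k j b = if h : j ∈ Finset.Icc (-(N : ℤ)) N then x (k, ⟨j, h⟩, b) else 0 := by
  simp only [coef, apath, inner_sum, real_inner_smul_right]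
  rw [intervalIntegral.integral_finsetSum fun α _ => Continuous.intervalIntegrable (by fun_prop) _ _]
  simp only [intervalIntegral.integral_const_mul, integral_inner_mode]
  split_ifs with h
  · rw [Finset.sum_eq_single (k, ⟨j, h⟩, b)]
    · simp
    · rintro ⟨k', ⟨j', hj'⟩, b'⟩ - hne
      rw [if_neg, mul_zero]
      rintro ⟨rfl, rfl, rfl⟩
      exact hne rfl
    · simp
  · refine Finset.sum_eq_zero ?_
    rintro ⟨k', ⟨j', hj'⟩, b'⟩ -
    rw [if_neg, mul_zero]
    rintro ⟨rfl, rfl, rfl⟩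
    exact h hj'

theorem pcoef_apath (x : EuclideanSpace ℝ (Lam ι β N)) : pcoef N (apath x) = x := by
  ext ⟨k, ⟨j, hj⟩, b⟩
  exact (coef_apath x k j b).trans (dif_pos hj)

theorem integral_inner_apath (x : EuclideanSpace ℝ (Lam ι β N)) {f : ℝ → VS ι β} (hf : Continuous f) :
    ∫ t in (0:ℝ)..1, inner ℝ (apath x t) (f t) = inner ℝ x (pcoef N f) := by
  simp only [apath, sum_inner, real_inner_smul_left]
  rw [intervalIntegral.integral_finsetSum fun α _ => Continuous.intervalIntegrable (by fun_prop) _ _,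
    PiLp.inner_apply]
  refine Finset.sum_congr rfl fun α _ => ?_
  rw [intervalIntegral.integral_const_mul]
  simp [pcoef, coef, mul_comm]

theorem integral_norm_sq_apath (x : EuclideanSpace ℝ (Lam ι β N)) :
    ∫ t in (0:ℝ)..1, ‖apath x t‖ ^ 2 = ‖x‖ ^ 2 := by
  have := integral_inner_apath x (continuous_apath x)
  rw [pcoef_apath, real_inner_self_eq_norm_sq] at this
  simpa [real_inner_self_eq_norm_sq] using this

theorem integral_blkNorm_apath (x : EuclideanSpace ℝ (Lam ι β N)) (k : ι ⊕ β) :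
    ∫ t in (0:ℝ)..1, blkNorm k (apath x t) = ∑ j, ∑ b, x (k, j, b) ^ 2 := by
  have h1 := hasSum_coef_sq k (continuous_apath x)
  have h2 := hasSum_sum_of_ne_finset_zero (L := SummationFilter.unconditional ℤ) (s := Finset.Icc (-(N : ℤ)) N)
    (f := fun j => ∑ b, coef (apath x) k j b ^ 2) (fun j hj => by simp [coef_apath, hj])
  rw [h1.unique h2, ← Finset.sum_coe_sort]
  refine Finset.sum_congr rfl fun j _ => Finset.sum_congr rfl fun b _ => ?_
  rw [coef_apath, dif_pos j.2]

theorem integral_znorm_apath (x : EuclideanSpace ℝ (Lam ι β N)) (i : ι) :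
    ∫ t in (0:ℝ)..1, znorm i (apath x t) = blockInner lblk i x x := by
  have := integral_blkNorm_apath x (.inl i)
  simp only [blkNorm, Sum.elim_inl] at this
  rw [this, blockInner, Fintype.sum_prod_type, Fintype.sum_sum_type, Finset.sum_eq_single i]
  · simp [lblk, Fintype.sum_prod_type, sq]
  · intro i' _ h
    simp [lblk, h]
  · simp

theorem integral_wnorm_apath (x : EuclideanSpace ℝ (Lam ι β N)) :
    ∫ t in (0:ℝ)..1, wnorm (apath x t) = ∑ l, ∑ j, ∑ b, x (.inr l, j, b) ^ 2 := by
  simp only [wnorm]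
  rw [intervalIntegral.integral_finsetSum fun l _ => Continuous.intervalIntegrable ?_ _ _]
  · exact Finset.sum_congr rfl fun l _ => integral_blkNorm_apath x (.inr l)
  · exact (continuous_blkNorm (.inr l)).comp (continuous_apath x)

theorem integral_norm_sq_eq {f : ℝ → VS ι β} (hf : Continuous f) :
    ∫ t in (0:ℝ)..1, ‖f t‖ ^ 2 = ∑ k, ∫ t in (0:ℝ)..1, blkNorm k (f t) := by
  rw [← intervalIntegral.integral_finsetSum (f := fun k t => blkNorm k (f t)) fun k _ =>
    Continuous.intervalIntegrable ((continuous_blkNorm k).comp hf) _ _]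
  simp only [sum_blkNorm]

theorem norm_pcoef_sq_le {f : ℝ → VS ι β} (hf : Continuous f) :
    ‖pcoef N f‖ ^ 2 ≤ ∫ t in (0:ℝ)..1, ‖f t‖ ^ 2 := by
  rw [integral_norm_sq_eq hf, EuclideanSpace.norm_sq_eq, Fintype.sum_prod_type]
  refine Finset.sum_le_sum fun k _ => ?_
  have h := sum_le_hasSum (Finset.Icc (-(N : ℤ)) N)
    (fun j _ => Finset.sum_nonneg fun b _ => sq_nonneg _) (hasSum_coef_sq k hf)
  refine le_trans (le_of_eq ?_) h
  rw [← Finset.sum_coe_sort (Finset.Icc (-(N : ℤ)) N), Fintype.sum_prod_type]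
  simp [pcoef]

theorem hasDerivAt_mode (k : ι ⊕ β) (j : ℤ) (b : Bool) (t : ℝ) :
    HasDerivAt (mode k j b) (Complex.I • freq k j • mode k j b t) t := by
  have h1 : HasDerivAt (fun t : ℝ => ((freq k j * t : ℝ) : ℂ) * Complex.I) (freq k j * Complex.I) t := by
    have : HasDerivAt (fun t : ℝ => freq k j * t) (freq k j) t := by
      simpa using (hasDerivAt_id t).const_mul (freq k j)
    exact this.ofReal_comp.mul_const _
  have h2 := h1.cexp.smul_const (modeVec k b : VS ι β)
  refine HasDerivAt.congr_deriv h2 ?_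
  simp only [mode]
  rw [← Complex.coe_smul (freq k j), smul_smul, smul_smul]
  congr 1
  ring

theorem hasDerivAt_apath (x : EuclideanSpace ℝ (Lam ι β N)) (t : ℝ) :
    HasDerivAt (apath x) (Complex.I • apath (diagMul lfreq x) t) t := by
  have := HasDerivAt.fun_sum (u := Finset.univ) fun (α : Lam ι β N) _ =>
    (hasDerivAt_mode (ι := ι) (β := β) α.1 α.2.1 α.2.2 t).const_smul (x α)
  refine HasDerivAt.congr_deriv this ?_
  simp only [apath, Finset.smul_sum, diagMul, lfreq]
  refine Finset.sum_congr rfl fun α _ => ?_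
  rw [smul_comm (x α), smul_smul, mul_comm]

theorem apath_blockFlip (η : ι → ℤˣ) (x : EuclideanSpace ℝ (Lam ι β N)) (t : ℝ) :
    apath (blockFlip lblk η x) t = rotV (fun i => (sgn (η i) : ℂ)) (apath x t) := by
  ext c
  have e : ∀ y : EuclideanSpace ℝ (Lam ι β N), apath y t c = ∑ α, (y α : ℂ) * mode α.1 α.2.1 α.2.2 t c := by
    intro y
    simp [apath]
  rcases c with ⟨i, b'⟩ | l
  · simp only [rotV, Sum.elim_inl, e, Finset.mul_sum]
    refine Finset.sum_congr rfl ?_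
    rintro ⟨k | k, j, b⟩ -
    · by_cases h : k = i
      · subst h
        simp [blockFlip, lblk, mul_assoc]
      · simp [mode, modeVec, h]
    · simp [mode, modeVec]
  · simp only [rotV, Sum.elim_inr, e]
    refine Finset.sum_congr rfl ?_
    rintro ⟨k | k, j, b⟩ -
    · simp [mode, modeVec]
    · simp [blockFlip, lblk]

theorem apath_boundary (x : EuclideanSpace ℝ (Lam ι β N)) (i : ι) (n : ℤ) :
    apath x n (.inl (i, true)) = (starRingEnd ℂ) (apath x n (.inl (i, false))) := by
  simp only [apath, PiLp.smul_apply, WithLp.ofLp_sum, Finset.sum_apply, map_sum]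
  refine Finset.sum_congr rfl ?_
  rintro ⟨k | k, j, b⟩ -
  · have h : (starRingEnd ℂ) (Complex.exp ((Real.pi * j * n : ℝ) * Complex.I)) = Complex.exp ((Real.pi * j * n : ℝ) * Complex.I) := by
      rw [← Complex.exp_conj, Complex.exp_eq_exp_iff_exists_int]
      refine ⟨-(j * n), ?_⟩
      simp
      ring
    by_cases hk : k = i
    · simp [mode, modeVec, hk, freq] at h ⊢
      simp [h]
    · simp [mode, modeVec, hk]
  · simp [mode, modeVec]

theorem apath_one_inr (x : EuclideanSpace ℝ (Lam ι β N)) (l : β) :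
    apath x 1 (.inr l) = apath x 0 (.inr l) := by
  simp only [apath, PiLp.smul_apply, WithLp.ofLp_sum, Finset.sum_apply]
  refine Finset.sum_congr rfl ?_
  rintro ⟨k | k, j, b⟩ -
  · simp [mode, modeVec]
  · have h : Complex.exp (2 * Real.pi * j * Complex.I) = 1 := by
      rw [Complex.exp_eq_one_iff]; exact ⟨j, by ring⟩
    simp [mode, freq, h]

theorem apath_mul_block (r : ι → ℝ) (x : EuclideanSpace ℝ (Lam ι β N)) (t : ℝ) :
    Complex.I • apath (WithLp.toLp 2 fun α => (lblk α).elim 0 r * x α) t = lamV r (apath x t) := by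
  ext c
  have e : ∀ y : EuclideanSpace ℝ (Lam ι β N), apath y t c = ∑ α, (y α : ℂ) * mode α.1 α.2.1 α.2.2 t c := by
    intro y
    simp [apath]
  rw [PiLp.smul_apply]
  rcases c with ⟨i, b'⟩ | l
  · simp only [lamV, Sum.elim_inl, e, Finset.mul_sum, smul_eq_mul]
    refine Finset.sum_congr rfl ?_
    rintro ⟨k | k, j, b⟩ -
    · by_cases h : k = i
      · subst h
        simp [lblk]
        ring
      · simp [mode, modeVec, h]
    · simp [mode, modeVec]
  · simp only [lamV, Sum.elim_inr, e, smul_eq_mul]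
    rw [Finset.sum_eq_zero, mul_zero]
    rintro ⟨k | k, j, b⟩ -
    · simp [mode, modeVec]
    · simp [lblk]

/-- Integration by parts. -/
theorem coef_deriv {f f' : ℝ → VS ι β} (hf : ∀ t, HasDerivAt f (f' t) t) (hf' : Continuous f')
    (h0 : f 0 = 0) (h1 : f 1 = 0) (k : ι ⊕ β) (j : ℤ) (b : Bool) :
    coef (fun t => -(Complex.I • f' t)) k j b = freq k j * coef f k j b := by
  have hII : ∀ u v : VS ι β, inner ℝ (Complex.I • u) (Complex.I • v) = inner ℝ u v := by
    intro u v
    rw [real_inner_VS, real_inner_VS]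
    refine Finset.sum_congr rfl fun c _ => ?_
    simp [Complex.inner]
  have hfc : Continuous f := continuous_iff_continuousAt.2 fun t => (hf t).continuousAt
  have hd : ∀ t, HasDerivAt (fun t => inner ℝ (mode k j b t) (Complex.I • f t))
      (inner ℝ (mode k j b t) (Complex.I • f' t) +
        inner ℝ (Complex.I • freq k j • mode k j b t) (Complex.I • f t)) t := fun t =>
    (hasDerivAt_mode k j b t).inner ℝ ((hf t).const_smul Complex.I)
  have hintegral := intervalIntegral.integral_eq_sub_of_hasDerivAt (a := 0) (b := 1) (fun t _ => hd t)
    (Continuous.intervalIntegrable (by fun_prop) _ _)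
  rw [h0, h1] at hintegral
  simp only [hII, smul_zero, inner_zero_right, sub_zero, real_inner_smul_left] at hintegral
  rw [intervalIntegral.integral_add (Continuous.intervalIntegrable (by fun_prop) _ _)
    (Continuous.intervalIntegrable (by fun_prop) _ _), intervalIntegral.integral_const_mul] at hintegral
  simp only [coef, inner_neg_right, intervalIntegral.integral_neg]
  linarith

theorem integral_norm_sub_apath_pcoef_le {f f' : ℝ → VS ι β} (hf : ∀ t, HasDerivAt f (f' t) t)
    (hf' : Continuous f') (h0 : f 0 = 0) (h1 : f 1 = 0) :
    ∫ t in (0:ℝ)..1, ‖f t - apath (pcoef N f) t‖ ^ 2 ≤ ((N + 1 : ℝ) ^ 2)⁻¹ * ∫ t in (0:ℝ)..1, ‖f' t‖ ^ 2 := by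
  have hfc : Continuous f := continuous_iff_continuousAt.2 fun t => (hf t).continuousAt
  have hg : Continuous fun t => f t - apath (pcoef N f) t := by fun_prop
  have hF : Continuous fun t => -(Complex.I • f' t) := by fun_prop
  have e : ∫ t in (0:ℝ)..1, ‖f' t‖ ^ 2 = ∫ t in (0:ℝ)..1, ‖-(Complex.I • f' t)‖ ^ 2 := by
    simp [norm_smul]
  rw [e, integral_norm_sq_eq hg, integral_norm_sq_eq hF, Finset.mul_sum]
  refine Finset.sum_le_sum fun k _ => ?_
  refine hasSum_le (fun j => ?_) (hasSum_coef_sq k hg) ((hasSum_coef_sq k hF).mul_left _)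
  rw [Finset.mul_sum]
  refine Finset.sum_le_sum fun b _ => ?_
  rw [coef_sub hfc (continuous_apath _), coef_apath, coef_deriv hf hf' h0 h1]
  split_ifs with hj
  · have : coef f k j b - (pcoef N f) (k, ⟨j, hj⟩, b) = 0 := sub_self _
    rw [this]
    simp only [ne_eq, OfNat.ofNat_ne_zero, not_false_eq_true, zero_pow]; positivity
  · rw [sub_zero, mul_pow, ← mul_assoc]
    refine le_mul_of_one_le_left (sq_nonneg _) ?_
    rw [inv_mul_eq_div, one_le_div (by positivity), sq_le_sq, abs_of_nonneg (by positivity)]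
    have hj' : (N + 1 : ℝ) ≤ |(j : ℝ)| := by
      rw [Finset.mem_Icc, not_and_or] at hj
      have : (N + 1 : ℤ) ≤ |j| := by
        rw [le_abs]; omega
      exact_mod_cast this
    refine hj'.trans ?_
    have hp := Real.pi_gt_three
    have hj0 := abs_nonneg (j : ℝ)
    rcases k with i | l <;> simp [freq, abs_mul, abs_of_pos Real.pi_pos] <;> nlinarith

/-- Comparison of the mean with the quadratic mean. -/
theorem integral_norm_le_of_sq {E : Type} [NormedAddCommGroup E] {g : ℝ → E} (hg : Continuous g) {c : ℝ}
    (hc : 0 ≤ c) (h : ∫ t in (0:ℝ)..1, ‖g t‖ ^ 2 ≤ c ^ 2) : ∫ t in (0:ℝ)..1, ‖g t‖ ≤ c := by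
  set m := ∫ t in (0:ℝ)..1, ‖g t‖ with hm
  have h1 : 0 ≤ ∫ t in (0:ℝ)..1, (‖g t‖ - m) ^ 2 :=
    intervalIntegral.integral_nonneg zero_le_one fun _ _ => sq_nonneg _
  have h2 : ∫ t in (0:ℝ)..1, (‖g t‖ - m) ^ 2 = (∫ t in (0:ℝ)..1, ‖g t‖ ^ 2) - m ^ 2 := by
    have : ∀ t, (‖g t‖ - m) ^ 2 = ‖g t‖ ^ 2 - 2 * m * ‖g t‖ + m ^ 2 := fun t => by ring
    simp only [this]
    rw [intervalIntegral.integral_add (Continuous.intervalIntegrable (by fun_prop) _ _)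
      (Continuous.intervalIntegrable (by fun_prop) _ _), intervalIntegral.integral_sub
      (Continuous.intervalIntegrable (by fun_prop) _ _) (Continuous.intervalIntegrable (by fun_prop) _ _),
      intervalIntegral.integral_const_mul, ← hm]
    simp
    ring
  exact abs_le_of_sq_le_sq' (by linarith) hc |>.2

end Paths

section Nice
variable {V : Type} [NormedAddCommGroup V] [InnerProductSpace ℝ V] [CompleteSpace V]

/-- `F` is the gradient of the time-dependent function `k`, is continuously differentiable, and is
bounded by `C` together with its derivative. -/
structure NiceGrad (k : ℝ → V → ℝ) (F : ℝ → V → V) (C : ℝ) : Prop where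
  grad : ∀ t y, HasGradientAt (k t) (F t y) y
  cont : Continuous (Function.uncurry k)
  smooth : ContDiff ℝ 1 (Function.uncurry F)
  bdd : ∀ t y, ‖F t y‖ ≤ C
  dbdd : ∀ p, ‖fderiv ℝ (Function.uncurry F) p‖ ≤ C

variable {k k' : ℝ → V → ℝ} {F F' : ℝ → V → V} {C C' : ℝ}

theorem NiceGrad.nonneg (h : NiceGrad k F C) : 0 ≤ C := (norm_nonneg _).trans (h.bdd 0 0)

theorem NiceGrad.smul_add (h : NiceGrad k F C) (h' : NiceGrad k' F' C') {s : ℝ} (hs : s ∈ Icc (0:ℝ) 1) :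
    NiceGrad (fun t y => s * k t y + k' t y) (fun t y => s • F t y + F' t y) (C + C') where
  grad t y := by
    have h1 := (h.grad t y).hasFDerivAt.const_mul s
    have h2 := h1.add (h'.grad t y).hasFDerivAt
    rw [hasGradientAt_iff_hasFDerivAt]
    refine h2.congr_fderiv ?_
    ext v
    simp [inner_add_left, real_inner_smul_left]
  cont := (h.cont.const_mul s).add h'.cont
  smooth := (h.smooth.const_smul s).add h'.smooth
  bdd t y := by
    refine (norm_add_le _ _).trans (add_le_add ?_ (h'.bdd t y))
    rw [norm_smul, Real.norm_of_nonneg hs.1]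
    exact (mul_le_of_le_one_left (norm_nonneg _) hs.2).trans (h.bdd t y)
  dbdd p := by
    have d1 : HasFDerivAt (Function.uncurry F) _ p := ((h.smooth.differentiable one_ne_zero) p).hasFDerivAt
    have d2 : HasFDerivAt (Function.uncurry F') _ p := ((h'.smooth.differentiable one_ne_zero) p).hasFDerivAt
    have e := ((d1.const_smul s).add d2).fderiv
    have e' : Function.uncurry (fun t y => s • F t y + F' t y) = s • Function.uncurry F + Function.uncurry F' := by
      ext ⟨t, y⟩; rfl
    rw [e', e]
    refine (ContinuousLinearMap.opNorm_add_le _ _).trans (add_le_add ?_ (h'.dbdd p))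
    refine (ContinuousLinearMap.opNorm_smul_le _ _).trans ?_
    rw [Real.norm_of_nonneg hs.1]
    exact (mul_le_of_le_one_left (norm_nonneg _) hs.2).trans (h.dbdd p)

theorem NiceGrad.lipschitz (h : NiceGrad k F C) (t : ℝ) (y z : V) : ‖F t y - F t z‖ ≤ C * ‖y - z‖ := by
  have := Convex.norm_image_sub_le_of_norm_fderiv_le (f := Function.uncurry F) (s := univ) (C := C)
    (𝕜 := ℝ) (fun p _ => (h.smooth.differentiable one_ne_zero) p) (fun p _ => h.dbdd p) convex_univ
    (mem_univ (t, z)) (mem_univ (t, y))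
  simpa [Function.uncurry] using this

theorem NiceGrad.hasDerivAt_line (h : NiceGrad k F C) (t : ℝ) (y v : V) (s : ℝ) :
    HasDerivAt (fun s : ℝ => k t (y + s • v)) (inner ℝ (F t (y + s • v)) v) s := by
  have h1 : HasDerivAt (fun s : ℝ => y + s • v) v s := by
    simpa using ((hasDerivAt_id s).smul_const v).const_add y
  exact ((h.grad t (y + s • v)).hasFDerivAt.comp_hasDerivAt s h1).congr_deriv (by simp)

theorem NiceGrad.le_taylor (h : NiceGrad k F C) (t : ℝ) (y v : V) :
    k t (y + v) ≤ k t y + inner ℝ (F t y) v + C * ‖v‖ ^ 2 := by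
  obtain ⟨s, hs, e⟩ := exists_hasDerivAt_eq_slope (fun s : ℝ => k t (y + s • v))
    (fun s => inner ℝ (F t (y + s • v)) v) (zero_lt_one' ℝ)
    (fun s _ => (h.hasDerivAt_line t y v s).continuousAt.continuousWithinAt)
    fun s _ => h.hasDerivAt_line t y v s
  simp only [one_smul, zero_smul, add_zero, sub_zero, div_one] at e
  have h1 : inner ℝ (F t (y + s • v)) v - inner ℝ (F t y) v ≤ C * ‖v‖ ^ 2 := by
    rw [← inner_sub_left]
    refine (real_inner_le_norm _ _).trans ?_
    have := h.lipschitz t (y + s • v) y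
    rw [add_sub_cancel_left, norm_smul, Real.norm_of_nonneg hs.1.le] at this
    have hC := h.nonneg
    have h2 : ‖F t (y + s • v) - F t y‖ ≤ C * ‖v‖ :=
      this.trans (mul_le_mul_of_nonneg_left (mul_le_of_le_one_left (norm_nonneg _) hs.2.le) hC)
    nlinarith [norm_nonneg v]
  linarith

theorem NiceGrad.le_lipschitz (h : NiceGrad k F C) (t : ℝ) (y v : V) :
    k t (y + v) ≤ k t y + C * ‖v‖ := by
  obtain ⟨s, hs, e⟩ := exists_hasDerivAt_eq_slope (fun s : ℝ => k t (y + s • v))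
    (fun s => inner ℝ (F t (y + s • v)) v) (zero_lt_one' ℝ)
    (fun s _ => (h.hasDerivAt_line t y v s).continuousAt.continuousWithinAt)
    fun s _ => h.hasDerivAt_line t y v s
  simp only [one_smul, zero_smul, add_zero, sub_zero, div_one] at e
  have h1 := (real_inner_le_norm (F t (y + s • v)) v).trans
    (mul_le_mul_of_nonneg_right (h.bdd t (y + s • v)) (norm_nonneg v))
  linarith

theorem NiceGrad.path (h : NiceGrad k F C) {p p' : ℝ → V} (hp : ∀ t, HasDerivAt p (p' t) t)
    (hp' : Continuous p') :
    ∃ f', (∀ t, HasDerivAt (fun t => F t (p t)) (f' t) t) ∧ Continuous f' ∧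
      ∀ t, ‖f' t‖ ≤ C * (1 + ‖p' t‖) := by
  have hpc : Continuous p := continuous_iff_continuousAt.2 fun t => (hp t).continuousAt
  refine ⟨fun t => fderiv ℝ (Function.uncurry F) (t, p t) (1, p' t), fun t => ?_, ?_, fun t => ?_⟩
  · have h1 : HasDerivAt (fun t => (t, p t)) ((1:ℝ), p' t) t := (hasDerivAt_id t).prodMk (hp t)
    exact ((h.smooth.differentiable one_ne_zero) (t, p t)).hasFDerivAt.comp_hasDerivAt t h1
  · have h2 := h.smooth.continuous_fderiv one_ne_zero
    exact (h2.comp (continuous_id.prodMk hpc)).clm_apply (continuous_const.prodMk hp')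
  · refine (ContinuousLinearMap.le_opNorm _ _).trans ?_
    refine mul_le_mul (h.dbdd _) ?_ (norm_nonneg _) h.nonneg
    rw [Prod.norm_def]
    simp only [norm_one]
    exact max_le (by linarith [norm_nonneg (p' t)]) (by linarith)

/-- A compactly supported continuous function is bounded. -/
theorem exists_bound_of_compact {X E : Type} [TopologicalSpace X] [NormedAddCommGroup E] {u : X → E}
    (hu : Continuous u) (hs : HasCompactSupport u) : ∃ C, 0 ≤ C ∧ ∀ x, ‖u x‖ ≤ C := by
  obtain ⟨C, hC⟩ := hs.exists_bound_of_continuous hu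
  exact ⟨max C 0, le_max_right _ _, fun x => (hC x).trans (le_max_left _ _)⟩

theorem exists_bounds_of_compact {E E' : Type} [NormedAddCommGroup E] [NormedSpace ℝ E]
    [NormedAddCommGroup E'] [NormedSpace ℝ E'] {u : E → E'} (hu : ContDiff ℝ 1 u)
    (hs : HasCompactSupport u) : ∃ C, 0 ≤ C ∧ (∀ x, ‖u x‖ ≤ C) ∧ ∀ x, ‖fderiv ℝ u x‖ ≤ C := by
  obtain ⟨C, h0, hC⟩ := exists_bound_of_compact hu.continuous hs
  obtain ⟨C', h0', hC'⟩ := exists_bound_of_compact (hu.continuous_fderiv one_ne_zero) (hs.fderiv (𝕜 := ℝ))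
  exact ⟨max C C', le_max_of_le_left h0, fun x => (hC x).trans (le_max_left _ _),
    fun x => (hC' x).trans (le_max_right _ _)⟩

theorem hasFDerivAt_slice {E : Type} [NormedAddCommGroup E] [NormedSpace ℝ E] {k : ℝ → V → E}
    {t : ℝ} {y : V} (h : DifferentiableAt ℝ (Function.uncurry k) (t, y)) :
    HasFDerivAt (k t) ((fderiv ℝ (Function.uncurry k) (t, y)).comp (ContinuousLinearMap.inr ℝ ℝ V)) y :=
  HasFDerivAt.comp (g := Function.uncurry k) (f := fun y => (t, y)) y h.hasFDerivAt
    (hasFDerivAt_prodMk_right t y)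

theorem niceGrad_of_compact [FiniteDimensional ℝ V] (hk : ContDiff ℝ (⊤ : ℕ∞) (Function.uncurry k))
    (hs : HasCompactSupport (Function.uncurry k)) : ∃ C, NiceGrad k (fun t => gradient (k t)) C := by
  have hgr : ∀ t y, HasGradientAt (k t) (gradient (k t) y) y := fun t y =>
    (hasFDerivAt_slice ((hk.differentiable (by simp)) (t, y))).differentiableAt.hasGradientAt
  let e := stdOrthonormalBasis ℝ V
  have hF : Function.uncurry (fun t => gradient (k t))
      = fun p : ℝ × V => ∑ i, fderiv ℝ (Function.uncurry k) p (0, e i) • e i := by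
    ext ⟨t, y⟩
    simp only [Function.uncurry]
    rw [← e.sum_repr (gradient (k t) y)]
    refine Finset.sum_congr rfl fun i _ => ?_
    rw [e.repr_apply_apply, real_inner_comm]
    congr 1
    have := (hgr t y).hasFDerivAt.unique (hasFDerivAt_slice ((hk.differentiable (by simp)) (t, y)))
    have := congrArg (fun L => L (e i)) this
    simpa using this
  have hd : ContDiff ℝ 1 (fderiv ℝ (Function.uncurry k)) := hk.fderiv_right (by norm_cast)
  have hsm : ContDiff ℝ 1 (Function.uncurry (fun t => gradient (k t))) := by
    rw [hF]
    exact ContDiff.sum fun i _ => (hd.clm_apply contDiff_const).smul contDiff_const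
  have hcs : HasCompactSupport (Function.uncurry (fun t => gradient (k t))) := by
    refine (hs.fderiv (𝕜 := ℝ)).mono ?_
    intro p hp
    rw [hF] at hp
    rw [Function.mem_support] at hp ⊢
    contrapose! hp
    simp [hp]
  obtain ⟨C, -, h1, h2⟩ := exists_bounds_of_compact hsm hcs
  exact ⟨C, hgr, hk.continuous, hsm, fun t y => h1 (t, y), h2⟩

end Nice

section Grad
variable {ι β : Type} [Fintype ι] [Fintype β] [DecidableEq ι] [DecidableEq β]

theorem abs_blockInner_le {Λ : Type} [Fintype Λ] (blk : Λ → Option ι) (i : ι) (x y : EuclideanSpace ℝ Λ) :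
    |blockInner blk i x y| ≤ (blockInner blk i x x + blockInner blk i y y) / 2 := by
  have h : ∀ c : ℝ, 0 ≤ blockInner blk i x x + 2 * c * blockInner blk i x y + c ^ 2 * blockInner blk i y y := by
    intro c
    have := blockInner_self_nonneg (blk := blk) i (x + c • y)
    simp only [blockInner_add_left, blockInner_add_right, blockInner_smul_left, blockInner_smul_right] at this
    rw [blockInner_comm i y x] at this
    linarith
  rw [abs_le]
  constructor <;> linarith [h 1, h (-1)]

theorem norm_sq_block_mul {Λ : Type} [Fintype Λ] (blk : Λ → Option ι) (r : ι → ℝ) (x : EuclideanSpace ℝ Λ) :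
    ‖(WithLp.toLp 2 fun α => (blk α).elim 0 r * x α : EuclideanSpace ℝ Λ)‖ ^ 2
      = ∑ i, r i ^ 2 * blockInner blk i x x := by
  rw [EuclideanSpace.real_norm_sq_eq]
  simp only [blockInner, Finset.mul_sum]
  rw [Finset.sum_comm]
  refine Finset.sum_congr rfl fun α _ => ?_
  rcases h : blk α with _ | i
  · simp
  · simp; ring

theorem norm_sq_add_three_le {E : Type} [SeminormedAddCommGroup E] (a b c : E) :
    ‖a - b + c‖ ^ 2 ≤ 3 * (‖a‖ ^ 2 + ‖b‖ ^ 2 + ‖c‖ ^ 2) := by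
  have h : ‖a - b + c‖ ≤ ‖a‖ + ‖b‖ + ‖c‖ := (norm_add_le _ _).trans (by gcongr; exact norm_sub_le _ _)
  have := pow_le_pow_left₀ (norm_nonneg _) h 2
  nlinarith [sq_nonneg (‖a‖ - ‖b‖), sq_nonneg (‖a‖ - ‖c‖), sq_nonneg (‖b‖ - ‖c‖)]

theorem norm_sq_add_le_two {E : Type} [SeminormedAddCommGroup E] (a b : E) :
    ‖a + b‖ ^ 2 ≤ 2 * ‖a‖ ^ 2 + 2 * ‖b‖ ^ 2 := by
  have := pow_le_pow_left₀ (norm_nonneg _) (norm_add_le a b) 2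
  nlinarith [sq_nonneg (‖a‖ - ‖b‖)]

theorem norm_I_smul (y : VS ι β) : ‖Complex.I • y‖ = ‖y‖ := by rw [norm_smul]; simp

/-- A priori bound of the velocity in terms of the action. -/
theorem norm_sq_diagMul_le {Λ : Type} [Fintype Λ] {blk : Λ → Option ι} {ω : Λ → ℝ} {R M μ C₁ : ℝ} (hR : 0 < R)
    {f x : EuclideanSpace ℝ Λ} (hf : ‖f‖ ≤ M)
    (hx : ∀ i : ι, R ≤ blockInner blk i x x ∧ blockInner blk i x x ≤ R + 1)
    (hA : blockAction blk ω x ≤ C₁)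
    (hT : ‖tangential blk R (f + diagMul ω x) x‖ ≤ μ) :
    ‖diagMul ω x‖ ^ 2 ≤ 3 * (μ ^ 2 + M ^ 2 +
      Fintype.card ι * ((((M ^ 2 + R + 1) / 2 + 2 * C₁) / R) ^ 2 * (R + 1))) := by
  set r := multiplier blk R (f + diagMul ω x) x with hr
  have hM2 : ‖f‖ ^ 2 ≤ M ^ 2 := pow_le_pow_left₀ (norm_nonneg _) hf 2
  have hri : ∀ i, |r i| ≤ ((M ^ 2 + R + 1) / 2 + 2 * C₁) / R := by
    intro i
    rw [hr, multiplier, max_eq_left (hx i).1, abs_div, abs_of_pos (hR.trans_le (hx i).1)]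
    have h1 : |blockInner blk i (f + diagMul ω x) x| ≤ (M ^ 2 + R + 1) / 2 + 2 * C₁ := by
      rw [blockInner_add_left]
      refine (abs_add_le _ _).trans (add_le_add ?_ ?_)
      · refine (abs_blockInner_le blk i f x).trans ?_
        linarith [(hx i).2, blockInner_self_le (blk := blk) i f]
      · have h2 : |blockInner blk i (diagMul ω x) x / 2| ≤ C₁ := le_trans
          (Finset.single_le_sum (f := fun i => |blockInner blk i (diagMul ω x) x / 2|)
            (fun i _ => abs_nonneg _) (Finset.mem_univ i)) hA
        rw [abs_div, abs_two] at h2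
        linarith
    exact div_le_div₀ ((abs_nonneg _).trans h1) h1 hR (hx i).1
  have hdec : diagMul ω x = tangential blk R (f + diagMul ω x) x - f
      + WithLp.toLp 2 fun α => (blk α).elim 0 r * x α := by
    ext α
    simp only [tangential, PiLp.add_apply, PiLp.sub_apply, ← hr]
    ring
  conv_lhs => rw [hdec]
  refine (norm_sq_add_three_le _ _ _).trans ?_
  rw [norm_sq_block_mul]
  have h3 : ∑ i, r i ^ 2 * blockInner blk i x x ≤
      Fintype.card ι * ((((M ^ 2 + R + 1) / 2 + 2 * C₁) / R) ^ 2 * (R + 1)) := by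
    rw [← nsmul_eq_mul, ← Finset.card_univ]
    refine Finset.sum_le_card_nsmul _ _ _ fun i _ => ?_
    refine mul_le_mul ?_ (hx i).2 (blockInner_self_nonneg _ _) (sq_nonneg _)
    rw [← sq_abs]
    exact pow_le_pow_left₀ (abs_nonneg _) (hri i) 2
  have h4 := pow_le_pow_left₀ (norm_nonneg _) hT 2
  linarith

variable {k : ℝ → ℝ → VS ι β → ℝ} {F : ℝ → ℝ → VS ι β → VS ι β} {C R δ ρ cw MG : ℝ} {G : ℝ → VS ι β → ℝ}

theorem norm_pcoef_le_of_bdd {N : ℕ} {f : ℝ → VS ι β} (hf : Continuous f) (hC : 0 ≤ C) (hb : ∀ t, ‖f t‖ ≤ C) :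
    ‖pcoef N f‖ ≤ C := by
  refine le_of_sq_le_sq ?_ hC
  refine (norm_pcoef_sq_le hf).trans ?_
  have := intervalIntegral.integral_mono_on (μ := volume) (a := 0) (b := 1) zero_le_one
    (Continuous.intervalIntegrable (u := fun t => ‖f t‖ ^ 2) (by fun_prop) _ _)
    ((continuous_const (y := C ^ 2)).intervalIntegrable _ _)
    fun t _ => pow_le_pow_left₀ (norm_nonneg _) (hb t) 2
  simpa using this

theorem exists_tangential_bound (hR : 0 < R) (hδ : 0 < δ) (hδ1 : δ < 1) (hρ : 0 < ρ) (hMG : 0 ≤ MG)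
    (hk : ∀ s ∈ Icc (0:ℝ) 1, NiceGrad (k s) (F s) C)
    (hF0 : ∀ s y, F s 0 y = 0) (hF1 : ∀ s y, F s 1 y = 0)
    (hforth : ∀ s t y i, inner ℝ (F s t y) (lamV (Pi.single i 1) y) = 0)
    (hFl : ∀ s, ∀ t ∈ Icc 0 (1 - δ), ∀ y a, F s t y (.inl a) = 0)
    (hFr : ∀ s, ∀ t ∈ Icc 0 (1 - δ), ∀ y, ∃ q : ℝ, ∀ l, F s t y (.inr l) = q • y (.inr l))
    (hG : ContDiff ℝ 1 (Function.uncurry G))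
    (hGb : ∀ t ∈ Icc (1 - δ) 1, ∀ y v, |fderiv ℝ (Function.uncurry G) (t, y) (0, v)| ≤ MG * ‖v‖)
    (hGr : ∀ t ∈ Icc (1 - δ) 1, ∀ y r, fderiv ℝ (Function.uncurry G) (t, y) (0, lamV r y) = 0)
    (hGt : ∀ s, ∀ t ∈ Icc (1 - δ) 1, ∀ y, (∀ i, |znorm i y - R| ≤ ρ) →
      fderiv ℝ (Function.uncurry G) (t, y) (1, -(Complex.I • F s t y)) = 0)
    (hG0 : ∀ y, (∀ a, |‖y (.inl a)‖ ^ 2 - R / 2| ≤ ρ) → wnorm y ≤ cw + ρ → G (1 - δ) y = 1)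
    (hG1 : ∀ y, (∀ a, |‖y (.inl a)‖ ^ 2 - R / 2| ≤ ρ) → wnorm y ≤ cw + ρ → G 1 y = 0) :
    ∃ μ > 0, ∃ δ₀ > 0, ∀ C₁, ∃ N : ℕ, ∀ s ∈ Icc (0:ℝ) 1, ∀ x : EuclideanSpace ℝ (Lam ι β N),
      (∀ i, R ≤ blockInner lblk i x x ∧ blockInner lblk i x x ≤ R + δ₀) → blockAction lblk lfreq x ≤ C₁ →
      (∃ t₀ ∈ Icc (0:ℝ) (1 - δ), wnorm (apath x t₀) ≤ cw) →
      μ ≤ ‖tangential lblk R (pcoef N (fun t => F s t (apath x t)) + diagMul lfreq x) x‖ := by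
  have hC : 0 ≤ C := (hk 0 ⟨le_rfl, zero_le_one⟩).nonneg
  obtain ⟨ν, hν, hν1, hν2, hν3, hν4⟩ : ∃ ν > 0, ν ≤ 1 / 2 ∧ 8 * (1 + R + 1) * ν ≤ ρ / 2 ∧
      2 * (1 + |cw|) * ν ≤ ρ ∧ MG * ν < 1 := by
    refine ⟨min (1 / 2) (min (ρ / (16 * (1 + R + 1))) (min (ρ / (2 * (1 + |cw|))) (1 / (2 * (MG + 1))))),
      by positivity, min_le_left _ _, ?_, ?_, ?_⟩
    · have : min (1 / 2) (min (ρ / (16 * (1 + R + 1))) (min (ρ / (2 * (1 + |cw|))) (1 / (2 * (MG + 1))))) ≤ ρ / (16 * (1 + R + 1)) :=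
        (min_le_right _ _).trans (min_le_left _ _)
      rw [le_div_iff₀ (by positivity)] at this
      linarith
    · have : min (1 / 2) (min (ρ / (16 * (1 + R + 1))) (min (ρ / (2 * (1 + |cw|))) (1 / (2 * (MG + 1))))) ≤ ρ / (2 * (1 + |cw|)) :=
        (min_le_right _ _).trans ((min_le_right _ _).trans (min_le_left _ _))
      rw [le_div_iff₀ (by positivity)] at this
      linarith
    · have : min (1 / 2) (min (ρ / (16 * (1 + R + 1))) (min (ρ / (2 * (1 + |cw|))) (1 / (2 * (MG + 1))))) ≤ 1 / (2 * (MG + 1)) :=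
        (min_le_right _ _).trans ((min_le_right _ _).trans (min_le_right _ _))
      have h2 := mul_le_mul_of_nonneg_left this hMG
      refine h2.trans_lt ?_
      rw [mul_one_div, div_lt_one (by positivity)]
      linarith
  refine ⟨ν / 2, by positivity, min (ρ / 2) 1, by positivity, fun C₁ => ?_⟩
  set C₂ := 3 * ((ν / 2) ^ 2 + C ^ 2 +
      Fintype.card ι * ((((C ^ 2 + R + 1) / 2 + 2 * C₁) / R) ^ 2 * (R + 1))) with hC₂
  have hC₂0 : 0 ≤ C₂ := by positivity
  obtain ⟨N, hN⟩ := exists_nat_ge (2 * C ^ 2 * (1 + C₂) / (ν / 2) ^ 2)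
  refine ⟨N, fun s hs x hx hA ⟨t₀, ht₀, hw⟩ => ?_⟩
  by_contra! hT
  have hkn := hk s hs
  set p := apath x with hp
  set f := fun t => F s t (p t) with hf
  have hpd := hasDerivAt_apath x
  have hpc' : Continuous fun t => Complex.I • apath (diagMul lfreq x) t := by fun_prop
  obtain ⟨f', hff', hf'c, hf'b⟩ := hkn.path hpd hpc'
  have hfc : Continuous f := continuous_iff_continuousAt.2 fun t => (hff' t).continuousAt
  have hx1 : ∀ i, R ≤ blockInner lblk i x x ∧ blockInner lblk i x x ≤ R + 1 := fun i =>
    ⟨(hx i).1, (hx i).2.trans (by gcongr; exact min_le_right _ _)⟩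
  have hΩ := norm_sq_diagMul_le hR (norm_pcoef_le_of_bdd (N := N) hfc hC fun t => hkn.bdd t _) hx1 hA hT.le
  rw [← hC₂] at hΩ
  set T := tangential lblk R (pcoef N f + diagMul lfreq x) x with hTdef
  set r := multiplier lblk R (pcoef N f + diagMul lfreq x) x with hr
  set e := fun t => Complex.I • (apath T t + (f t - apath (pcoef N f) t)) with he
  have hec : Continuous e := by fun_prop
  have hpe : ∀ t, HasDerivAt p (-(Complex.I • f t) + lamV r (p t) + e t) t := by
    intro t
    refine (hpd t).congr_deriv ?_
    have hdec : diagMul lfreq x = T - pcoef N f + WithLp.toLp 2 fun α => (lblk α).elim 0 r * x α := by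
      ext α
      simp only [hTdef, tangential, PiLp.add_apply, PiLp.sub_apply, ← hr]
      ring
    rw [hdec, apath_add, apath_sub, smul_add, apath_mul_block, he]
    simp only [smul_add, smul_sub]
    abel
  have htail : ∫ t in (0:ℝ)..1, ‖f t - apath (pcoef N f) t‖ ^ 2 ≤ (ν / 2) ^ 2 := by
    refine (integral_norm_sub_apath_pcoef_le hff' hf'c (hF0 s _) (hF1 s _)).trans ?_
    have h1 : ∫ t in (0:ℝ)..1, ‖f' t‖ ^ 2 ≤ 2 * C ^ 2 * (1 + C₂) := by
      have h2 := intervalIntegral.integral_mono_on (μ := volume) (a := 0) (b := 1)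
        (f := fun t => ‖f' t‖ ^ 2) (g := fun t => 2 * C ^ 2 * (1 + ‖apath (diagMul lfreq x) t‖ ^ 2)) zero_le_one
        (Continuous.intervalIntegrable (by fun_prop) _ _) (Continuous.intervalIntegrable (by fun_prop) _ _)
        (fun t _ => by
          have h3 := pow_le_pow_left₀ (norm_nonneg _) (hf'b t) 2
          rw [norm_I_smul] at h3
          refine h3.trans ?_
          have := mul_nonneg (sq_nonneg C) (sq_nonneg (1 - ‖apath (diagMul lfreq x) t‖))
          nlinarith)
      refine h2.trans ?_
      rw [intervalIntegral.integral_const_mul, intervalIntegral.integral_add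
        (continuous_const.intervalIntegrable _ _) (Continuous.intervalIntegrable (by fun_prop) _ _),
        integral_norm_sq_apath]
      simp only [intervalIntegral.integral_const, sub_zero, smul_eq_mul, mul_one]
      gcongr
    have h4 : 2 * C ^ 2 * (1 + C₂) ≤ (ν / 2) ^ 2 * (N + 1) ^ 2 := by
      rw [div_le_iff₀ (by positivity)] at hN
      have : (N:ℝ) ≤ (N + 1) ^ 2 := by nlinarith [Nat.cast_nonneg (α := ℝ) N]
      calc _ ≤ _ := hN
        _ ≤ _ := by rw [mul_comm]; gcongr
    rw [inv_mul_le_iff₀ (by positivity), mul_comm]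
    exact h1.trans h4
  have heν : ∫ t in (0:ℝ)..1, ‖e t‖ ≤ ν := by
    refine integral_norm_le_of_sq hec hν.le ?_
    have h2 := intervalIntegral.integral_mono_on (μ := volume) (a := 0) (b := 1)
        (f := fun t => ‖e t‖ ^ 2) (g := fun t => 2 * ‖apath T t‖ ^ 2 + 2 * ‖f t - apath (pcoef N f) t‖ ^ 2) zero_le_one
        (Continuous.intervalIntegrable (by fun_prop) _ _) (Continuous.intervalIntegrable (by fun_prop) _ _)
        (fun t _ => by
          simp only [he, norm_I_smul]
          exact norm_sq_add_le_two _ _)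
    refine h2.trans ?_
    rw [intervalIntegral.integral_add (Continuous.intervalIntegrable (by fun_prop) _ _)
      (Continuous.intervalIntegrable (by fun_prop) _ _), intervalIntegral.integral_const_mul,
      intervalIntegral.integral_const_mul, integral_norm_sq_apath]
    have := pow_le_pow_left₀ (norm_nonneg _) hT.le 2
    linarith
  have hb : ∀ n : ℤ, ∀ i, ‖p n (.inl (i, true))‖ = ‖p n (.inl (i, false))‖ := by
    intro n i
    rw [hp, apath_boundary]
    simp
  obtain ⟨hz, hz0, hz1, hw0, hw1⟩ := path_rigidity (δ := δ) (δ₀ := min (ρ / 2) 1) (ρ := ρ) (by positivity) hR.le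
    hpe hec heν hν1 hδ.le hδ1.le
    (fun i t _ => hforth s t _ i) (fun t ht a => hFl s t ht _ a) (fun t ht => hFr s t ht _)
    (by simpa using hb 0) (by simpa using hb 1)
    (by rw [wnorm, wnorm]; simp only [hp, apath_one_inr])
    (fun i => by rw [hp, integral_znorm_apath]; exact (hx i).1)
    (fun i => by rw [hp, integral_znorm_apath]; exact (hx i).2)
    ht₀ hw
    (by
      have h1 : min (ρ / 2) 1 ≤ ρ / 2 := min_le_left _ _
      have h2 : min (ρ / 2) 1 ≤ 1 := min_le_right _ _
      have h3 : 8 * (1 + R + min (ρ / 2) 1) * ν ≤ 8 * (1 + R + 1) * ν := by gcongr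
      linarith)
    (by
      refine le_trans ?_ hν3
      gcongr
      exact le_abs_self _)
  have hg : ∀ t ∈ Icc (1 - δ) 1, HasDerivAt (fun t => G t (p t)) (fderiv ℝ (Function.uncurry G) (t, p t) (0, e t)) t := by
    intro t ht
    have h1 : HasDerivAt (fun t => (t, p t)) ((1:ℝ), -(Complex.I • f t) + lamV r (p t) + e t) t :=
      (hasDerivAt_id t).prodMk (hpe t)
    have h2 := ((hG.differentiable one_ne_zero) (t, p t)).hasFDerivAt.comp_hasDerivAt t h1
    refine HasDerivAt.congr_deriv (f := fun t => G t (p t)) h2 ?_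
    have h3 : ((1:ℝ), -(Complex.I • f t) + lamV r (p t) + e t)
        = ((1:ℝ), -(Complex.I • f t)) + ((0:ℝ), lamV r (p t)) + ((0:ℝ), e t) := by simp
    rw [h3, map_add, map_add, hGr t ht, hGt s t ht _ (hz t ⟨by linarith [ht.1], ht.2⟩)]
    simp
  have hfin : ‖G 1 (p 1) - G (1 - δ) (p (1 - δ))‖ ≤ MG * ∫ u in (1 - δ)..1, ‖e u‖ := by
    refine image_norm_le_of_norm_deriv_right_le_deriv_boundary
      (f := fun t => G t (p t) - G (1 - δ) (p (1 - δ)))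
      (f' := fun t => fderiv ℝ (Function.uncurry G) (t, p t) (0, e t))
      (B := fun t => MG * ∫ u in (1 - δ)..t, ‖e u‖) (B' := fun t => MG * ‖e t‖)
      (a := 1 - δ) (b := 1) ?_ ?_ ?_ ?_ ?_ ⟨by linarith, le_rfl⟩
    · exact fun t ht => (((hg t ht).sub_const _).continuousAt).continuousWithinAt
    · exact fun t ht => ((hg t ⟨ht.1, ht.2.le⟩).sub_const _).hasDerivWithinAt
    · simp
    · exact fun t => (intervalIntegral.integral_hasDerivAt_right (hec.norm.intervalIntegrable _ _)
        (hec.norm.stronglyMeasurableAtFilter _ _) hec.norm.continuousAt).const_mul _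
    · exact fun t ht => hGb t ⟨ht.1, ht.2.le⟩ _ _
  have hle : ∫ u in (1 - δ)..1, ‖e u‖ ≤ ν := (intervalIntegral.integral_mono_interval (by linarith)
    (by linarith) le_rfl (Eventually.of_forall fun _ => norm_nonneg _) (hec.norm.intervalIntegrable _ _)).trans heν
  rw [hG0 _ hz0 hw0, hG1 _ hz1 hw1] at hfin
  have := mul_le_mul_of_nonneg_left hle hMG
  norm_num at hfin
  linarith

end Grad

section Pullback
variable {V W : Type} [NormedAddCommGroup V] [InnerProductSpace ℝ V] [CompleteSpace V]
  [NormedAddCommGroup W] [InnerProductSpace ℝ W] [CompleteSpace W]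

theorem NiceGrad.comp {k : ℝ → W → ℝ} {F : ℝ → W → W} {C : ℝ} (h : NiceGrad k F C) {P : V →L[ℝ] W} {J : W →L[ℝ] V}
    (hPJ : ∀ u v, inner ℝ (J u) v = inner ℝ u (P v)) (hP : ‖P‖ ≤ 1) (hJ : ‖J‖ ≤ 1) :
    NiceGrad (fun t y => k t (P y)) (fun t y => J (F t (P y))) C where
  grad t y := by
    rw [hasGradientAt_iff_hasFDerivAt]
    refine ((h.grad t (P y)).hasFDerivAt.comp y P.hasFDerivAt).congr_fderiv ?_
    ext v
    simp [hPJ]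
  cont := h.cont.comp (continuous_fst.prodMk (P.continuous.comp continuous_snd))
  smooth := J.contDiff.comp (h.smooth.comp (contDiff_fst.prodMk (P.contDiff.comp contDiff_snd)))
  bdd t y := (J.le_of_opNorm_le hJ _).trans (by rw [one_mul]; exact h.bdd t _)
  dbdd p := by
    have h1 : HasFDerivAt (fun p : ℝ × V => (p.1, P p.2)) ((ContinuousLinearMap.id ℝ ℝ).prodMap P) p :=
      ((ContinuousLinearMap.id ℝ ℝ).prodMap P).hasFDerivAt
    have h2 := J.hasFDerivAt.comp p (((h.smooth.differentiable one_ne_zero) (p.1, P p.2)).hasFDerivAt.comp p h1)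
    have h3 : Function.uncurry (fun t y => J (F t (P y))) = J ∘ Function.uncurry F ∘ fun p : ℝ × V => (p.1, P p.2) := rfl
    rw [h3, h2.fderiv]
    refine ContinuousLinearMap.opNorm_le_bound _ h.nonneg fun v => ?_
    simp only [ContinuousLinearMap.comp_apply]
    refine (J.le_of_opNorm_le hJ _).trans ?_
    rw [one_mul]
    refine ((fderiv ℝ (Function.uncurry F) (p.1, P p.2)).le_of_opNorm_le (h.dbdd _) _).trans ?_
    refine mul_le_mul_of_nonneg_left ?_ h.nonneg
    rw [Prod.norm_def, Prod.norm_def]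
    refine max_le_max le_rfl ?_
    exact (P.le_of_opNorm_le hP v.2).trans (by rw [one_mul])

theorem NiceGrad.map_eq {k : ℝ → V → ℝ} {F : ℝ → V → V} {C : ℝ} (h : NiceGrad k F C) {Q : V →L[ℝ] V}
    (hQ : ∀ u v, inner ℝ (Q u) v = inner ℝ u (Q v)) (hQ2 : ∀ y, Q (Q y) = y)
    (hk : ∀ t y, k t (Q y) = k t y) (t : ℝ) (y : V) : F t (Q y) = Q (F t y) := by
  refine ext_inner_right ℝ fun v => ?_
  have h1 := h.hasDerivAt_line t (Q y) v 0
  have h2 := h.hasDerivAt_line t y (Q v) 0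
  have e : (fun s : ℝ => k t (Q y + s • v)) = fun s : ℝ => k t (y + s • Q v) := by
    ext s
    rw [← hk t (y + s • Q v), map_add, map_smul, hQ2]
  rw [e] at h1
  have := h1.unique h2
  simp only [zero_smul, add_zero] at this
  rw [this, hQ]

end Pullback

section AB
variable {ι β : Type} [Fintype ι] [Fintype β]

/-- Projection to the unpaired coordinates. -/
def projW : VS ι β →L[ℝ] EuclideanSpace ℂ β :=
  LinearMap.toContinuousLinearMap
    { toFun := fun y => WithLp.toLp 2 fun l => y (.inr l)
      map_add' := fun _ _ => rfl
      map_smul' := fun _ _ => rfl }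

/-- Inclusion of the unpaired coordinates. -/
def inclW : EuclideanSpace ℂ β →L[ℝ] VS ι β :=
  LinearMap.toContinuousLinearMap
    { toFun := fun w => WithLp.toLp 2 (Sum.elim (fun _ => 0) fun l => w l)
      map_add' := fun _ _ => by ext (_ | _) <;> simp
      map_smul' := fun _ _ => by ext (_ | _) <;> simp }

/-- Real diagonal rotation of the pairs as a linear map. -/
def rotL (r : ι → ℝ) : VS ι β →L[ℝ] VS ι β :=
  LinearMap.toContinuousLinearMap
    { toFun := rotV fun i => (r i : ℂ)
      map_add' := fun _ _ => by ext (_ | _) <;> simp [rotV, mul_add]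
      map_smul' := fun _ _ => by ext (_ | _) <;> simp [rotV]; ring }

theorem projW_apply (y : VS ι β) (l : β) : projW y l = y (.inr l) := rfl
theorem inclW_inl (w : EuclideanSpace ℂ β) (a : ι × Bool) : inclW w (.inl a) = 0 := rfl
theorem inclW_inr (w : EuclideanSpace ℂ β) (l : β) : (inclW w : VS ι β) (.inr l) = w l := rfl
theorem rotL_apply (r : ι → ℝ) (y : VS ι β) : rotL r y = rotV (fun i => (r i : ℂ)) y := rfl

theorem norm_projW_sq (y : VS ι β) : ‖projW y‖ ^ 2 = wnorm y := by
  rw [EuclideanSpace.norm_sq_eq]; rfl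

theorem inner_inclW (u : EuclideanSpace ℂ β) (v : VS ι β) : inner ℝ (inclW u) v = inner ℝ u (projW v) := by
  rw [real_inner_VS, Fintype.sum_sum_type, PiLp.inner_apply]
  simp [inclW_inl, inclW_inr, projW_apply]

theorem norm_projW_le : ‖(projW : VS ι β →L[ℝ] _)‖ ≤ 1 := by
  refine ContinuousLinearMap.opNorm_le_bound _ zero_le_one fun y => ?_
  rw [one_mul]
  refine le_of_sq_le_sq ?_ (norm_nonneg _)
  rw [norm_projW_sq, norm_sq_VS]
  linarith [Finset.sum_nonneg fun i (_ : i ∈ Finset.univ) => znorm_nonneg i y]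

theorem norm_inclW_le : ‖(inclW : _ →L[ℝ] VS ι β)‖ ≤ 1 := by
  refine ContinuousLinearMap.opNorm_le_bound _ zero_le_one fun w => ?_
  rw [one_mul]
  refine le_of_sq_le_sq (le_of_eq ?_) (norm_nonneg _)
  rw [norm_sq_VS, EuclideanSpace.norm_sq_eq]
  simp [znorm, wnorm, inclW_inl, inclW_inr]

theorem inner_rotL (r : ι → ℝ) (u v : VS ι β) : inner ℝ (rotL r u) v = inner ℝ u (rotL r v) := by
  rw [real_inner_VS, real_inner_VS]
  refine Finset.sum_congr rfl fun c _ => ?_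
  rcases c with a | l
  · simp only [rotL_apply, rotV, Sum.elim_inl, Complex.inner, map_mul, Complex.conj_ofReal]
    congr 1; ring
  · rfl

theorem rotL_rotL (η : ι → ℤˣ) (y : VS ι β) : rotL (fun i => sgn (η i)) (rotL (fun i => sgn (η i)) y) = y := by
  ext (a | l)
  · simp only [rotL_apply, rotV, Sum.elim_inl, ← mul_assoc, ← Complex.ofReal_mul]
    rw [← sq, sgn_sq]; simp
  · rfl

theorem hasDerivAt_rotV (r : ι → ℝ) (y : VS ι β) :
    HasDerivAt (fun s : ℝ => rotV (fun i => Complex.exp ((s * r i : ℝ) * Complex.I)) y) (lamV r y) 0 := by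
  rw [hasDerivAt_iff_hasFDerivAt, ← hasFDerivWithinAt_univ, hasFDerivWithinAt_piLp]
  rintro (a | l)
  · rw [hasFDerivWithinAt_univ]
    have h0 : HasDerivAt (fun s : ℝ => s * r a.1) (r a.1) 0 := by
      simpa using (hasDerivAt_id (0:ℝ)).mul_const (r a.1)
    have h := ((h0.ofReal_comp.mul_const Complex.I).cexp).mul_const (y (.inl a))
    refine h.hasFDerivAt.congr_fderiv ?_
    ext
    simp [lamV]
  · rw [hasFDerivWithinAt_univ]
    refine (hasFDerivAt_const (y (.inr l)) (0:ℝ)).congr_fderiv ?_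
    ext
    simp [lamV]

theorem rotV_zero_angle (r : ι → ℝ) (y : VS ι β) :
    rotV (fun i => Complex.exp (((0:ℝ) * r i : ℝ) * Complex.I)) y = y := by
  ext (a | l) <;> simp [rotV]

theorem norm_exp_angle (s r : ℝ) : ‖Complex.exp ((s * r : ℝ) * Complex.I)‖ = 1 :=
  Complex.norm_exp_ofReal_mul_I _

theorem NiceGrad.inner_lamV {k : ℝ → VS ι β → ℝ} {F : ℝ → VS ι β → VS ι β} {C : ℝ} (h : NiceGrad k F C)
    (hk : ∀ t y (c : ι → ℂ), (∀ i, ‖c i‖ = 1) → k t (rotV c y) = k t y) (t : ℝ) (y : VS ι β) (r : ι → ℝ) :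
    inner ℝ (F t y) (lamV r y) = 0 := by
  have h1 := (h.grad t (rotV (fun i => Complex.exp (((0:ℝ) * r i : ℝ) * Complex.I)) y)).hasFDerivAt.comp_hasDerivAt
    (0:ℝ) (hasDerivAt_rotV r y)
  have h2 : (k t ∘ fun s : ℝ => rotV (fun i => Complex.exp ((s * r i : ℝ) * Complex.I)) y) = fun _ => k t y := by
    ext s
    exact hk t y _ fun i => norm_exp_angle _ _
  rw [h2] at h1
  have := h1.unique (hasDerivAt_const (0:ℝ) (k t y))
  rw [rotV_zero_angle] at this
  simpa using this

theorem fderiv_lamV {G : ℝ → VS ι β → ℝ} (hG : ContDiff ℝ 1 (Function.uncurry G))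
    (hk : ∀ t y (c : ι → ℂ), (∀ i, ‖c i‖ = 1) → G t (rotV c y) = G t y) (t : ℝ) (y : VS ι β) (r : ι → ℝ) :
    fderiv ℝ (Function.uncurry G) (t, y) (0, lamV r y) = 0 := by
  have h0 : HasDerivAt (fun s : ℝ => (t, rotV (fun i => Complex.exp ((s * r i : ℝ) * Complex.I)) y)) ((0:ℝ), lamV r y) 0 :=
    (hasDerivAt_const _ _).prodMk (hasDerivAt_rotV r y)
  have h1 := ((hG.differentiable one_ne_zero) (t, rotV (fun i => Complex.exp (((0:ℝ) * r i : ℝ) * Complex.I)) y)).hasFDerivAt.comp_hasDerivAt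
    (0:ℝ) h0
  have h2 : (Function.uncurry G ∘ fun s : ℝ => (t, rotV (fun i => Complex.exp ((s * r i : ℝ) * Complex.I)) y)) = fun _ => G t y := by
    ext s
    exact hk t y _ fun i => norm_exp_angle _ _
  rw [h2] at h1
  have := h1.unique (hasDerivAt_const (0:ℝ) (G t y))
  rwa [rotV_zero_angle] at this

variable [DecidableEq ι] [DecidableEq β]

theorem pcoef_rotL {N : ℕ} (η : ι → ℤˣ) (f : ℝ → VS ι β) :
    pcoef N (fun t => rotL (fun i => sgn (η i)) (f t)) = blockFlip lblk η (pcoef N f) := by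
  ext ⟨k, j, b⟩
  rcases k with i | l
  · simp only [pcoef, blockFlip, lblk, coef, Sum.elim_inl, Option.elim_some, ← intervalIntegral.integral_const_mul]
    refine intervalIntegral.integral_congr fun t _ => ?_
    simp only [inner_mode_inl, rotL_apply, rotV, Sum.elim_inl, map_mul, Complex.conj_ofReal]
    rw [mul_left_comm (sgn (η i))]
    congr 1
    rw [← Complex.re_ofReal_mul]
    congr 1; ring
  · simp only [pcoef, blockFlip, lblk, coef, Sum.elim_inr, Option.elim_none, one_mul]
    refine intervalIntegral.integral_congr fun t _ => ?_
    simp only [inner_mode_inr, rotL_apply, rotV, Sum.elim_inr]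

/-- The action functional on truncated Fourier series. -/
def pathAction (k : ℝ → VS ι β → ℝ) {N : ℕ} (x : EuclideanSpace ℝ (Lam ι β N)) : ℝ :=
  (∫ t in (0:ℝ)..1, k t (apath x t)) + inner ℝ (diagMul lfreq x) x / 2

theorem NiceGrad.continuous_comp {k : ℝ → VS ι β → ℝ} {F : ℝ → VS ι β → VS ι β} {C : ℝ} (h : NiceGrad k F C)
    {p : ℝ → VS ι β} (hp : Continuous p) : Continuous (fun t => k t (p t)) ∧ Continuous fun t => F t (p t) :=
  ⟨h.cont.comp (continuous_id.prodMk hp), h.smooth.continuous.comp (continuous_id.prodMk hp)⟩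

theorem pathAction_add_le {k : ℝ → VS ι β → ℝ} {F : ℝ → VS ι β → VS ι β} {C W : ℝ} (h : NiceGrad k F C) {N : ℕ}
    (hW : 0 ≤ W) (hω : ∀ α : Lam ι β N, |lfreq α| ≤ W) (x v : EuclideanSpace ℝ (Lam ι β N)) :
    pathAction k (x + v) ≤ pathAction k x
      + inner ℝ (pcoef N (fun t => F t (apath x t)) + diagMul lfreq x) v + (C + W / 2) * ‖v‖ ^ 2 := by
  obtain ⟨hc1, hc2⟩ := h.continuous_comp (continuous_apath x)
  have hc3 := (h.continuous_comp (continuous_apath (x + v))).1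
  have hc4 : Continuous fun t => inner ℝ (apath v t) (F t (apath x t)) := (continuous_apath v).inner hc2
  have hc5 : Continuous fun t => C * ‖apath v t‖ ^ 2 := by fun_prop
  have h1 := intervalIntegral.integral_mono_on (μ := volume) (a := 0) (b := 1)
    (f := fun t => k t (apath (x + v) t))
    (g := fun t => k t (apath x t) + inner ℝ (apath v t) (F t (apath x t)) + C * ‖apath v t‖ ^ 2) zero_le_one
    (hc3.intervalIntegrable _ _) (((hc1.add hc4).add hc5).intervalIntegrable _ _)
    (fun t _ => by
      have := h.le_taylor t (apath x t) (apath v t)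
      rw [real_inner_comm, ← apath_add] at this
      exact this)
  have hc6 : Continuous fun t => k t (apath x t) + inner ℝ (apath v t) (F t (apath x t)) := hc1.add hc4
  rw [intervalIntegral.integral_add (hc6.intervalIntegrable _ _) (hc5.intervalIntegrable _ _),
    intervalIntegral.integral_add (hc1.intervalIntegrable _ _) (hc4.intervalIntegrable _ _),
    intervalIntegral.integral_const_mul, integral_inner_apath v hc2, integral_norm_sq_apath] at h1
  have h2 : inner ℝ (diagMul lfreq v) v ≤ W * ‖v‖ ^ 2 := by
    refine (real_inner_le_norm _ _).trans ?_
    rw [sq, ← mul_assoc]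
    exact mul_le_mul_of_nonneg_right (norm_diagMul_le hω hW v) (norm_nonneg _)
  have h3 : inner ℝ (diagMul lfreq v) x = inner ℝ (diagMul lfreq x) v := by
    simp only [inner_eq_sum_mul, diagMul]
    exact Finset.sum_congr rfl fun α _ => by ring
  simp only [pathAction, diagMul_add, inner_add_left, inner_add_right, h3]
  rw [real_inner_comm] at h1
  linarith

theorem NiceGrad.continuous_pcoef {k : ℝ → VS ι β → ℝ} {F : ℝ → VS ι β → VS ι β} {C : ℝ} (h : NiceGrad k F C) {N : ℕ} :
    Continuous fun x : EuclideanSpace ℝ (Lam ι β N) => pcoef N fun t => F t (apath x t) := by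
  refine LipschitzWith.continuous (K := ⟨C, h.nonneg⟩) (LipschitzWith.of_dist_le_mul fun x y => ?_)
  rw [dist_eq_norm, dist_eq_norm, ← pcoef_sub (h.continuous_comp (continuous_apath x)).2 (h.continuous_comp (continuous_apath y)).2]
  have hx := (h.continuous_comp (continuous_apath x)).2
  have hy := (h.continuous_comp (continuous_apath y)).2
  refine le_of_sq_le_sq ((norm_pcoef_sq_le (hx.sub hy)).trans ?_) (mul_nonneg h.nonneg (norm_nonneg _))
  have h1 := intervalIntegral.integral_mono_on (μ := volume) (a := 0) (b := 1)
    (f := fun t => ‖F t (apath x t) - F t (apath y t)‖ ^ 2)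
    (g := fun t => C ^ 2 * ‖apath (x - y) t‖ ^ 2) zero_le_one
    (((hx.sub hy).norm.pow 2).intervalIntegrable _ _) (Continuous.intervalIntegrable (by fun_prop) _ _)
    (fun t _ => by
      rw [apath_sub, ← mul_pow]
      exact pow_le_pow_left₀ (norm_nonneg _) (h.lipschitz t _ _) 2)
  rw [intervalIntegral.integral_const_mul, integral_norm_sq_apath, ← mul_pow] at h1
  exact h1

theorem integral_comp_apath_le {k : ℝ → VS ι β → ℝ} {F : ℝ → VS ι β → VS ι β} {C : ℝ} (h : NiceGrad k F C) {N : ℕ}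
    (x v : EuclideanSpace ℝ (Lam ι β N)) :
    ∫ t in (0:ℝ)..1, k t (apath (x + v) t) ≤ (∫ t in (0:ℝ)..1, k t (apath x t)) + C * ‖v‖ := by
  have hc1 := (h.continuous_comp (continuous_apath x)).1
  have hc3 := (h.continuous_comp (continuous_apath (x + v))).1
  have hc4 : Continuous fun t => C * ‖apath v t‖ := by fun_prop
  have h1 := intervalIntegral.integral_mono_on (μ := volume) (a := 0) (b := 1)
    (f := fun t => k t (apath (x + v) t))
    (g := fun t => k t (apath x t) + C * ‖apath v t‖) zero_le_one
    (hc3.intervalIntegrable _ _) ((hc1.add hc4).intervalIntegrable _ _)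
    (fun t _ => by rw [apath_add]; exact h.le_lipschitz t _ _)
  rw [intervalIntegral.integral_add (hc1.intervalIntegrable _ _) (hc4.intervalIntegrable _ _),
    intervalIntegral.integral_const_mul] at h1
  refine h1.trans ?_
  have := integral_norm_le_of_sq (continuous_apath v) (norm_nonneg v) (integral_norm_sq_apath v).le
  have := mul_le_mul_of_nonneg_left this h.nonneg
  linarith

theorem continuous_integral_comp_apath {k : ℝ → VS ι β → ℝ} {F : ℝ → VS ι β → VS ι β} {C : ℝ} (h : NiceGrad k F C) {N : ℕ} :
    Continuous fun x : EuclideanSpace ℝ (Lam ι β N) => ∫ t in (0:ℝ)..1, k t (apath x t) := by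
  refine LipschitzWith.continuous (K := ⟨C, h.nonneg⟩) (LipschitzWith.of_le_add_mul _ fun x y => ?_)
  have := integral_comp_apath_le h y (x - y)
  rw [add_sub_cancel] at this
  rwa [dist_eq_norm]

end AB

section Profile

/-- Smooth time cutoff, supported in `[0, 1 - δ]`. -/
def timeBump (δ t : ℝ) : ℝ := Real.smoothTransition (t / δ) * Real.smoothTransition ((1 - δ - t) / δ)

/-- Smooth radial profile, above `S' - π r`, vanishing for `π r ≥ S''`. -/
def profile (S' S'' r : ℝ) : ℝ := (S'' - Real.pi * r) * Real.smoothTransition ((S'' - Real.pi * r) / (S'' - S'))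

variable {δ S' S'' : ℝ}

theorem contDiff_timeBump : ContDiff ℝ (⊤ : ℕ∞) (timeBump δ) :=
  (Real.smoothTransition.contDiff.comp (contDiff_id.div_const _)).mul
    (Real.smoothTransition.contDiff.comp ((contDiff_const.sub contDiff_id).div_const _))

theorem contDiff_profile : ContDiff ℝ (⊤ : ℕ∞) (profile S' S'') := by
  have h : ContDiff ℝ (⊤ : ℕ∞) fun r : ℝ => S'' - Real.pi * r := contDiff_const.sub (contDiff_const.mul contDiff_id)
  exact h.mul (Real.smoothTransition.contDiff.comp (h.div_const _))

theorem timeBump_nonneg (t : ℝ) : 0 ≤ timeBump δ t :=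
  mul_nonneg (Real.smoothTransition.nonneg _) (Real.smoothTransition.nonneg _)

theorem timeBump_le_one (t : ℝ) : timeBump δ t ≤ 1 :=
  mul_le_one₀ (Real.smoothTransition.le_one _) (Real.smoothTransition.nonneg _) (Real.smoothTransition.le_one _)

theorem timeBump_eq_zero (hδ : 0 < δ) {t : ℝ} (ht : t ≤ 0 ∨ 1 - δ ≤ t) : timeBump δ t = 0 := by
  rcases ht with ht | ht
  · rw [timeBump, Real.smoothTransition.zero_of_nonpos (div_nonpos_of_nonpos_of_nonneg ht hδ.le), zero_mul]
  · rw [timeBump, Real.smoothTransition.zero_of_nonpos (x := (1 - δ - t) / δ)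
      (div_nonpos_of_nonpos_of_nonneg (by linarith) hδ.le), mul_zero]

theorem timeBump_eq_one (hδ : 0 < δ) {t : ℝ} (ht : δ ≤ t) (ht' : t ≤ 1 - 2 * δ) : timeBump δ t = 1 := by
  rw [timeBump, Real.smoothTransition.one_of_one_le, Real.smoothTransition.one_of_one_le, one_mul]
  · rw [le_div_iff₀ hδ]; linarith
  · rw [le_div_iff₀ hδ]; linarith

theorem le_integral_timeBump (hδ : 0 < δ) (hδ3 : 3 * δ ≤ 1) : 1 - 3 * δ ≤ ∫ t in (0:ℝ)..1, timeBump δ t := by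
  have hc := (contDiff_timeBump (δ := δ)).continuous
  have h1 : ∫ t in δ..(1 - 2 * δ), timeBump δ t = 1 - 3 * δ := by
    rw [intervalIntegral.integral_congr (g := fun _ => 1)]
    · simp; ring
    · intro t ht
      rw [uIcc_of_le (by linarith)] at ht
      exact timeBump_eq_one hδ ht.1 ht.2
  rw [← h1]
  exact intervalIntegral.integral_mono_interval hδ.le (by linarith) (by linarith)
    (Eventually.of_forall timeBump_nonneg) (hc.intervalIntegrable _ _)

theorem profile_eq_zero (hS : S' < S'') {r : ℝ} (hr : S'' ≤ Real.pi * r) : profile S' S'' r = 0 := by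
  rw [profile, Real.smoothTransition.zero_of_nonpos (div_nonpos_of_nonpos_of_nonneg (by linarith) (by linarith)), mul_zero]

theorem profile_nonneg (hS : S' < S'') (r : ℝ) : 0 ≤ profile S' S'' r := by
  rcases le_total S'' (Real.pi * r) with h | h
  · rw [profile_eq_zero hS h]
  · exact mul_nonneg (by linarith) (Real.smoothTransition.nonneg _)

theorem profile_le (hS : S' < S'') (hS'' : 0 ≤ S'') {r : ℝ} (hr : 0 ≤ r) : profile S' S'' r ≤ S'' := by
  rcases le_total S'' (Real.pi * r) with h | h
  · rwa [profile_eq_zero hS h]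
  · refine (mul_le_of_le_one_right (by linarith) (Real.smoothTransition.le_one _)).trans ?_
    have := Real.pi_pos
    nlinarith

theorem le_profile (hS : S' < S'') (r : ℝ) : S' - Real.pi * r ≤ profile S' S'' r := by
  rcases le_total (Real.pi * r) S' with h | h
  · rw [profile, Real.smoothTransition.one_of_one_le, mul_one]
    · linarith
    · rw [le_div_iff₀ (by linarith)]; linarith
  · linarith [profile_nonneg hS r]

theorem exists_niceGrad_bump {ι β : Type} [Fintype ι] [Fintype β] (hδ : 0 < δ) (hS : S' < S'') :
    ∃ C, ∃ F : ℝ → VS ι β → VS ι β, NiceGrad (fun t y => timeBump δ t * profile S' S'' (wnorm y)) F C ∧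
      (∀ t y a, F t y (.inl a) = 0) ∧ (∀ t y, ∃ q : ℝ, ∀ l, F t y (.inr l) = q • y (.inr l)) ∧
      ∀ t y, timeBump δ t = 0 → F t y = 0 := by
  set k : ℝ → EuclideanSpace ℂ β → ℝ := fun t w => timeBump δ t * profile S' S'' (‖w‖ ^ 2) with hk
  have hsm : ContDiff ℝ (⊤ : ℕ∞) (Function.uncurry k) :=
    (contDiff_timeBump.comp contDiff_fst).mul (contDiff_profile.comp (contDiff_snd.norm_sq ℝ))
  have hcs : HasCompactSupport (Function.uncurry k) := by
    refine HasCompactSupport.intro (K := Icc (0:ℝ) 1 ×ˢ Metric.closedBall 0 √(|S''| / Real.pi))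
      (isCompact_Icc.prod (isCompact_closedBall _ _)) ?_
    rintro ⟨t, w⟩ h
    simp only [Function.uncurry, hk]
    by_cases ht : t ∈ Icc (0:ℝ) 1
    · have hw : w ∉ Metric.closedBall 0 √(|S''| / Real.pi) := fun hw => h ⟨ht, hw⟩
      rw [mem_closedBall_zero_iff, not_le] at hw
      have h2 : |S''| / Real.pi ≤ ‖w‖ ^ 2 := (Real.sqrt_le_left (norm_nonneg _)).1 hw.le
      rw [div_le_iff₀ Real.pi_pos] at h2
      rw [profile_eq_zero hS (by linarith [le_abs_self S'']), mul_zero]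
    · rw [timeBump_eq_zero hδ, zero_mul]
      by_contra! hh
      exact ht ⟨hh.1.le, by linarith⟩
  have hgr : ∀ t w, gradient (k t) w = (2 * (timeBump δ t * deriv (profile S' S'') (‖w‖ ^ 2))) • w := by
    intro t w
    refine HasGradientAt.gradient ?_
    rw [hasGradientAt_iff_hasFDerivAt]
    have h1 : HasDerivAt (profile S' S'') (deriv (profile S' S'') (‖w‖ ^ 2)) (‖w‖ ^ 2) :=
      ((contDiff_profile.differentiable (by simp)) _).hasDerivAt
    have h2 := (h1.comp_hasFDerivAt w (hasStrictFDerivAt_norm_sq w).hasFDerivAt).const_mul (timeBump δ t)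
    refine HasFDerivAt.congr_fderiv h2 ?_
    ext v
    simp
    ring
  obtain ⟨C, hC⟩ := niceGrad_of_compact hsm hcs
  have h := hC.comp (P := (projW : VS ι β →L[ℝ] _)) (J := inclW) inner_inclW norm_projW_le norm_inclW_le
  refine ⟨C, fun t y => inclW (gradient (k t) (projW y)), ?_, fun t y a => inclW_inl _ _, fun t y => ?_, fun t y ht => ?_⟩
  · have e : (fun t (y : VS ι β) => timeBump δ t * profile S' S'' (wnorm y)) = fun t y => k t (projW y) := by
      ext t y
      simp only [hk, norm_projW_sq]
    rw [e]
    exact h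
  · refine ⟨2 * (timeBump δ t * deriv (profile S' S'') (‖projW y‖ ^ 2)), fun l => ?_⟩
    rw [inclW_inr, hgr]
    rfl
  · change inclW (gradient (k t) (projW y)) = 0
    rw [hgr, ht]; simp

end Profile

section Linking
variable {ι β : Type} [Fintype ι] [Fintype β] [DecidableEq ι] [DecidableEq β] {N : ℕ}

theorem blockInner_lblk (i : ι) (x y : EuclideanSpace ℝ (Lam ι β N)) :
    blockInner lblk i x y = ∑ p, x (.inl i, p) * y (.inl i, p) := by
  rw [blockInner, Fintype.sum_prod_type, Fintype.sum_sum_type, Finset.sum_eq_single i]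
  · simp [lblk]
  · intro j _ hj
    simp [lblk, hj]
  · simp

/-- Indices of the linking sphere: negative frequencies and one real constant mode. -/
abbrev NegIdx (N : ℕ) : Type :=
  {p : ↥(Finset.Icc (-(N : ℤ)) N) × Bool // (p.1 : ℤ) < 0 ∨ ((p.1 : ℤ) = 0 ∧ p.2 = false)}

/-- Indices of the nonpositive frequencies. -/
abbrev NonposIdx (N : ℕ) : Type := {j : ↥(Finset.Icc (-(N : ℤ)) N) // (j : ℤ) ≤ 0}

/-- The parametrisation of the linking set. -/
def linkMap (R : ℝ) (p : (ι × NegIdx N → ℝ) × (β × NonposIdx N × Bool → ℝ)) : EuclideanSpace ℝ (Lam ι β N) :=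
  WithLp.toLp 2 fun α => Sum.elim
    (fun i => if h : (α.2.1 : ℤ) < 0 ∨ ((α.2.1 : ℤ) = 0 ∧ α.2.2 = false) then √R * p.1 (i, ⟨α.2, h⟩) else 0)
    (fun l => if h : (α.2.1 : ℤ) ≤ 0 then p.2 (l, ⟨α.2.1, h⟩, α.2.2) else 0) α.1

theorem linkMap_inl (R : ℝ) (p : (ι × NegIdx N → ℝ) × (β × NonposIdx N × Bool → ℝ)) (i : ι) (q : NegIdx N) :
    linkMap R p (.inl i, q.1) = √R * p.1 (i, q) := by
  simp only [linkMap, Sum.elim_inl]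
  rw [dif_pos q.2]

theorem linkMap_inr (R : ℝ) (p : (ι × NegIdx N → ℝ) × (β × NonposIdx N × Bool → ℝ)) (l : β) (j : NonposIdx N) (b : Bool) :
    linkMap R p (.inr l, j.1, b) = p.2 (l, j, b) := by
  simp only [linkMap, Sum.elim_inr]
  rw [dif_pos j.2]

theorem linkMap_pos (R : ℝ) (p : (ι × NegIdx N → ℝ) × (β × NonposIdx N × Bool → ℝ)) (α : Lam ι β N)
    (hα : (0 : ℤ) < α.2.1) : linkMap R p α = 0 := by
  rcases α with ⟨i | l, j, b⟩
  · simp only [linkMap, Sum.elim_inl]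
    rw [dif_neg]
    simp only at hα
    omega
  · simp only [linkMap, Sum.elim_inr]
    rw [dif_neg]
    simp only at hα
    omega

theorem continuous_linkMap (R : ℝ) :
    Continuous (linkMap R : (ι × NegIdx N → ℝ) × (β × NonposIdx N × Bool → ℝ) → EuclideanSpace ℝ (Lam ι β N)) := by
  refine (PiLp.continuous_toLp 2 _).comp (continuous_pi ?_)
  rintro ⟨i | l, j, b⟩
  · simp only [Sum.elim_inl]
    split_ifs <;> fun_prop
  · simp only [Sum.elim_inr]
    split_ifs <;> fun_prop

theorem linkMap_flip (R : ℝ) (η : ι → ℤˣ) (u : ι × NegIdx N → ℝ) (y : β × NonposIdx N × Bool → ℝ) :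
    linkMap R (fun e => sgn (η e.1) * u e, y) = blockFlip lblk η (linkMap R (u, y)) := by
  ext ⟨i | l, j, b⟩
  · simp only [linkMap, blockFlip, lblk, Sum.elim_inl, Option.elim]
    split_ifs <;> ring
  · simp [linkMap, blockFlip, lblk]

theorem blockInner_linkMap {R : ℝ} (hR : 0 < R) {u : ι × NegIdx N → ℝ} (hu : u ∈ sphProd (Prod.fst : ι × NegIdx N → ι))
    (y : β × NonposIdx N × Bool → ℝ) (i : ι) : blockInner lblk i (linkMap R (u, y)) (linkMap R (u, y)) = R := by
  rw [blockInner_lblk]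
  have h1 : ∑ q : NegIdx N, u (i, q) ^ 2 = 1 := by
    rw [← hu i, Finset.sum_filter, Fintype.sum_prod_type, Finset.sum_eq_single i]
    · simp
    · intro j _ hj; simp [hj]
    · simp
  have h2 : ∑ q : NegIdx N, linkMap R (u, y) (.inl i, q.1) ^ 2 = R := by
    simp only [linkMap_inl, mul_pow, Real.sq_sqrt hR.le, ← Finset.mul_sum, h1, mul_one]
  refine Eq.trans ?_ h2
  rw [← Finset.sum_subtype (p := fun p : ↥(Finset.Icc (-(N : ℤ)) N) × Bool => (p.1 : ℤ) < 0 ∨ ((p.1 : ℤ) = 0 ∧ p.2 = false))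
    (Finset.univ.filter fun p => (p.1 : ℤ) < 0 ∨ ((p.1 : ℤ) = 0 ∧ p.2 = false)) (by simp) (f := fun p => linkMap R (u, y) (.inl i, p) ^ 2), Finset.sum_filter]
  refine Finset.sum_congr rfl fun p _ => ?_
  split_ifs with h
  · ring
  · simp only [linkMap, Sum.elim_inl]
    rw [dif_neg h]; ring

theorem exists_linking {R c : ℝ} (hR : 0 < R) {Θ : EuclideanSpace ℝ (Lam ι β N) → EuclideanSpace ℝ (Lam ι β N)}
    (hΘc : Continuous Θ) (hΘe : ∀ η x, Θ (blockFlip lblk η x) = blockFlip lblk η (Θ x)) (hΘ : ∀ x, ‖Θ x - x‖ ≤ c) :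
    ∃ x, (∀ i, blockInner lblk i x x = R) ∧ (∀ α : Lam ι β N, (0 : ℤ) < α.2.1 → x α = 0) ∧
      (∀ α : Lam ι β N, (α.2.1 : ℤ) < 0 → Θ x α = 0) ∧
      ∀ l (j : ↥(Finset.Icc (-(N : ℤ)) N)) b, (j : ℤ) ≤ 0 → Θ x (.inr l, j, b) = 0 := by
  set τ : ι → ι × NegIdx N := fun i => (i, ⟨(⟨0, by simp⟩, false), .inr ⟨rfl, rfl⟩⟩) with hτ
  have hco : ∀ α, Continuous fun p : (ι × NegIdx N → ℝ) × (β × NonposIdx N × Bool → ℝ) => Θ (linkMap R p) α := by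
    intro α
    exact (EuclideanSpace.proj (𝕜 := ℝ) α).continuous.comp
      (hΘc.comp (continuous_linkMap (ι := ι) (β := β) (N := N) R))
  have hdiff : ∀ x α, |Θ x α - x α| ≤ c := by
    intro x α
    have := (PiLp.norm_apply_le (Θ x - x) α).trans (hΘ x)
    simpa using this
  have hc : 0 ≤ c := (norm_nonneg _).trans (hΘ 0)
  have hFb : ∀ d : ι × NegIdx N, ∀ u ∈ sphProd (Prod.fst : ι × NegIdx N → ι), ∀ y,
      |Θ (linkMap R (u, y)) (.inl d.1, d.2.1)| ≤ √R + c := by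
    intro d u hu y
    have e1 := abs_le.1 (hdiff (linkMap R (u, y)) (.inl d.1, d.2.1))
    rw [linkMap_inl] at e1
    have hd : u d ^ 2 ≤ 1 := by
      rw [← hu d.1]
      exact Finset.single_le_sum (f := fun c => u c ^ 2) (fun _ _ => sq_nonneg _) (by simp)
    have hd' := abs_le.1 ((sq_le_one_iff_abs_le_one _).1 hd)
    have hR' := Real.sqrt_nonneg R
    have e2 : √R * u (d.1, d.2) ≤ √R := mul_le_of_le_one_right hR' hd'.2
    have e3 : -√R ≤ √R * u (d.1, d.2) := by nlinarith [hd'.1]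
    rw [abs_le]
    constructor <;> linarith [e1.1, e1.2]
  have hGb : ∀ (d : β × NonposIdx N × Bool) (u : ι × NegIdx N → ℝ) y,
      |Θ (linkMap R (u, y)) (.inr d.1, d.2.1.1, d.2.2) - y d| ≤ √R + c := by
    intro d u y
    have e1 := hdiff (linkMap R (u, y)) (.inr d.1, d.2.1.1, d.2.2)
    rw [linkMap_inr] at e1
    exact e1.trans (by linarith [Real.sqrt_nonneg R])
  have hFo : ∀ (d : ι × NegIdx N) (u : ι × NegIdx N → ℝ) (y) (η : ι → ℤˣ),
      Θ (linkMap R (fun e => sgn (η e.1) * u e, y)) (.inl d.1, d.2.1)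
        = sgn (η d.1) * Θ (linkMap R (u, y)) (.inl d.1, d.2.1) := by
    intro d u y η
    rw [linkMap_flip, hΘe]
    simp [blockFlip, lblk]
  have hGo : ∀ (d : β × NonposIdx N × Bool) (u : ι × NegIdx N → ℝ) (y) (η : ι → ℤˣ),
      Θ (linkMap R (fun e => sgn (η e.1) * u e, y)) (.inr d.1, d.2.1.1, d.2.2)
        = Θ (linkMap R (u, y)) (.inr d.1, d.2.1.1, d.2.2) := by
    intro d u y η
    rw [linkMap_flip, hΘe]
    simp [blockFlip, lblk]
  obtain ⟨u, hu, y, h1, h2⟩ := borsuk_ulam_sphProd_prod (κ := ι × NegIdx N) (δ := β × NonposIdx N × Bool)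
    Prod.fst τ (fun i => rfl)
    (fun d p => Θ (linkMap R p) (.inl d.1, d.2.1)) (fun d p => Θ (linkMap R p) (.inr d.1, d.2.1.1, d.2.2)) (√R + c)
    (fun d _ => (hco _).continuousOn) (fun d => (hco _).continuousOn)
    (fun d _ u _ y η => hFo d u y η) (fun d u _ y η => hGo d u y η)
    (fun d _ u hu y => hFb d u hu y) (fun d u _ y => hGb d u y)
  refine ⟨linkMap R (u, y), blockInner_linkMap hR hu y, fun α hα => linkMap_pos R _ α hα, ?_, ?_⟩
  · rintro ⟨i | l, j, b⟩ hj
    · refine h1 (i, ⟨(j, b), .inl hj⟩) ?_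
      rintro ⟨i', hi'⟩
      simp only [hτ, Prod.mk.injEq, Subtype.mk.injEq] at hi'
      rw [← hi'.2.1] at hj
      simp at hj
    · exact h2 (l, ⟨j, le_of_lt hj⟩, b)
  · intro l j b hj
    exact h2 (l, ⟨j, hj⟩, b)

end Linking

section ActionBound
variable {ι β : Type} [Fintype ι] [Fintype β] [DecidableEq ι] [DecidableEq β] {N : ℕ}

theorem inner_Lam (x y : EuclideanSpace ℝ (Lam ι β N)) :
    inner ℝ x y = (∑ i, blockInner lblk i x y) + ∑ l, ∑ p, x (.inr l, p) * y (.inr l, p) := by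
  rw [inner_eq_sum_mul, Fintype.sum_prod_type, Fintype.sum_sum_type]
  simp only [blockInner_lblk]

theorem lfreq_inl (i : ι) (p : ↥(Finset.Icc (-(N : ℤ)) N) × Bool) :
    lfreq ((.inl i, p) : Lam ι β N) = Real.pi * ((p.1 : ℤ) : ℝ) := rfl

theorem lfreq_inr (l : β) (p : ↥(Finset.Icc (-(N : ℤ)) N) × Bool) :
    lfreq ((.inr l, p) : Lam ι β N) = 2 * Real.pi * ((p.1 : ℤ) : ℝ) := rfl

theorem inner_diagMul_add_blockAction_nonpos {x : EuclideanSpace ℝ (Lam ι β N)}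
    (hx : ∀ α : Lam ι β N, (0 : ℤ) < α.2.1 → x α = 0) :
    inner ℝ (diagMul lfreq x) x / 2 + blockAction lblk lfreq x ≤ 0 := by
  have hneg : ∀ (k : ι ⊕ β) p, diagMul lfreq x (k, p) * x (k, p) ≤ 0 := by
    intro k p
    change lfreq (k, p) * x (k, p) * x (k, p) ≤ 0
    rcases lt_or_ge (0 : ℤ) p.1 with h | h
    · rw [hx (k, p) h]; simp
    · have h' : ((p.1 : ℤ) : ℝ) ≤ 0 := by exact_mod_cast h
      have : lfreq (k, p) ≤ 0 := by
        rcases k with i | l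
        · rw [lfreq_inl]; nlinarith [Real.pi_pos]
        · rw [lfreq_inr]; nlinarith [Real.pi_pos]
      rw [mul_assoc]
      exact mul_nonpos_of_nonpos_of_nonneg this (mul_self_nonneg _)
  have h1 : ∀ i, blockInner lblk i (diagMul lfreq x) x ≤ 0 := by
    intro i
    rw [blockInner_lblk]
    exact Finset.sum_nonpos fun p _ => hneg _ p
  have h2 : blockAction lblk lfreq x = -(∑ i, blockInner lblk i (diagMul lfreq x) x) / 2 := by
    rw [blockAction, ← Finset.sum_neg_distrib, Finset.sum_div]
    refine Finset.sum_congr rfl fun i _ => ?_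
    rw [abs_of_nonpos (by linarith [h1 i])]; ring
  have h3 : ∑ l, ∑ p, diagMul lfreq x (.inr l, p) * x (.inr l, p) ≤ 0 :=
    Finset.sum_nonpos fun l _ => Finset.sum_nonpos fun p _ => hneg _ p
  rw [h2, inner_Lam]
  linarith

theorem le_inner_diagMul {z : EuclideanSpace ℝ (Lam ι β N)} (hz : ∀ α : Lam ι β N, (α.2.1 : ℤ) < 0 → z α = 0)
    (hz' : ∀ l (j : ↥(Finset.Icc (-(N : ℤ)) N)) b, (j : ℤ) ≤ 0 → z (.inr l, j, b) = 0) :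
    Real.pi * ∫ t in (0:ℝ)..1, wnorm (apath z t) ≤ inner ℝ (diagMul lfreq z) z / 2 := by
  rw [integral_wnorm_apath, inner_Lam]
  have h1 : ∀ i, 0 ≤ blockInner lblk i (diagMul lfreq z) z := by
    intro i
    rw [blockInner_lblk]
    refine Finset.sum_nonneg fun p _ => ?_
    change 0 ≤ lfreq (.inl i, p) * z (.inl i, p) * z (.inl i, p)
    rcases lt_or_ge (p.1 : ℤ) 0 with h | h
    · rw [hz (.inl i, p) h]; simp
    · have h' : (0:ℝ) ≤ ((p.1 : ℤ) : ℝ) := by exact_mod_cast h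
      rw [lfreq_inl, mul_assoc]
      exact mul_nonneg (mul_nonneg Real.pi_pos.le h') (mul_self_nonneg _)
  have h2 : 2 * Real.pi * (∑ l, ∑ j, ∑ b, z (.inr l, j, b) ^ 2)
      ≤ ∑ l, ∑ p, diagMul lfreq z (.inr l, p) * z (.inr l, p) := by
    rw [Finset.mul_sum]
    refine Finset.sum_le_sum fun l _ => ?_
    rw [Fintype.sum_prod_type, Finset.mul_sum]
    refine Finset.sum_le_sum fun j _ => ?_
    rw [Finset.mul_sum]
    refine Finset.sum_le_sum fun b _ => ?_
    change _ ≤ lfreq (.inr l, j, b) * z (.inr l, j, b) * z (.inr l, j, b)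
    rcases le_or_gt (j : ℤ) 0 with h | h
    · rw [hz' l j b h]; simp
    · have h' : (1:ℝ) ≤ ((j : ℤ) : ℝ) := by exact_mod_cast h
      rw [lfreq_inr]
      have h3 : Real.pi * 1 * z (.inr l, j, b) ^ 2 ≤ Real.pi * ((j : ℤ) : ℝ) * z (.inr l, j, b) ^ 2 := by gcongr
      simp only
      linarith
  have h3 := Finset.sum_nonneg fun i (_ : i ∈ Finset.univ) => h1 i
  linarith

theorem wnorm_rotV (c : ι → ℂ) (y : VS ι β) : wnorm (rotV c y) = wnorm y := rfl

theorem norm_sgn (s : ℤˣ) : ‖(sgn s : ℂ)‖ = 1 := by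
  rw [Complex.norm_real, Real.norm_eq_abs, abs_sgn]

theorem continuous_wnorm : Continuous (wnorm : VS ι β → ℝ) := by
  unfold wnorm; fun_prop

variable {R S' S'' S₃ δ ρ MG : ℝ} {h G : ℝ → VS ι β → ℝ} {L U : ℝ → ℝ}

theorem action_bound (hR : 0 < R) (hS'0 : 0 ≤ S') (hS : S' < S'') (hS3 : S'' < S₃) (hδ : 0 < δ) (hδ3 : 3 * δ ≤ 1)
    (hρ : 0 < ρ) (hMG : 0 ≤ MG)
    (hh : ContDiff ℝ (⊤ : ℕ∞) (Function.uncurry h)) (hhs : HasCompactSupport (Function.uncurry h))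
    (hht : ∀ t y, t ∉ Ioo (1 - δ) 1 → h t y = 0)
    (hhr : ∀ t y (c : ι → ℂ), (∀ i, ‖c i‖ = 1) → h t (rotV c y) = h t y)
    (hG : ContDiff ℝ 1 (Function.uncurry G))
    (hGb : ∀ t ∈ Icc (1 - δ) 1, ∀ y v, |fderiv ℝ (Function.uncurry G) (t, y) (0, v)| ≤ MG * ‖v‖)
    (hGr : ∀ t y (c : ι → ℂ), (∀ i, ‖c i‖ = 1) → G t (rotV c y) = G t y)
    (hGt : ∀ t ∈ Icc (1 - δ) 1, ∀ y, (∀ i, |znorm i y - R| ≤ ρ) →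
      fderiv ℝ (Function.uncurry G) (t, y) (1, -(Complex.I • gradient (h t) y)) = 0)
    (hG0 : ∀ y, (∀ a, |‖y (.inl a)‖ ^ 2 - R / 2| ≤ ρ) → Real.pi * wnorm y ≤ S₃ → G (1 - δ) y = 1)
    (hG1 : ∀ y, (∀ a, |‖y (.inl a)‖ ^ 2 - R / 2| ≤ ρ) → Real.pi * wnorm y ≤ S₃ → G 1 y = 0)
    (hLc : Continuous L) (hUc : Continuous U) (hL : ∀ t ∈ Icc (0:ℝ) 1, ∀ y, L t ≤ h t y)
    (hU : ∀ t ∈ Icc (0:ℝ) 1, ∀ y, h t y ≤ U t) :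
    S' * (1 - 3 * δ) ≤ (∫ t in (0:ℝ)..1, U t) - ∫ t in (0:ℝ)..1, L t := by
  have hπ := Real.pi_pos
  obtain ⟨Cb, Fb, hb, hb0, hbr, hbz⟩ := exists_niceGrad_bump (ι := ι) (β := β) hδ hS
  obtain ⟨Ch, hhn⟩ := niceGrad_of_compact hh hhs
  set kb : ℝ → VS ι β → ℝ := fun t y => timeBump δ t * profile S' S'' (wnorm y) with hkb
  set Fh : ℝ → VS ι β → VS ι β := fun t => gradient (h t) with hFh
  set kk : ℝ → ℝ → VS ι β → ℝ := fun s t y => s * kb t y + h t y with hkk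
  set FF : ℝ → ℝ → VS ι β → VS ι β := fun s t y => s • Fb t y + Fh t y with hFF
  have hn : ∀ s ∈ Icc (0:ℝ) 1, NiceGrad (kk s) (FF s) (Cb + Ch) := fun s hs => hb.smul_add hhn hs
  have hFh0 : ∀ t y, t ∉ Ioo (1 - δ) 1 → Fh t y = 0 := by
    intro t y ht
    have : h t = fun _ => 0 := funext fun y => hht t y ht
    simp [hFh, this, gradient]
  have hkinv : ∀ s t y (c : ι → ℂ), (∀ i, ‖c i‖ = 1) → kk s t (rotV c y) = kk s t y := by
    intro s t y c hc
    simp only [hkk, hkb, wnorm_rotV, hhr t y c hc]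
  have hbinv : ∀ t y (c : ι → ℂ), (∀ i, ‖c i‖ = 1) → kb t (rotV c y) = kb t y := by
    intro t y c hc
    simp only [hkb, wnorm_rotV]
  set ρ' := min ρ ((S₃ - S'') / Real.pi) with hρ'
  have hρ'0 : 0 < ρ' := lt_min hρ (div_pos (by linarith) hπ)
  have hcw : ∀ w, w ≤ S'' / Real.pi + ρ' → Real.pi * w ≤ S₃ := by
    intro w hw
    have h1 : w ≤ S₃ / Real.pi := by
      have := min_le_right ρ ((S₃ - S'') / Real.pi)
      have e : S'' / Real.pi + (S₃ - S'') / Real.pi = S₃ / Real.pi := by ring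
      linarith
    rw [le_div_iff₀ hπ] at h1; linarith
  obtain ⟨μ, hμ, δ₀, hδ₀, hmain⟩ := exists_tangential_bound (k := kk) (F := FF) (C := Cb + Ch) (cw := S'' / Real.pi)
    (ρ := ρ') (δ := δ) (G := G) (MG := MG) hR hδ (by linarith) hρ'0 hMG hn
    (fun s y => by simp only [hFF]; rw [hbz 0 y (timeBump_eq_zero hδ (.inl le_rfl)), hFh0 0 y (fun hh => by linarith [hh.1])]; simp)
    (fun s y => by simp only [hFF]; rw [hbz 1 y (timeBump_eq_zero hδ (.inr (by linarith))), hFh0 1 y (by simp)]; simp)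
    (fun s t y i => by
      simp only [hFF]
      rw [inner_add_left, real_inner_smul_left, hb.inner_lamV hbinv, hhn.inner_lamV hhr]; simp)
    (fun s t ht y a => by
      simp only [hFF]
      rw [hFh0 t y (fun hh => by linarith [hh.1, ht.2]), add_zero, PiLp.smul_apply, hb0, smul_zero])
    (fun s t ht y => by
      obtain ⟨q, hq⟩ := hbr t y
      refine ⟨s * q, fun l => ?_⟩
      simp only [hFF]
      rw [hFh0 t y (fun hh => by linarith [hh.1, ht.2]), add_zero, PiLp.smul_apply, hq, smul_smul])
    hG hGb (fun t _ y r => fderiv_lamV hG hGr t y r)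
    (fun s t ht y hy => by
      have := hGt t ht y fun i => (hy i).trans (min_le_left _ _)
      simp only [hFF]
      rwa [hbz t y (timeBump_eq_zero hδ (.inr ht.1)), smul_zero, zero_add])
    (fun y hy hw => hG0 y (fun a => (hy a).trans (min_le_left _ _)) (hcw _ hw))
    (fun y hy hw => hG1 y (fun a => (hy a).trans (min_le_left _ _)) (hcw _ hw))
  set M := Cb + Ch with hM
  have hM0 : 0 ≤ M := add_nonneg hb.nonneg hhn.nonneg
  obtain ⟨N, hN⟩ := hmain (2 * (S'' * (1 + M / μ) + 1 + S''))
  set B : EuclideanSpace ℝ (Lam ι β N) → ℝ := fun x => ∫ t in (0:ℝ)..1, kb t (apath x t) with hB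
  have hkbc : ∀ x : EuclideanSpace ℝ (Lam ι β N), Continuous fun t => kb t (apath x t) :=
    fun x => (hb.continuous_comp (continuous_apath x)).1
  have hhc : ∀ x : EuclideanSpace ℝ (Lam ι β N), Continuous fun t => h t (apath x t) :=
    fun x => (hhn.continuous_comp (continuous_apath x)).1
  have hpa : ∀ s (x : EuclideanSpace ℝ (Lam ι β N)), pathAction (kk s) x = pathAction h x + s * B x := by
    intro s x
    simp only [pathAction, hkk, hB]
    rw [intervalIntegral.integral_add ((hkbc x).const_mul s |>.intervalIntegrable _ _) ((hhc x).intervalIntegrable _ _),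
      intervalIntegral.integral_const_mul]
    ring
  obtain ⟨W, hW0, hW⟩ : ∃ W, 0 ≤ W ∧ ∀ α : Lam ι β N, |lfreq α| ≤ W :=
    ⟨∑ α : Lam ι β N, |lfreq α|, Finset.sum_nonneg fun _ _ => abs_nonneg _, fun α =>
      Finset.single_le_sum (f := fun α : Lam ι β N => |lfreq α|) (fun _ _ => abs_nonneg _) (Finset.mem_univ α)⟩
  have hS''0 : 0 ≤ S'' := by linarith
  have hkb_nonneg : ∀ t y, 0 ≤ kb t y := fun t y => mul_nonneg (timeBump_nonneg t) (profile_nonneg hS _)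
  have hwn : ∀ y : VS ι β, 0 ≤ wnorm y := wnorm_nonneg
  have hBbd : ∀ x, 0 ≤ B x ∧ B x ≤ S'' := by
    intro x
    refine ⟨intervalIntegral.integral_nonneg zero_le_one fun t _ => hkb_nonneg t _, ?_⟩
    have := intervalIntegral.integral_mono_on (μ := volume) (a := 0) (b := 1) (g := fun _ => S'') zero_le_one
      ((hkbc x).intervalIntegrable _ _) (by simp) fun t _ =>
        (mul_le_of_le_one_left (profile_nonneg hS _) (timeBump_le_one t)).trans (profile_le hS hS''0 (hwn (apath x t)))
    simpa using this
  have hBne : ∀ x, B x ≠ 0 → ∃ t₀ ∈ Icc (0:ℝ) (1 - δ), wnorm (apath x t₀) ≤ S'' / Real.pi := by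
    intro x hx
    by_contra! hc
    apply hx
    have : ∀ t ∈ uIcc (0:ℝ) 1, kb t (apath x t) = 0 := by
      intro t ht
      rw [uIcc_of_le zero_le_one] at ht
      rcases le_or_gt t (1 - δ) with h1 | h1
      · have := hc t ⟨ht.1, h1⟩
        rw [div_lt_iff₀ hπ] at this
        simp only [hkb]
        rw [profile_eq_zero hS (by linarith), mul_zero]
      · simp only [hkb]
        rw [timeBump_eq_zero hδ (.inr h1.le), zero_mul]
    simp only [hB]
    rw [intervalIntegral.integral_congr this]; simp
  set σ : ℝ → ℝ := fun s => max 0 (min s 1) with hσ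
  have hσI : ∀ s, σ s ∈ Icc (0:ℝ) 1 := fun s => ⟨le_max_left _ _, max_le zero_le_one (min_le_right _ _)⟩
  have hσe : ∀ s ∈ Icc (0:ℝ) 1, σ s = s := fun s hs => by
    simp only [hσ]; rw [min_eq_left hs.2, max_eq_right hs.1]
  have key : ∀ e > 0, S' * (1 - 3 * δ) ≤ ((∫ t in (0:ℝ)..1, U t) - ∫ t in (0:ℝ)..1, L t) + e := by
    intro e he
    obtain ⟨Θ, hΘc, hΘe, hΘn, hΘ⟩ := exists_deformation (blk := lblk) (ω := lfreq) (R := R) (μ := μ) (M := M) (Bm := S'')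
      (δ₀ := δ₀) (K := M + W / 2) (LB := Cb) hR hμ hM0 hδ₀ (fun x : EuclideanSpace ℝ (Lam ι β N) => pathAction h x) B
      (fun s x => pcoef N fun t => FF (σ s) t (apath x t))
      (fun s hs x v => by
        have := pathAction_add_le (hn s hs) hW0 hW x v
        rw [hpa, hpa] at this
        simp only [hσe s hs]
        exact this)
      (fun s hs x => norm_pcoef_le_of_bdd ((hn _ (hσI s)).continuous_comp (continuous_apath x)).2 hM0
        fun t => (hn _ (hσI s)).bdd t _)
      (fun s => (hn _ (hσI s)).continuous_pcoef) hBbd (fun x v => integral_comp_apath_le hb x v)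
      (continuous_integral_comp_apath hb)
      (fun s η x => by
        rw [← pcoef_rotL]
        congr 1
        ext1 t
        rw [apath_blockFlip, ← rotL_apply]
        exact (hn _ (hσI s)).map_eq (inner_rotL _) (rotL_rotL η)
          (fun t y => by rw [rotL_apply]; exact hkinv _ t y _ fun i => norm_sgn _) t _)
      (fun η x => by
        simp only [hB, apath_blockFlip]
        refine intervalIntegral.integral_congr fun t _ => ?_
        exact hbinv t _ _ fun i => norm_sgn _)
      (fun s hs x hx hx' hx'' => by
        simp only [hσe s hs]
        exact hN s hs x hx hx' (hBne x hx''))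
      he
    obtain ⟨x, hx1, hx2, hx3, hx4⟩ := exists_linking (ι := ι) (β := β) (N := N) hR hΘc hΘe hΘn
    have hup : pathAction h x + blockAction lblk lfreq x ≤ ∫ t in (0:ℝ)..1, U t := by
      have h1 := inner_diagMul_add_blockAction_nonpos hx2
      have h2 : ∫ t in (0:ℝ)..1, h t (apath x t) ≤ ∫ t in (0:ℝ)..1, U t :=
        intervalIntegral.integral_mono_on zero_le_one ((hhc x).intervalIntegrable _ _) (hUc.intervalIntegrable _ _)
          fun t ht => hU t ht _
      simp only [pathAction]
      linarith
    have h1 := hΘ x _ hx1 hup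
    set z := Θ x with hz
    have h2 := le_inner_diagMul hx3 hx4
    have hwc : Continuous fun t => wnorm (apath z t) := continuous_wnorm.comp (continuous_apath z)
    have hbc : Continuous (timeBump δ) := contDiff_timeBump.continuous
    have hhk : Continuous fun t => h t (apath z t) + kb t (apath z t) := (hhc z).add (hkbc z)
    have h3 : ∫ t in (0:ℝ)..1, (L t + S' * timeBump δ t) ≤
        ∫ t in (0:ℝ)..1, (h t (apath z t) + kb t (apath z t) + Real.pi * wnorm (apath z t)) := by
      refine intervalIntegral.integral_mono_on zero_le_one
        ((hLc.add (hbc.const_mul S')).intervalIntegrable _ _)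
        ((hhk.add (hwc.const_mul Real.pi)).intervalIntegrable _ _) fun t ht => ?_
      have e1 := hL t ht (apath z t)
      have e2 := mul_le_mul_of_nonneg_left (le_profile hS (wnorm (apath z t))) (timeBump_nonneg (δ := δ) t)
      have e3 : 0 ≤ Real.pi * wnorm (apath z t) * (1 - timeBump δ t) :=
        mul_nonneg (mul_nonneg hπ.le (hwn _)) (by linarith [timeBump_le_one (δ := δ) t])
      simp only [hkb]
      nlinarith
    rw [intervalIntegral.integral_add (hLc.intervalIntegrable _ _) ((hbc.const_mul S').intervalIntegrable _ _),
      intervalIntegral.integral_const_mul,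
      intervalIntegral.integral_add (hhk.intervalIntegrable _ _)
        ((hwc.const_mul Real.pi).intervalIntegrable _ _),
      intervalIntegral.integral_add ((hhc z).intervalIntegrable _ _) ((hkbc z).intervalIntegrable _ _),
      intervalIntegral.integral_const_mul] at h3
    have h4 := mul_le_mul_of_nonneg_left (le_integral_timeBump hδ hδ3) hS'0
    simp only [pathAction, hB] at h1
    linarith
  exact le_of_forall_pos_le_add key

end ActionBound

section Lift

/-- Smooth cutoff on the line, `1` below `a` and `0` above `b`. -/
def smoothStep (a b r : ℝ) : ℝ := Real.smoothTransition ((b - r) / (b - a))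

theorem contDiff_smoothStep {a b : ℝ} : ContDiff ℝ (⊤ : ℕ∞) (smoothStep a b) :=
  Real.smoothTransition.contDiff.comp ((contDiff_const.sub contDiff_id).div_const _)

theorem smoothStep_nonneg (a b r : ℝ) : 0 ≤ smoothStep a b r := Real.smoothTransition.nonneg _

theorem smoothStep_le_one (a b r : ℝ) : smoothStep a b r ≤ 1 := Real.smoothTransition.le_one _

theorem smoothStep_eq_one {a b r : ℝ} (h : a < b) (hr : r ≤ a) : smoothStep a b r = 1 := by
  refine Real.smoothTransition.one_of_one_le ?_
  rw [le_div_iff₀ (by linarith)]; linarith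

theorem smoothStep_eq_zero {a b r : ℝ} (h : a < b) (hr : b ≤ r) : smoothStep a b r = 0 :=
  Real.smoothTransition.zero_of_nonpos (div_nonpos_of_nonpos_of_nonneg (by linarith) (by linarith))

/-- A positive smooth function equal to the identity above `c`. -/
def regPos (c s : ℝ) : ℝ := c + (s - c) * Real.smoothTransition (2 * s / c - 1)

theorem contDiff_regPos {c : ℝ} : ContDiff ℝ (⊤ : ℕ∞) (regPos c) :=
  contDiff_const.add ((contDiff_id.sub contDiff_const).mul (Real.smoothTransition.contDiff.comp
    (((contDiff_const.mul contDiff_id).div_const _).sub contDiff_const)))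

theorem regPos_pos {c : ℝ} (hc : 0 < c) (s : ℝ) : 0 < regPos c s := by
  unfold regPos
  have h0 := Real.smoothTransition.nonneg (2 * s / c - 1)
  have h1 := Real.smoothTransition.le_one (2 * s / c - 1)
  rcases le_or_gt s (c / 2) with h | h
  · rw [Real.smoothTransition.zero_of_nonpos]
    · linarith
    · rw [sub_nonpos, div_le_one hc]; linarith
  · nlinarith

theorem regPos_eq {c s : ℝ} (hc : 0 < c) (hs : c ≤ s) : regPos c s = s := by
  rw [regPos, Real.smoothTransition.one_of_one_le]
  · ring
  · rw [le_sub_iff_add_le, le_div_iff₀ hc]; linarith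

/-- A smooth function equal to the inverse square root above `c`. -/
def invSqrt (c s : ℝ) : ℝ := (√(regPos c s))⁻¹

theorem contDiff_invSqrt {c : ℝ} (hc : 0 < c) : ContDiff ℝ (⊤ : ℕ∞) (invSqrt c) :=
  (contDiff_regPos.sqrt fun s => (regPos_pos hc s).ne').inv fun s => (Real.sqrt_pos.2 (regPos_pos hc s)).ne'

theorem invSqrt_eq {c s : ℝ} (hc : 0 < c) (hs : c ≤ s) : invSqrt c s = (√s)⁻¹ := by
  rw [invSqrt, regPos_eq hc hs]

variable {ι β : Type} [Fintype ι] [Fintype β] [DecidableEq ι] [DecidableEq β] {n : ℕ}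

/-- The reduction map from pairs of coordinates to the disk coordinates. -/
def liftMap (e : ι ⊕ β ≃ Fin n) (c : ℝ) (y : VS ι β) : CE n :=
  WithLp.toLp 2 fun j => Sum.elim
    (fun i => (invSqrt c (‖y (.inl (i, false))‖ ^ 2) : ℂ) * (y (.inl (i, true)) * (starRingEnd ℂ) (y (.inl (i, false)))))
    (fun l => y (.inr l)) (e.symm j)

/-- The cutoff used to lift functions along `liftMap`. -/
def liftCut (R c : ℝ) (y : VS ι β) : ℝ :=
  ∏ i, smoothStep (2 * R) (3 * R) (znorm i y) * Real.smoothTransition (‖y (.inl (i, false))‖ ^ 2 / c - 2)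

variable {e : ι ⊕ β ≃ Fin n} {c R : ℝ}

theorem liftMap_inl (y : VS ι β) (i : ι) : liftMap e c y (e (.inl i)) =
    (invSqrt c (‖y (.inl (i, false))‖ ^ 2) : ℂ) * (y (.inl (i, true)) * (starRingEnd ℂ) (y (.inl (i, false)))) := by
  simp [liftMap]

theorem liftMap_inr (y : VS ι β) (l : β) : liftMap e c y (e (.inr l)) = y (.inr l) := by
  simp [liftMap]

theorem contDiff_coord (a : (ι × Bool) ⊕ β) : ContDiff ℝ (⊤ : ℕ∞) fun y : VS ι β => y a :=
  ((EuclideanSpace.proj a : VS ι β →L[ℂ] ℂ).restrictScalars ℝ).contDiff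

theorem contDiff_liftMap (hc : 0 < c) : ContDiff ℝ (⊤ : ℕ∞) (liftMap e c : VS ι β → CE n) := by
  rw [contDiff_piLp]
  intro j
  obtain ⟨k, rfl⟩ := e.surjective j
  rcases k with i | l
  · simp only [liftMap_inl]
    have h1 : ContDiff ℝ (⊤ : ℕ∞) fun y : VS ι β => invSqrt c (‖y (.inl (i, false))‖ ^ 2) :=
      (contDiff_invSqrt hc).comp ((contDiff_coord _).norm_sq ℝ)
    exact (Complex.ofRealCLM.contDiff.comp h1).mul
      ((contDiff_coord _).mul (Complex.conjCLE.contDiff.comp (contDiff_coord _)))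
  · simp only [liftMap_inr]
    exact contDiff_coord _

theorem contDiff_znorm (i : ι) : ContDiff ℝ (⊤ : ℕ∞) (znorm i : VS ι β → ℝ) :=
  ((contDiff_coord _).norm_sq ℝ).add ((contDiff_coord _).norm_sq ℝ)

theorem contDiff_liftCut : ContDiff ℝ (⊤ : ℕ∞) (liftCut R c : VS ι β → ℝ) := by
  refine contDiff_prod fun i _ => ?_
  exact (contDiff_smoothStep.comp (contDiff_znorm i)).mul (Real.smoothTransition.contDiff.comp
    ((((contDiff_coord _).norm_sq ℝ).div_const _).sub contDiff_const))

theorem liftCut_nonneg (y : VS ι β) : 0 ≤ liftCut R c y :=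
  Finset.prod_nonneg fun i _ => mul_nonneg (smoothStep_nonneg _ _ _) (Real.smoothTransition.nonneg _)

theorem liftCut_le_one (y : VS ι β) : liftCut R c y ≤ 1 :=
  Finset.prod_le_one (fun i _ => mul_nonneg (smoothStep_nonneg _ _ _) (Real.smoothTransition.nonneg _))
    fun i _ => mul_le_one₀ (smoothStep_le_one _ _ _) (Real.smoothTransition.nonneg _) (Real.smoothTransition.le_one _)

theorem liftCut_eq_zero (hc : 0 < c) {y : VS ι β} {i : ι} (h : ‖y (.inl (i, false))‖ ^ 2 ≤ 2 * c) : liftCut R c y = 0 := by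
  refine Finset.prod_eq_zero (Finset.mem_univ i) ?_
  rw [Real.smoothTransition.zero_of_nonpos, mul_zero]
  rw [sub_nonpos, div_le_iff₀ hc]; exact h

theorem znorm_le_of_liftCut_ne_zero (hR : 0 < R) {y : VS ι β} (h : liftCut R c y ≠ 0) (i : ι) : znorm i y ≤ 3 * R := by
  by_contra! hh
  refine h (Finset.prod_eq_zero (Finset.mem_univ i) ?_)
  rw [smoothStep_eq_zero (by linarith) hh.le, zero_mul]

theorem liftCut_eq_one (hc : 0 < c) (hR : 0 < R) {y : VS ι β} (h : ∀ i, 3 * c ≤ ‖y (.inl (i, false))‖ ^ 2)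
    (h' : ∀ i, znorm i y ≤ 2 * R) : liftCut R c y = 1 := by
  refine Finset.prod_eq_one fun i _ => ?_
  rw [smoothStep_eq_one (by linarith) (h' i), Real.smoothTransition.one_of_one_le, one_mul]
  rw [le_sub_iff_add_le, le_div_iff₀ hc]; linarith [h i]

theorem norm_sq_liftMap_inl (hc : 0 < c) {y : VS ι β} {i : ι} (h : c ≤ ‖y (.inl (i, false))‖ ^ 2) :
    ‖liftMap e c y (e (.inl i))‖ ^ 2 = ‖y (.inl (i, true))‖ ^ 2 := by
  rw [liftMap_inl, invSqrt_eq hc h, Real.sqrt_sq (norm_nonneg _), norm_mul, norm_mul, RCLike.norm_conj, Complex.norm_real,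
    norm_inv, norm_norm]
  have : ‖y (.inl (i, false))‖ ≠ 0 := by
    intro h0
    rw [h0] at h; norm_num at h; linarith
  field_simp

theorem norm_rotV_coord {d : ι → ℂ} (hd : ∀ i, ‖d i‖ = 1) (y : VS ι β) (a : ι × Bool) : ‖rotV d y (.inl a)‖ = ‖y (.inl a)‖ := by
  simp [rotV, hd]

theorem liftCut_rotV {d : ι → ℂ} (hd : ∀ i, ‖d i‖ = 1) (y : VS ι β) : liftCut R c (rotV d y) = liftCut R c y := by
  simp only [liftCut, znorm, norm_rotV_coord hd]

theorem liftMap_rotV {d : ι → ℂ} (hd : ∀ i, ‖d i‖ = 1) (y : VS ι β) : liftMap e c (rotV d y) = liftMap e c y := by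
  ext j
  obtain ⟨k, rfl⟩ := e.surjective j
  rcases k with i | l
  · rw [liftMap_inl, liftMap_inl, norm_rotV_coord hd]
    congr 1
    simp only [rotV, Sum.elim_inl, map_mul]
    rw [mul_mul_mul_comm, Complex.mul_conj, Complex.normSq_eq_norm_sq, hd]
    simp
  · rw [liftMap_inr, liftMap_inr]; rfl

end Lift

section Poisson

variable {ι β : Type} [Fintype ι] [Fintype β] [DecidableEq ι] [DecidableEq β] {n : ℕ}
variable {e : ι ⊕ β ≃ Fin n} {c R : ℝ}

/-- Derivative of the quotient `z₁ z̄₀ / |z₀|`. -/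
def hopfDeriv (z₀ z₁ v₀ v₁ : ℂ) : ℂ :=
  ((‖z₀‖⁻¹ : ℝ) : ℂ) * (v₁ * (starRingEnd ℂ) z₀ + z₁ * (starRingEnd ℂ) v₀) -
    ((‖z₀‖⁻¹ ^ 3 * inner ℝ z₀ v₀ : ℝ) : ℂ) * (z₁ * (starRingEnd ℂ) z₀)

theorem hasDerivAt_invSqrt {s : ℝ} (hc : 0 < c) (hs : c < s) : HasDerivAt (invSqrt c) (-(1 / 2) * (√s)⁻¹ ^ 3) s := by
  have h1 : HasDerivAt (fun s => (√s)⁻¹) (-(1 / 2) * (√s)⁻¹ ^ 3) s := by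
    have hs0 : 0 < s := hc.trans hs
    refine ((Real.hasDerivAt_sqrt hs0.ne').inv (Real.sqrt_pos.2 hs0).ne').congr_deriv ?_
    field_simp
  refine h1.congr_of_eventuallyEq ?_
  filter_upwards [lt_mem_nhds hs] with x hx
  exact invSqrt_eq hc hx.le

theorem hasDerivAt_liftMap_inl (hc : 0 < c) {y v : VS ι β} {i : ι} (hy : c < ‖y (.inl (i, false))‖ ^ 2) :
    HasDerivAt (fun s : ℝ => liftMap e c (y + s • v) (e (.inl i)))
      (hopfDeriv (y (.inl (i, false))) (y (.inl (i, true))) (v (.inl (i, false))) (v (.inl (i, true)))) 0 := by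
  have hl : ∀ a, HasDerivAt (fun s : ℝ => (y + s • v) a) (v a) 0 := fun a => by
    have := ((hasDerivAt_id (0:ℝ)).smul_const (v a)).const_add (y a)
    simpa using this
  have h2 := (hl (.inl (i, false))).norm_sq
  have h3 : HasDerivAt (fun s : ℝ => invSqrt c (‖(y + s • v) (.inl (i, false))‖ ^ 2)) _ 0 :=
    HasDerivAt.comp (h₂ := invSqrt c) (0:ℝ) (hasDerivAt_invSqrt hc (by simpa using hy)) h2
  have h4 := h3.ofReal_comp.mul ((hl (.inl (i, true))).mul
    (Complex.conjCLE.hasFDerivAt.comp_hasDerivAt (0:ℝ) (hl (.inl (i, false)))))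
  have h5 := h4.congr_deriv (g' := hopfDeriv (y (.inl (i, false))) (y (.inl (i, true))) (v (.inl (i, false))) (v (.inl (i, true)))) ?_
  · refine h5.congr_of_eventuallyEq (Eventually.of_forall fun s => ?_)
    exact liftMap_inl _ _
  · simp only [zero_smul, add_zero, Function.comp_apply, Real.sqrt_sq (norm_nonneg _), invSqrt_eq hc hy.le, hopfDeriv,
      Complex.conjCLE_apply]
    push_cast
    simp only [Pi.mul_apply, Function.comp_apply, zero_smul, add_zero, Complex.conjCLE_apply]
    ring

theorem fderiv_liftMap_inl (hc : 0 < c) {y : VS ι β} (v : VS ι β) {i : ι} (hy : c < ‖y (.inl (i, false))‖ ^ 2) :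
    fderiv ℝ (liftMap e c) y v (e (.inl i)) =
      hopfDeriv (y (.inl (i, false))) (y (.inl (i, true))) (v (.inl (i, false))) (v (.inl (i, true))) := by
  have h1 : HasDerivAt (fun s : ℝ => y + s • v) v 0 := by
    simpa using ((hasDerivAt_id (0:ℝ)).smul_const v).const_add y
  have h2 := (((contDiff_liftMap (e := e) (ι := ι) (β := β) hc).differentiable (by simp)) (y + (0:ℝ) • v)).hasFDerivAt.comp_hasDerivAt (0:ℝ) h1
  have h3 := ((EuclideanSpace.proj (e (.inl i)) : CE n →L[ℂ] ℂ).restrictScalars ℝ).hasFDerivAt.comp_hasDerivAt (0:ℝ) h2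
  rw [zero_smul, add_zero] at h3
  exact h3.unique (hasDerivAt_liftMap_inl hc hy)

theorem fderiv_liftMap_inr (hc : 0 < c) (y v : VS ι β) (l : β) :
    fderiv ℝ (liftMap e c) y v (e (.inr l)) = v (.inr l) := by
  have h2 := (((contDiff_liftMap (e := e) (ι := ι) (β := β) hc).differentiable (by simp)) y).hasFDerivAt
  have h3 := ((EuclideanSpace.proj (e (.inr l)) : CE n →L[ℂ] ℂ).restrictScalars ℝ).hasFDerivAt.comp y h2
  have h4 : HasFDerivAt (fun y : VS ι β => y (.inr l)) ((EuclideanSpace.proj (.inr l) : VS ι β →L[ℂ] ℂ).restrictScalars ℝ) y :=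
    ((EuclideanSpace.proj (.inr l) : VS ι β →L[ℂ] ℂ).restrictScalars ℝ).hasFDerivAt
  have h5 := h4.congr_of_eventuallyEq (Eventually.of_forall fun y => (liftMap_inr (e := e) (c := c) y l))
  exact congrArg (fun L => L v) (h3.unique h5)

theorem real_inner_CE (e : ι ⊕ β ≃ Fin n) (x y : CE n) : inner ℝ x y =
    ∑ i, inner ℝ (x (e (.inl i))) (y (e (.inl i))) + ∑ l, inner ℝ (x (e (.inr l))) (y (e (.inr l))) := by
  rw [PiLp.inner_apply, ← e.sum_comp, Fintype.sum_sum_type]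

/-- Adjoint of `hopfDeriv` in the first variable. -/
def hopfAdj (z₀ z₁ w : ℂ) : ℂ :=
  ((‖z₀‖⁻¹ : ℝ) : ℂ) * (z₁ * (starRingEnd ℂ) w) - ((‖z₀‖⁻¹ ^ 3 * inner ℝ w (z₁ * (starRingEnd ℂ) z₀) : ℝ) : ℂ) * z₀

theorem inner_hopfDeriv (z₀ z₁ v₀ v₁ w : ℂ) : inner ℝ w (hopfDeriv z₀ z₁ v₀ v₁) =
    inner ℝ (hopfAdj z₀ z₁ w) v₀ + inner ℝ (((‖z₀‖⁻¹ : ℝ) : ℂ) * (z₀ * w)) v₁ := by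
  generalize hr : ‖z₀‖⁻¹ = r
  simp only [hopfDeriv, hopfAdj, hr, Complex.inner, Complex.mul_re, Complex.mul_im, Complex.sub_re, Complex.sub_im, Complex.add_re,
    Complex.add_im, Complex.ofReal_re, Complex.ofReal_im, Complex.conj_re, Complex.conj_im]
  ring

theorem hopfDeriv_adj {z₀ : ℂ} (h : z₀ ≠ 0) (z₁ w : ℂ) :
    hopfDeriv z₀ z₁ (-(Complex.I * hopfAdj z₀ z₁ w)) (-(Complex.I * (((‖z₀‖⁻¹ : ℝ) : ℂ) * (z₀ * w)))) = -(Complex.I * w) := by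
  have hr : ‖z₀‖⁻¹ ^ 2 * (z₀.re ^ 2 + z₀.im ^ 2) = 1 := by
    have h1 : z₀.re ^ 2 + z₀.im ^ 2 = ‖z₀‖ ^ 2 := by rw [Complex.sq_norm, Complex.normSq_apply]; ring
    have : ‖z₀‖ ≠ 0 := norm_ne_zero_iff.2 h
    rw [h1]; field_simp
  generalize hrd : ‖z₀‖⁻¹ = r at hr
  have key : hopfDeriv z₀ z₁ (-(Complex.I * hopfAdj z₀ z₁ w)) (-(Complex.I * ((r : ℂ) * (z₀ * w)))) - -(Complex.I * w) =
      ((1 - r ^ 2 * (z₀.re ^ 2 + z₀.im ^ 2) : ℝ) : ℂ) * (Complex.I * w +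
        r * z₁ * (starRingEnd ℂ) (-(Complex.I * hopfAdj z₀ z₁ w)) +
        r ^ 4 * (inner ℝ w (z₁ * (starRingEnd ℂ) z₀) : ℝ) * Complex.I * z₁ * (starRingEnd ℂ) z₀) := by
    simp only [hopfDeriv, hopfAdj, hrd, Complex.inner, ← Complex.ofReal_pow]
    apply Complex.ext <;>
      simp only [Complex.mul_re, Complex.mul_im, Complex.sub_re, Complex.sub_im, Complex.add_re, Complex.neg_re, Complex.neg_im,
        Complex.I_re, Complex.I_im,
        Complex.add_im, Complex.ofReal_re, Complex.ofReal_im, Complex.conj_re, Complex.conj_im] <;> ring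
  rw [hr, sub_self, Complex.ofReal_zero, zero_mul, sub_eq_zero] at key
  exact key

theorem gradient_comp_liftMap (hc : 0 < c) {u : CE n → ℝ} {y : VS ι β} (hu : DifferentiableAt ℝ u (liftMap e c y))
    (v : VS ι β) : inner ℝ (gradient (u ∘ liftMap e c) y) v = inner ℝ (gradient u (liftMap e c y)) (fderiv ℝ (liftMap e c) y v) := by
  have h2 := (((contDiff_liftMap (e := e) (ι := ι) (β := β) hc).differentiable (by simp)) y)
  rw [inner_gradient_left, inner_gradient_left, fderiv_comp y hu h2]
  rfl

/-- `liftMap` intertwines the Hamiltonian vector fields of a function and of its lift. -/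
theorem fderiv_liftMap_hamiltonian (hc : 0 < c) {u : CE n → ℝ} {y : VS ι β} (hu : DifferentiableAt ℝ u (liftMap e c y))
    (hy : ∀ i, c < ‖y (.inl (i, false))‖ ^ 2) :
    fderiv ℝ (liftMap e c) y (-(Complex.I • gradient (u ∘ liftMap e c) y)) = -(Complex.I • gradient u (liftMap e c y)) := by
  set w := gradient u (liftMap e c y) with hw
  have hV : gradient (u ∘ liftMap e c) y = WithLp.toLp 2 (Sum.elim (fun a : ι × Bool => if a.2 then
      ((‖y (.inl (a.1, false))‖⁻¹ : ℝ) : ℂ) * (y (.inl (a.1, false)) * w (e (.inl a.1)))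
      else hopfAdj (y (.inl (a.1, false))) (y (.inl (a.1, true))) (w (e (.inl a.1)))) fun l => w (e (.inr l))) := by
    refine ext_inner_right ℝ fun v => ?_
    rw [gradient_comp_liftMap hc hu, ← hw, real_inner_CE e, real_inner_VS, Fintype.sum_sum_type, Fintype.sum_prod_type]
    congr 1
    · refine Finset.sum_congr rfl fun i _ => ?_
      rw [fderiv_liftMap_inl hc v (hy i), inner_hopfDeriv]
      simp only [Fintype.sum_bool, Sum.elim_inl, if_true, Bool.false_eq_true, if_false]
      exact add_comm _ _
    · simp [fderiv_liftMap_inr hc]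
  rw [hV]
  ext j
  obtain ⟨k, rfl⟩ := e.surjective j
  rcases k with i | l
  · rw [fderiv_liftMap_inl hc _ (hy i)]
    have h0 : y (.inl (i, false)) ≠ 0 := by
      intro h; have := hy i; rw [h] at this; norm_num at this; linarith
    simpa using hopfDeriv_adj h0 (y (.inl (i, true))) (w (e (.inl i)))
  · rw [fderiv_liftMap_inr hc]
    simp

end Poisson

section Transport

variable {n : ℕ} {H : ℝ → CE n → ℝ} {φ : ℝ → CE n ≃ CE n}

theorem hamVF_eq_zero {t : ℝ} {z : CE n} (h : (t, z) ∉ tsupport (Function.uncurry H)) : hamVF H t z = 0 := by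
  have h1 : H t =ᶠ[nhds z] fun _ => 0 := by
    have h2 := (notMem_tsupport_iff_eventuallyEq.1 h)
    have h3 : Tendsto (fun z' : CE n => (t, z')) (nhds z) (nhds (t, z)) :=
      (Continuous.prodMk_right t).tendsto z
    exact h3.eventually h2
  have h2 : gradient (H t) z = 0 := by
    rw [gradient, h1.fderiv_eq]; simp
  rw [hamVF, h2, smul_zero]

theorem fderiv_symm_flow (hφ : IsHamFlow H φ) (t : ℝ) (z : CE n) :
    fderiv ℝ (fun p : ℝ × CE n => (φ p.1).symm p.2) (t, z) (1, hamVF H t z) = 0 := by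
  obtain ⟨x, rfl⟩ := (φ t).surjective z
  have h1 := (hφ.smooth_symm.differentiable (by simp) (t, φ t x)).hasFDerivAt.comp_hasDerivAt t
    ((hasDerivAt_id t).prodMk (hφ.isFlow t x))
  have h2 : ((fun p : ℝ × CE n => (φ p.1).symm p.2) ∘ fun s => (id s, φ s x)) = fun _ => x := by
    ext1 s; simp
  rw [h2] at h1
  exact h1.unique (hasDerivAt_const _ _)

theorem flow_symm_eq_self (hφ : IsHamFlow H φ) {z : CE n} (h : ∀ t, (t, z) ∉ tsupport (Function.uncurry H)) (t : ℝ) :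
    (φ t).symm z = z := by
  have h1 : ∀ s, HasDerivAt (fun s => (φ s).symm z) 0 s := fun s => by
    have h2 := (hφ.smooth_symm.differentiable (by simp) (s, z)).hasFDerivAt.comp_hasDerivAt s
      ((hasDerivAt_id s).prodMk (hasDerivAt_const s z))
    have h3 := fderiv_symm_flow hφ s z
    rw [hamVF_eq_zero (h s)] at h3
    rw [h3] at h2
    exact h2
  have h4 := is_const_of_deriv_eq_zero (fun s => (h1 s).differentiableAt) (fun s => (h1 s).deriv) t 0
  rw [h4, Equiv.symm_apply_eq, hφ.init]

theorem fderiv_transport (hφ : IsHamFlow H φ) {χ : CE n → ℝ} (hχ : ContDiff ℝ (⊤ : ℕ∞) χ) (t : ℝ) (z : CE n) :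
    fderiv ℝ (Function.uncurry fun t z => χ ((φ t).symm z)) (t, z) (1, hamVF H t z) = 0 := by
  have h := fderiv_comp (𝕜 := ℝ) (g := χ) (f := fun p : ℝ × CE n => (φ p.1).symm p.2) (t, z)
    (hχ.differentiable (by simp) _) (hφ.smooth_symm.differentiable (by simp) _)
  have h2 : (Function.uncurry fun t z => χ ((φ t).symm z)) = χ ∘ fun p : ℝ × CE n => (φ p.1).symm p.2 := rfl
  rw [h2, h, ContinuousLinearMap.comp_apply, fderiv_symm_flow hφ, map_zero]

variable {ι β : Type} [Fintype ι] [Fintype β] {e : ι ⊕ β ≃ Fin n}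

/-- Smooth cutoff for the product of a polydisk and a ball. -/
def cutD (e : ι ⊕ β ≃ Fin n) (c₁ S₃ S : ℝ) (z : CE n) : ℝ :=
  (∏ i, smoothStep c₁ 1 (Real.pi * ‖z (e (.inl i))‖ ^ 2)) * smoothStep S₃ S (Real.pi * ∑ l, ‖z (e (.inr l))‖ ^ 2)

theorem contDiff_coordCE (j : Fin n) : ContDiff ℝ (⊤ : ℕ∞) fun z : CE n => z j :=
  ((EuclideanSpace.proj j : CE n →L[ℂ] ℂ).restrictScalars ℝ).contDiff

theorem contDiff_cutD (c₁ S₃ S : ℝ) : ContDiff ℝ (⊤ : ℕ∞) (cutD e c₁ S₃ S) := by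
  refine (contDiff_prod fun i _ => ?_).mul ?_
  · exact contDiff_smoothStep.comp (contDiff_const.mul ((contDiff_coordCE _).norm_sq ℝ))
  · exact contDiff_smoothStep.comp (contDiff_const.mul (ContDiff.sum fun l _ => (contDiff_coordCE _).norm_sq ℝ))

theorem cutD_eq_one {c₁ S₃ S : ℝ} (hc : c₁ < 1) (hS : S₃ < S) {z : CE n} (h1 : ∀ i, Real.pi * ‖z (e (.inl i))‖ ^ 2 ≤ c₁)
    (h2 : Real.pi * ∑ l, ‖z (e (.inr l))‖ ^ 2 ≤ S₃) : cutD e c₁ S₃ S z = 1 := by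
  rw [cutD, Finset.prod_eq_one fun i _ => smoothStep_eq_one hc (h1 i), smoothStep_eq_one hS h2, one_mul]

theorem lt_of_cutD_ne_zero {c₁ S₃ S : ℝ} (hc : c₁ < 1) (hS : S₃ < S) {z : CE n} (h : cutD e c₁ S₃ S z ≠ 0) :
    (∀ i, Real.pi * ‖z (e (.inl i))‖ ^ 2 < 1) ∧ Real.pi * ∑ l, ‖z (e (.inr l))‖ ^ 2 < S := by
  constructor
  · intro i
    by_contra! hi
    exact h (by rw [cutD, Finset.prod_eq_zero (Finset.mem_univ i) (smoothStep_eq_zero hc hi), zero_mul])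
  · by_contra! hi
    exact h (by rw [cutD, smoothStep_eq_zero hS hi, mul_zero])

theorem norm_sq_CE (e : ι ⊕ β ≃ Fin n) (z : CE n) :
    ‖z‖ ^ 2 = ∑ i, ‖z (e (.inl i))‖ ^ 2 + ∑ l, ‖z (e (.inr l))‖ ^ 2 := by
  rw [EuclideanSpace.norm_sq_eq, ← e.sum_comp, Fintype.sum_sum_type]

/-- The support of a Hamiltonian in a cylinder is bounded and stays inside a smaller cylinder. -/
theorem exists_support_bound {a : ℝ} (hHs : HasCompactSupport (Function.uncurry H))
    (hsupp : ∀ t z, (t, z) ∈ tsupport (Function.uncurry H) → ∀ i, Real.pi * ‖z (e (.inl i))‖ ^ 2 < a) (ha : 1 < a) (S : ℝ) :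
    ∃ q r, 1 ≤ q ∧ q < a ∧ S / Real.pi + Fintype.card ι ≤ r ^ 2 ∧ 0 ≤ r ∧ ∀ t z, (t, z) ∈ tsupport (Function.uncurry H) →
      (∀ i, Real.pi * ‖z (e (.inl i))‖ ^ 2 ≤ q) ∧ ‖z‖ ≤ r := by
  have hK : IsCompact (tsupport (Function.uncurry H)) := hHs
  have h1 : ∀ i, ∃ q < a, ∀ t z, (t, z) ∈ tsupport (Function.uncurry H) → Real.pi * ‖z (e (.inl i))‖ ^ 2 ≤ q := by
    intro i
    rcases (tsupport (Function.uncurry H)).eq_empty_or_nonempty with h | h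
    · exact ⟨1, ha, by simp [h]⟩
    · have hc : Continuous fun p : ℝ × CE n => Real.pi * ‖p.2 (e (.inl i))‖ ^ 2 :=
        continuous_const.mul ((((contDiff_coordCE _).continuous.comp continuous_snd).norm).pow 2)
      obtain ⟨p, hp, hm⟩ := hK.exists_isMaxOn h hc.continuousOn
      exact ⟨_, hsupp p.1 p.2 hp i, fun t z hz => hm hz⟩
  choose q hqa hq using h1
  obtain ⟨r, hr⟩ := hK.isBounded.exists_norm_le
  have hfin : ∃ Q, 1 ≤ Q ∧ Q < a ∧ ∀ i, q i ≤ Q := by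
    have hne : (Finset.univ.image q ∪ {1}).Nonempty := Finset.Nonempty.inr (Finset.singleton_nonempty _)
    refine ⟨(Finset.univ.image q ∪ {1}).max' hne, Finset.le_max' _ _ (by simp), ?_, fun i => Finset.le_max' _ _ (by simp)⟩
    rw [Finset.max'_lt_iff]
    intro x hx
    simp only [Finset.mem_union, Finset.mem_image, Finset.mem_univ, true_and, Finset.mem_singleton] at hx
    rcases hx with ⟨i, rfl⟩ | rfl
    exacts [hqa i, ha]
  obtain ⟨Q, hQ1, hQa, hQ⟩ := hfin
  refine ⟨Q, max r (|S / Real.pi| + Fintype.card ι + 1), hQ1, hQa, ?_, ?_, fun t z hz => ⟨fun i => (hq i t z hz).trans (hQ i), ?_⟩⟩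
  · have h0 := le_abs_self (S / Real.pi)
    have h1 := abs_nonneg (S / Real.pi)
    have h2 : (0:ℝ) ≤ Fintype.card ι := by positivity
    have h3 := le_max_right r (|S / Real.pi| + Fintype.card ι + 1)
    nlinarith
  · exact le_trans (by positivity) (le_max_right _ _)
  · exact ((norm_snd_le (t, z)).trans (hr _ hz)).trans (le_max_left _ _)

theorem transport_support (hφ : IsHamFlow H φ) {c₁ S₃ S q r : ℝ} (hc : c₁ < 1) (hS : S₃ < S) (hq : 1 ≤ q)
    (hr : S / Real.pi + Fintype.card ι ≤ r ^ 2) (hr0 : 0 ≤ r)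
    (hb : ∀ t z, (t, z) ∈ tsupport (Function.uncurry H) → (∀ i, Real.pi * ‖z (e (.inl i))‖ ^ 2 ≤ q) ∧ ‖z‖ ≤ r)
    (t : ℝ) (z : CE n) (h : cutD e c₁ S₃ S ((φ t).symm z) ≠ 0) :
    (∀ i, Real.pi * ‖z (e (.inl i))‖ ^ 2 ≤ q) ∧ ‖z‖ ≤ r := by
  by_cases hz : ∃ t, (t, z) ∈ tsupport (Function.uncurry H)
  · obtain ⟨t', ht'⟩ := hz
    exact hb t' z ht'
  · push Not at hz
    rw [flow_symm_eq_self hφ hz] at h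
    obtain ⟨h1, h2⟩ := lt_of_cutD_ne_zero hc hS h
    refine ⟨fun i => (h1 i).le.trans hq, abs_le_of_sq_le_sq' ?_ hr0 |>.2⟩
    refine le_trans ?_ hr
    rw [norm_sq_CE e, add_comm]
    have hp := Real.pi_gt_three
    gcongr
    · rw [le_div_iff₀ (by positivity)]; linarith
    · rw [← Finset.card_univ, ← nsmul_one, ← Finset.sum_const]
      refine Finset.sum_le_sum fun i _ => ?_
      have := h1 i
      nlinarith [sq_nonneg ‖z (e (.inl i))‖]

end Transport

section SupCont

variable {E : Type*} [NormedAddCommGroup E] [Nonempty E]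

theorem bddAbove_of_compactSupport {f : ℝ → E → ℝ} (hf : Continuous (Function.uncurry f)) (hs : HasCompactSupport (Function.uncurry f))
    (t : ℝ) : BddAbove (range (f t)) := by
  obtain ⟨C, hC⟩ := hf.bounded_above_of_compact_support hs
  refine ⟨C, ?_⟩
  rintro _ ⟨x, rfl⟩
  exact (le_abs_self _).trans (hC (t, x))

theorem bddBelow_of_compactSupport {f : ℝ → E → ℝ} (hf : Continuous (Function.uncurry f)) (hs : HasCompactSupport (Function.uncurry f))
    (t : ℝ) : BddBelow (range (f t)) := by
  obtain ⟨C, hC⟩ := hf.bounded_above_of_compact_support hs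
  refine ⟨-C, ?_⟩
  rintro _ ⟨x, rfl⟩
  exact (abs_le.1 (hC (t, x))).1

theorem continuous_iSup_of_compactSupport {f : ℝ → E → ℝ} (hf : Continuous (Function.uncurry f))
    (hs : HasCompactSupport (Function.uncurry f)) : Continuous fun t => ⨆ x, f t x := by
  have hu := hs.uniformContinuous_of_continuous hf
  rw [Metric.continuous_iff]
  intro t ε hε
  obtain ⟨δ, hδ, h⟩ := Metric.uniformContinuous_iff.1 hu (ε / 2) (by linarith)
  refine ⟨δ, hδ, fun s hs' => ?_⟩
  have h1 : ∀ x, |f s x - f t x| < ε / 2 := fun x => by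
    have := @h (s, x) (t, x) (by rw [Prod.dist_eq]; simpa using hs')
    rwa [Real.dist_eq] at this
  have h2 : ⨆ x, f s x ≤ (⨆ x, f t x) + ε / 2 := ciSup_le fun x => by
    have := le_ciSup (bddAbove_of_compactSupport hf hs t) x
    linarith [(abs_lt.1 (h1 x)).2]
  have h3 : ⨆ x, f t x ≤ (⨆ x, f s x) + ε / 2 := ciSup_le fun x => by
    have := le_ciSup (bddAbove_of_compactSupport hf hs s) x
    linarith [(abs_lt.1 (h1 x)).1]
  rw [Real.dist_eq, abs_lt]
  constructor <;> linarith

theorem continuous_iInf_of_compactSupport {f : ℝ → E → ℝ} (hf : Continuous (Function.uncurry f))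
    (hs : HasCompactSupport (Function.uncurry f)) : Continuous fun t => ⨅ x, f t x := by
  have h1 : (fun t => ⨅ x, f t x) = fun t => -⨆ x, -f t x := by
    ext1 t
    rw [iInf, Real.sInf_def, iSup]
    congr 2
    ext r
    simp [neg_eq_iff_eq_neg]
  rw [h1]
  refine (continuous_iSup_of_compactSupport (f := fun t x => -f t x) hf.neg ?_).neg
  exact hs.neg

/-- In positive dimension a compactly supported function takes the value zero at each time. -/
theorem exists_eq_zero_of_compactSupport [NormedSpace ℝ E] [Nontrivial E] {f : ℝ → E → ℝ}
    (hs : HasCompactSupport (Function.uncurry f)) (t : ℝ) : ∃ x, f t x = 0 := by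
  obtain ⟨r, hr⟩ := (show IsCompact (tsupport (Function.uncurry f)) from hs).isBounded.exists_norm_le
  obtain ⟨x, hx⟩ := NormedSpace.exists_lt_norm ℝ E r
  refine ⟨x, ?_⟩
  by_contra h
  exact absurd ((norm_snd_le (t, x)).trans (hr (t, x) (subset_tsupport _ h))) (not_le.2 hx)

end SupCont

section LiftBound

variable {ι β : Type} [Fintype ι] [Fintype β] [DecidableEq ι] [DecidableEq β] {n : ℕ}
variable {e : ι ⊕ β ≃ Fin n} {c R δ q r ρ : ℝ}

/-- Affine reparametrisation sending `[1 - δ, 1]` to `[0, 1]`. -/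
def reparam (δ t : ℝ) : ℝ := δ⁻¹ * t - (δ⁻¹ - 1)

theorem reparam_one : reparam δ 1 = 1 := by unfold reparam; ring

theorem reparam_one_sub (hδ : 0 < δ) : reparam δ (1 - δ) = 0 := by
  unfold reparam; field_simp; simp

theorem reparam_mem_Ioo (hδ : 0 < δ) {t : ℝ} : reparam δ t ∈ Ioo (0:ℝ) 1 ↔ t ∈ Ioo (1 - δ) 1 := by
  have h : reparam δ t = (t - (1 - δ)) / δ := by unfold reparam; field_simp
  rw [mem_Ioo, mem_Ioo, h, div_lt_one hδ, lt_div_iff₀ hδ]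
  constructor <;> rintro ⟨h1, h2⟩ <;> constructor <;> linarith

theorem hasDerivAt_reparam (t : ℝ) : HasDerivAt (reparam δ) δ⁻¹ t :=
  (((hasDerivAt_id t).const_mul δ⁻¹).sub_const (δ⁻¹ - 1)).congr_deriv (mul_one _)

theorem contDiff_reparam : ContDiff ℝ (⊤ : ℕ∞) (reparam δ) := (contDiff_const.mul contDiff_id).sub contDiff_const

/-- Lift of a time-dependent function through `liftMap`, with time squeezed into `[1 - δ, 1]`. -/
def liftFun (e : ι ⊕ β ≃ Fin n) (R c δ : ℝ) (f : ℝ → CE n → ℝ) (t : ℝ) (y : VS ι β) : ℝ :=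
  liftCut R c y * f (reparam δ t) (liftMap e c y)

theorem contDiff_liftFun (hc : 0 < c) {f : ℝ → CE n → ℝ} (hf : ContDiff ℝ (⊤ : ℕ∞) (Function.uncurry f)) :
    ContDiff ℝ (⊤ : ℕ∞) (Function.uncurry (liftFun e R c δ f : ℝ → VS ι β → ℝ)) := by
  have h1 : ContDiff ℝ (⊤ : ℕ∞) fun p : ℝ × VS ι β => liftCut R c p.2 := contDiff_liftCut.comp contDiff_snd
  have h2 : ContDiff ℝ (⊤ : ℕ∞) fun p : ℝ × VS ι β => (reparam δ p.1, liftMap e c p.2) :=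
    (contDiff_reparam.comp contDiff_fst).prodMk ((contDiff_liftMap hc).comp contDiff_snd)
  exact h1.mul (hf.comp h2)

theorem liftFun_rotV {f : ℝ → CE n → ℝ} {d : ι → ℂ} (hd : ∀ i, ‖d i‖ = 1) (t : ℝ) (y : VS ι β) :
    liftFun e R c δ f t (rotV d y) = liftFun e R c δ f t y := by
  simp only [liftFun, liftCut_rotV hd, liftMap_rotV hd]

theorem norm_sq_le_of_liftFun_ne_zero (hR : 0 < R) {f : ℝ → CE n → ℝ} (hf : ∀ t z, f t z ≠ 0 → ‖z‖ ≤ r)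
    {t : ℝ} {y : VS ι β} (h : liftFun e R c δ f t y ≠ 0) : ‖y‖ ^ 2 ≤ Fintype.card ι * (3 * R) + r ^ 2 := by
  have h1 := znorm_le_of_liftCut_ne_zero hR (left_ne_zero_of_mul h)
  have h2 := hf _ _ (right_ne_zero_of_mul h)
  have h3 : wnorm y ≤ ‖liftMap e c y‖ ^ 2 := by
    rw [norm_sq_CE e]
    simp only [liftMap_inr]
    have : 0 ≤ ∑ i, ‖liftMap e c y (e (.inl i))‖ ^ 2 := by positivity
    rw [wnorm]; linarith
  have h4 : ‖liftMap e c y‖ ^ 2 ≤ r ^ 2 := by gcongr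
  have h5 : ∑ i, znorm i y ≤ Fintype.card ι * (3 * R) := by
    rw [← Finset.card_univ, ← nsmul_eq_mul, ← Finset.sum_const]
    exact Finset.sum_le_sum fun i _ => h1 i
  rw [norm_sq_VS]; linarith

/-- The ball containing the support of every lifted function. -/
theorem norm_le_of_liftFun_ne_zero (hR : 0 < R) {f : ℝ → CE n → ℝ} (hf : ∀ t z, f t z ≠ 0 → ‖z‖ ≤ r)
    {t : ℝ} {y : VS ι β} (h : liftFun e R c δ f t y ≠ 0) : ‖y‖ ≤ √(Fintype.card ι * (3 * R) + r ^ 2) :=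
  Real.le_sqrt_of_sq_le (norm_sq_le_of_liftFun_ne_zero hR hf h)

theorem hasCompactSupport_liftFun (hR : 0 < R) (hδ : 0 < δ) {f : ℝ → CE n → ℝ} (hf : ∀ t z, f t z ≠ 0 → ‖z‖ ≤ r)
    (hft : ∀ t z, t ∉ Ioo (0:ℝ) 1 → f t z = 0) :
    HasCompactSupport (Function.uncurry (liftFun e R c δ f : ℝ → VS ι β → ℝ)) := by
  refine HasCompactSupport.intro ((isCompact_Icc (a := 1 - δ) (b := 1)).prod
    (isCompact_closedBall (0 : VS ι β) (√(Fintype.card ι * (3 * R) + r ^ 2)))) fun p hp => ?_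
  by_contra h
  refine hp ⟨?_, ?_⟩
  · by_contra ht
    have : reparam δ p.1 ∉ Ioo (0:ℝ) 1 := fun h' => ht (Ioo_subset_Icc_self ((reparam_mem_Ioo hδ).1 h'))
    exact h (by show _ * _ = _; rw [hft _ _ this, mul_zero])
  · rw [mem_closedBall_zero_iff]
    exact norm_le_of_liftFun_ne_zero hR hf h

theorem exists_fderiv_liftFun_bound (hc : 0 < c) (hR : 0 < R) {f : ℝ → CE n → ℝ} (hfs : ContDiff ℝ (⊤ : ℕ∞) (Function.uncurry f))
    (hf : ∀ t z, f t z ≠ 0 → ‖z‖ ≤ r) : ∃ M, 0 ≤ M ∧ ∀ t ∈ Icc (1 - δ) 1, ∀ y v : VS ι β,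
      |fderiv ℝ (Function.uncurry (liftFun e R c δ f)) (t, y) (0, v)| ≤ M * ‖v‖ := by
  set B := √(Fintype.card ι * (3 * R) + r ^ 2) with hB
  have hcont : Continuous fun p => fderiv ℝ (Function.uncurry (liftFun e R c δ f : ℝ → VS ι β → ℝ)) p :=
    (contDiff_liftFun hc hfs).continuous_fderiv (by simp)
  obtain ⟨M, hM⟩ := ((isCompact_Icc (a := 1 - δ) (b := 1)).prod
    (isCompact_closedBall (0 : VS ι β) B)).exists_bound_of_continuousOn hcont.continuousOn
  refine ⟨|M|, abs_nonneg M, fun t ht y v => ?_⟩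
  by_cases hy : ‖y‖ ≤ B
  · have h1 := hM (t, y) ⟨ht, mem_closedBall_zero_iff.2 hy⟩
    have h2 := (fderiv ℝ (Function.uncurry (liftFun e R c δ f)) (t, y)).le_opNorm (0, v)
    have h3 : ‖((0:ℝ), v)‖ = ‖v‖ := by rw [Prod.norm_def]; simp
    rw [h3, Real.norm_eq_abs] at h2
    refine h2.trans ?_
    gcongr
    exact h1.trans (le_abs_self M)
  · have h1 : Function.uncurry (liftFun e R c δ f) =ᶠ[nhds (t, y)] fun _ => 0 := by
      have : ∀ᶠ p : ℝ × VS ι β in nhds (t, y), B < ‖p.2‖ :=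
        (continuous_snd.norm.tendsto (t, y)).eventually (lt_mem_nhds (not_le.1 hy))
      filter_upwards [this] with p hp
      by_contra h
      exact absurd (norm_le_of_liftFun_ne_zero hR hf h) (not_le.2 hp)
    rw [h1.fderiv_eq]
    simp
    positivity

theorem fderiv_liftFun_transport (hc : 0 < c) (hR : 0 < R) (hρ : ρ < R) (hq : q < Real.pi * (R - ρ - 3 * c))
    {H g : ℝ → CE n → ℝ} (hH : ContDiff ℝ (⊤ : ℕ∞) (Function.uncurry H)) (hg : ContDiff ℝ (⊤ : ℕ∞) (Function.uncurry g))
    (htr : ∀ t z, fderiv ℝ (Function.uncurry g) (t, z) (1, hamVF H t z) = 0)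
    (hgq : ∀ t z, g t z ≠ 0 → ∀ i, Real.pi * ‖z (e (.inl i))‖ ^ 2 ≤ q) (t : ℝ) (y : VS ι β) (hy : ∀ i, |znorm i y - R| ≤ ρ) :
    fderiv ℝ (Function.uncurry (liftFun e R c δ g)) (t, y)
      (1, -(Complex.I • gradient (liftFun e R c δ (fun t z => δ⁻¹ * H t z) t) y)) = 0 := by
  have hpi := Real.pi_pos
  have hcz : ∀ i, Continuous fun y : VS ι β => ‖y (.inl (i, false))‖ ^ 2 := fun i =>
    ((contDiff_coord _).continuous.norm).pow 2
  by_cases hA : ∀ i, 3 * c < ‖y (.inl (i, false))‖ ^ 2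
  · have hcut : ∀ᶠ y' in nhds y, liftCut R c y' = 1 := by
      have h1 : ∀ᶠ y' in nhds y, ∀ i, 3 * c < ‖y' (.inl (i, false))‖ ^ 2 :=
        eventually_all.2 fun i => ((hcz i).tendsto y).eventually (lt_mem_nhds (hA i))
      have h2 : ∀ᶠ y' in nhds y, ∀ i, znorm i y' < 2 * R :=
        eventually_all.2 fun i => ((contDiff_znorm i).continuous.tendsto y).eventually
          (gt_mem_nhds (by linarith [(abs_le.1 (hy i)).2]))
      filter_upwards [h1, h2] with y' h3 h4
      exact liftCut_eq_one hc hR (fun i => (h3 i).le) fun i => (h4 i).le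
    set τ := reparam δ t with hτ
    have hu : DifferentiableAt ℝ (fun z => δ⁻¹ * H τ z) (liftMap e c y) := by
      have h1 : Differentiable ℝ (H τ) := fun z => (hH.differentiable (by simp) (τ, z)).comp z
        ((differentiableAt_const τ).prodMk differentiableAt_id)
      exact (h1 _).const_mul _
    have hgrad : gradient (liftFun e R c δ (fun t z => δ⁻¹ * H t z) t) y = gradient ((fun z => δ⁻¹ * H τ z) ∘ liftMap e c) y := by
      have : liftFun e R c δ (fun t z => δ⁻¹ * H t z) t =ᶠ[nhds y] (fun z => δ⁻¹ * H τ z) ∘ liftMap e c := by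
        filter_upwards [hcut] with y' hy'
        simp only [liftFun, hy', one_mul, Function.comp_apply, hτ]
      rw [gradient, gradient, this.fderiv_eq]
    have hG : Function.uncurry (liftFun e R c δ g) =ᶠ[nhds (t, y)]
        Function.uncurry g ∘ fun p : ℝ × VS ι β => (reparam δ p.1, liftMap e c p.2) := by
      filter_upwards [(continuous_snd.tendsto (t, y)).eventually hcut] with p hp
      simp only [Function.uncurry, liftFun, hp, one_mul, Function.comp_apply]
    have hd1 : HasFDerivAt (fun p : ℝ × VS ι β => reparam δ p.1)
        ((ContinuousLinearMap.toSpanSingleton ℝ δ⁻¹).comp (ContinuousLinearMap.fst ℝ ℝ (VS ι β))) (t, y) :=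
      HasFDerivAt.comp (g := reparam δ) (t, y) (hasDerivAt_reparam t).hasFDerivAt hasFDerivAt_fst
    have hd2 : HasFDerivAt (fun p : ℝ × VS ι β => liftMap e c p.2)
        ((fderiv ℝ (liftMap e c) y).comp (ContinuousLinearMap.snd ℝ ℝ (VS ι β))) (t, y) :=
      HasFDerivAt.comp (g := liftMap e c) (t, y) ((contDiff_liftMap hc).differentiable (by simp) y).hasFDerivAt hasFDerivAt_snd
    have hd := HasFDerivAt.comp (g := Function.uncurry g) (t, y)
      (hg.differentiable (by simp) (reparam δ t, liftMap e c y)).hasFDerivAt (hd1.prodMk hd2)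
    rw [hgrad, (hd.congr_of_eventuallyEq hG).fderiv]
    have hham : -(Complex.I • gradient (fun z => δ⁻¹ * H τ z) (liftMap e c y)) = δ⁻¹ • hamVF H τ (liftMap e c y) := by
      have h1 : DifferentiableAt ℝ (H τ) (liftMap e c y) := (hH.differentiable (by simp) (τ, _)).comp _
        ((differentiableAt_const τ).prodMk differentiableAt_id)
      have h2 : gradient (fun z => δ⁻¹ * H τ z) (liftMap e c y) = δ⁻¹ • gradient (H τ) (liftMap e c y) := by
        rw [gradient, fderiv_const_mul h1, gradient, map_smulₛₗ]
        simp
      rw [h2, hamVF, neg_smul, smul_neg, smul_comm]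
    have hP := fderiv_liftMap_hamiltonian hc hu fun i => by linarith [hA i]
    rw [hham] at hP
    have h3 : ((((ContinuousLinearMap.toSpanSingleton ℝ δ⁻¹).comp (ContinuousLinearMap.fst ℝ ℝ (VS ι β))).prod
        ((fderiv ℝ (liftMap e c) y).comp (ContinuousLinearMap.snd ℝ ℝ (VS ι β)))) :
        ℝ × VS ι β →L[ℝ] ℝ × CE n) (1, -(Complex.I • gradient ((fun z => δ⁻¹ * H τ z) ∘ liftMap e c) y)) =
        δ⁻¹ • ((1:ℝ), hamVF H τ (liftMap e c y)) := by
      refine Prod.ext ?_ hP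
      simp
    refine (congrArg (fderiv ℝ (Function.uncurry g) (reparam δ t, liftMap e c y)) h3).trans ?_
    rw [map_smul, htr, smul_zero]
  · push Not at hA
    obtain ⟨i, hi⟩ := hA
    have hz : Function.uncurry (liftFun e R c δ g) =ᶠ[nhds (t, y)] fun _ => 0 := by
      have h1 : ∀ᶠ y' in nhds y, liftCut R c y' = 0 ∨ ∀ t', g t' (liftMap e c y') = 0 := by
        rcases lt_or_ge (‖y (.inl (i, false))‖ ^ 2) (2 * c) with h | h
        · filter_upwards [((hcz i).tendsto y).eventually (gt_mem_nhds h)] with y' hy'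
          exact Or.inl (liftCut_eq_zero hc hy'.le)
        · have h2 : q < Real.pi * ‖y (.inl (i, true))‖ ^ 2 := by
            refine hq.trans_le ?_
            gcongr
            have := (abs_le.1 (hy i)).1
            unfold znorm at this
            linarith
          have h3 : Continuous fun y : VS ι β => Real.pi * ‖y (.inl (i, true))‖ ^ 2 :=
            continuous_const.mul (((contDiff_coord _).continuous.norm).pow 2)
          filter_upwards [((hcz i).tendsto y).eventually (lt_mem_nhds (show c < _ by linarith)),
            (h3.tendsto y).eventually (lt_mem_nhds h2)] with y' h4 h5
          refine Or.inr fun t' => ?_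
          by_contra h6
          have h7 := hgq _ _ h6 i
          rw [norm_sq_liftMap_inl hc h4.le] at h7
          linarith
      filter_upwards [(continuous_snd.tendsto (t, y)).eventually h1] with p hp
      rcases hp with hp | hp
      · simp only [Function.uncurry, liftFun, hp, zero_mul]
      · simp only [Function.uncurry, liftFun, hp, mul_zero]
    rw [hz.fderiv_eq]; simp

/-- Action bound for Hamiltonians on the cylinder that move the sublevel set of a transported function off itself. -/
theorem hofer_bound_of_transport [Nonempty ι] {a c₁ S' S'' S₃ : ℝ} (hδ : 0 < δ) (hδ3 : 3 * δ ≤ 1) (ha : 0 < a)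
    (hS'0 : 0 ≤ S') (hS : S' < S'') (hS3 : S'' < S₃) (hac : a / 2 < c₁) (hqa : q < a)
    {H g : ℝ → CE n → ℝ} (hH : ContDiff ℝ (⊤ : ℕ∞) (Function.uncurry H)) (hHs : HasCompactSupport (Function.uncurry H))
    (hg : ContDiff ℝ (⊤ : ℕ∞) (Function.uncurry g)) (hHt : ∀ t z, t ∉ Ioo (0:ℝ) 1 → H t z = 0)
    (htr : ∀ t z, fderiv ℝ (Function.uncurry g) (t, z) (1, hamVF H t z) = 0)
    (hHr : ∀ t z, H t z ≠ 0 → ‖z‖ ≤ r)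
    (hgb : ∀ t z, g t z ≠ 0 → (∀ i, Real.pi * ‖z (e (.inl i))‖ ^ 2 ≤ q) ∧ ‖z‖ ≤ r)
    (hg0 : ∀ z, (∀ i, Real.pi * ‖z (e (.inl i))‖ ^ 2 ≤ c₁) → Real.pi * ∑ l, ‖z (e (.inr l))‖ ^ 2 ≤ S₃ → g 0 z = 1)
    (hg1 : ∀ z, (∀ i, Real.pi * ‖z (e (.inl i))‖ ^ 2 ≤ c₁) → Real.pi * ∑ l, ‖z (e (.inr l))‖ ^ 2 ≤ S₃ → g 1 z = 0) :
    S' * (1 - 3 * δ) ≤ ∫ t in (0:ℝ)..1, ((⨆ x : CE n, H t x) - ⨅ x : CE n, H t x) := by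
  have hpi := Real.pi_pos
  set R := a / Real.pi with hRd
  have hR : 0 < R := by positivity
  have hRa : Real.pi * R = a := by rw [hRd]; field_simp
  obtain ⟨c, hc, hc1, hc2, hc3⟩ : ∃ c, 0 < c ∧ c ≤ R / 8 ∧ Real.pi * c ≤ c₁ - a / 2 ∧ Real.pi * c ≤ (a - q) / 5 := by
    refine ⟨min (R / 8) (min ((c₁ - a / 2) / Real.pi) ((a - q) / 5 / Real.pi)), ?_, min_le_left _ _, ?_, ?_⟩
    · have h1 : 0 < c₁ - a / 2 := by linarith
      have h2 : 0 < a - q := by linarith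
      positivity
    · rw [mul_comm, ← le_div_iff₀ hpi]; exact (min_le_right _ _).trans (min_le_left _ _)
    · rw [mul_comm, ← le_div_iff₀ hpi]; exact (min_le_right _ _).trans (min_le_right _ _)
  have : Nontrivial (CE n) := by
    obtain ⟨i⟩ := ‹Nonempty ι›
    have : Nonempty (Fin n) := ⟨e (.inl i)⟩
    infer_instance
  have hHc := hH.continuous
  obtain ⟨M, hM0, hM⟩ := exists_fderiv_liftFun_bound (ι := ι) (β := β) (e := e) (δ := δ) hc hR hg fun t z h => (hgb t z h).2
  have hδH : ContDiff ℝ (⊤ : ℕ∞) (Function.uncurry fun t z => δ⁻¹ * H t z) := contDiff_const.mul hH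
  have hp : ∀ y : VS ι β, (∀ b : ι × Bool, |‖y (.inl b)‖ ^ 2 - R / 2| ≤ c) → liftCut R c y = 1 ∧
      (∀ i, Real.pi * ‖liftMap e c y (e (.inl i))‖ ^ 2 ≤ c₁) ∧ ∑ l, ‖liftMap e c y (e (.inr l))‖ ^ 2 = wnorm y := by
    intro y hy
    have h1 := fun b => abs_le.1 (hy b)
    refine ⟨liftCut_eq_one hc hR (fun i => by linarith [(h1 (i, false)).1]) fun i => ?_, fun i => ?_, ?_⟩
    · rw [znorm]; linarith [(h1 (i, false)).2, (h1 (i, true)).2]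
    · rw [norm_sq_liftMap_inl hc (by linarith [(h1 (i, false)).1])]
      have h2 := mul_le_mul_of_nonneg_left (h1 (i, true)).2 hpi.le
      linarith
    · simp only [liftMap_inr, wnorm]
  have hsup := continuous_iSup_of_compactSupport hHc hHs
  have hinf := continuous_iInf_of_compactSupport hHc hHs
  have hτ : Continuous (reparam δ) := contDiff_reparam.continuous
  have hz0 : ∀ t, (⨅ x, H t x) ≤ 0 ∧ 0 ≤ ⨆ x, H t x := fun t => by
    obtain ⟨x, hx⟩ := exists_eq_zero_of_compactSupport hHs t
    exact ⟨hx ▸ ciInf_le (bddBelow_of_compactSupport hHc hHs t) x, hx ▸ le_ciSup (bddAbove_of_compactSupport hHc hHs t) x⟩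
  have key := action_bound (ι := ι) (β := β) (h := liftFun e R c δ fun t z => δ⁻¹ * H t z) (G := liftFun e R c δ g)
    (L := fun t => δ⁻¹ * ⨅ x, H (reparam δ t) x) (U := fun t => δ⁻¹ * ⨆ x, H (reparam δ t) x)
    hR hS'0 hS hS3 hδ hδ3 hc hM0 (contDiff_liftFun hc hδH)
    (hasCompactSupport_liftFun hR hδ (r := r) (fun t z h => hHr t z (right_ne_zero_of_mul h)) fun t z ht => by rw [hHt t z ht, mul_zero])
    (fun t y ht => by
      rw [liftFun, hHt _ _ fun h' => ht ((reparam_mem_Ioo hδ).1 h'), mul_zero, mul_zero])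
    (fun t y d hd => liftFun_rotV hd t y) ((contDiff_liftFun hc hg).of_le (by simp)) hM
    (fun t y d hd => liftFun_rotV hd t y)
    (fun t _ y hy => fderiv_liftFun_transport hc hR (by linarith) (by nlinarith) hH hg htr (fun t z h => (hgb t z h).1) t y hy)
    (fun y hy hw => by
      obtain ⟨h1, h2, h3⟩ := hp y hy
      rw [liftFun, h1, one_mul, reparam_one_sub hδ, hg0 _ h2 (by rwa [h3])])
    (fun y hy hw => by
      obtain ⟨h1, h2, h3⟩ := hp y hy
      rw [liftFun, reparam_one, hg1 _ h2 (by rwa [h3]), mul_zero])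
    (continuous_const.mul (hinf.comp hτ)) (continuous_const.mul (hsup.comp hτ))
    (fun t _ y => by
      have h1 := ciInf_le (bddBelow_of_compactSupport hHc hHs (reparam δ t)) (liftMap e c y)
      have h2 := (hz0 (reparam δ t)).1
      have h3 := liftCut_nonneg (R := R) (c := c) y
      have h4 := liftCut_le_one (R := R) (c := c) y
      rw [liftFun, mul_left_comm]
      gcongr
      nlinarith)
    (fun t _ y => by
      have h1 := le_ciSup (bddAbove_of_compactSupport hHc hHs (reparam δ t)) (liftMap e c y)
      have h2 := (hz0 (reparam δ t)).2
      have h3 := liftCut_nonneg (R := R) (c := c) y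
      have h4 := liftCut_le_one (R := R) (c := c) y
      rw [liftFun, mul_left_comm]
      gcongr
      nlinarith)
  refine key.trans_eq ?_
  have hUc : Continuous fun t => δ⁻¹ * ⨆ x, H (reparam δ t) x := continuous_const.mul (hsup.comp hτ)
  have hLc : Continuous fun t => δ⁻¹ * ⨅ x, H (reparam δ t) x := continuous_const.mul (hinf.comp hτ)
  set w : ℝ → ℝ := fun t => (⨆ x, H t x) - ⨅ x, H t x with hw
  have hwc : Continuous w := hsup.sub hinf
  rw [← intervalIntegral.integral_sub (hUc.intervalIntegrable _ _) (hLc.intervalIntegrable _ _)]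
  have h1 : ∀ t, (δ⁻¹ * ⨆ x, H (reparam δ t) x) - (δ⁻¹ * ⨅ x, H (reparam δ t) x) = δ⁻¹ * w (δ⁻¹ * t - (δ⁻¹ - 1)) := fun t => by
    rw [hw, mul_sub]; rfl
  have h2 : (∫ t in (0:ℝ)..1, δ⁻¹ * w (δ⁻¹ * t - (δ⁻¹ - 1))) = ∫ t in (1 - δ⁻¹)..1, w t := by
    rw [intervalIntegral.integral_const_mul, intervalIntegral.integral_comp_mul_sub w (inv_ne_zero hδ.ne'), smul_eq_mul,
      ← mul_assoc, mul_inv_cancel₀ (inv_ne_zero hδ.ne'), one_mul]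
    congr 1 <;> ring
  have h3 : ∫ t in (1 - δ⁻¹)..0, w t = 0 := by
    have hle : 1 - δ⁻¹ ≤ 0 := by
      rw [sub_nonpos]; exact (one_le_inv₀ hδ).2 (by linarith)
    rw [intervalIntegral.integral_congr (g := fun _ => 0), intervalIntegral.integral_zero]
    intro t ht
    rw [uIcc_of_le hle] at ht
    have : ∀ x, H t x = 0 := fun x => hHt t x fun h => absurd h.1 (not_lt.2 ht.2)
    simp [hw, this]
  simp only [h1]
  rw [h2, ← intervalIntegral.integral_add_adjacent_intervals (hwc.intervalIntegrable (1 - δ⁻¹) 0) (hwc.intervalIntegrable 0 1), h3, zero_add]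

end LiftBound

theorem eq_zero_of_notMem_Ioo {n : ℕ} {H : ℝ → CE n → ℝ} (hH : Continuous (Function.uncurry H))
    (hsupp : ∀ t z, (t, z) ∈ tsupport (Function.uncurry H) → t ∈ Icc (0:ℝ) 1) (t : ℝ) (z : CE n) (ht : t ∉ Ioo (0:ℝ) 1) :
    H t z = 0 := by
  have h1 : EqOn (fun s => H s z) (fun _ => 0) (Icc (0:ℝ) 1)ᶜ := fun s hs =>
    image_eq_zero_of_notMem_tsupport (f := Function.uncurry H) (x := (s, z)) fun h => hs (hsupp s z h)
  have h2 := h1.closure (hH.comp (Continuous.prodMk_left z)) continuous_const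
  rw [closure_compl, interior_Icc] at h2
  exact h2 ht

end DispEnergy

/-- Theorem 1.3: the displacement energy of
`D²(1)^{n−k} × B^{2k}(kS)` inside the cylinder `Z_{n−k,k}(1+ε) = D²(1+ε)^{n−k} × ℂᵏ`
is at least `S`: every compactly supported Hamiltonian `H` on `[0,1] × Z` whose
time-one map displaces `D` from its closure has Hofer norm `‖H‖ ≥ S`.
The first `n−k` coordinates lie in the disk factors and the last `k` coordinates
form the ball factor. -/
theorem displacement_energy_polydisk_ball {n k : ℕ} (hn : 2 ≤ n)
    (hk1 : 1 ≤ k) (hkn : k < n) (S ε : ℝ)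
    (hS : 1 < S) (hε0 : 0 < ε) (hε1 : ε < 1)
    (D Z : Set (CE n))
    (hD : D = {z : CE n |
      (∀ j : Fin n, (j : ℕ) < n - k → Real.pi * ‖z j‖ ^ 2 < 1) ∧
      Real.pi * (∑ j ∈ Finset.univ.filter (fun j : Fin n => n - k ≤ (j : ℕ)), ‖z j‖ ^ 2)
        < (k : ℝ) * S})
    (hZ : Z = {z : CE n | ∀ j : Fin n, (j : ℕ) < n - k → Real.pi * ‖z j‖ ^ 2 < 1 + ε})
    (H : ℝ → CE n → ℝ) (φ : ℝ → CE n ≃ CE n)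
    (hHsmooth : ContDiff ℝ (⊤ : ℕ∞) (Function.uncurry H))
    (hHsupp : HasCompactSupport (Function.uncurry H))
    (hsupp : tsupport (Function.uncurry H) ⊆ Set.Icc (0:ℝ) 1 ×ˢ Z)
    (hφ : IsHamFlow H φ)
    (hdisp : (fun x => φ 1 x) '' D ∩ closure D = ∅) :
    S ≤ ∫ t in (0:ℝ)..1, ((⨆ x : CE n, H t x) - ⨅ x : CE n, H t x) := by
  subst hD hZ
  set D : Set (CE n) := {z : CE n |
      (∀ j : Fin n, (j : ℕ) < n - k → Real.pi * ‖z j‖ ^ 2 < 1) ∧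
      Real.pi * (∑ j ∈ Finset.univ.filter (fun j : Fin n => n - k ≤ (j : ℕ)), ‖z j‖ ^ 2)
        < (k : ℝ) * S} with hD
  let e : {j : Fin n // (j : ℕ) < n - k} ⊕ {j : Fin n // ¬ (j : ℕ) < n - k} ≃ Fin n :=
    Equiv.sumCompl fun j : Fin n => (j : ℕ) < n - k
  have he1 : ∀ i, e (.inl i) = i := fun i => Equiv.sumCompl_apply_inl i
  have he2 : ∀ l, e (.inr l) = l := fun l => Equiv.sumCompl_apply_inr l
  have : Nonempty {j : Fin n // (j : ℕ) < n - k} := ⟨⟨⟨0, by omega⟩, by simp; omega⟩⟩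
  have hk : S ≤ k * S := by
    have : (1:ℝ) ≤ k := by exact_mod_cast hk1
    nlinarith
  have hmemD : ∀ z : CE n, (∀ i, Real.pi * ‖z (e (.inl i))‖ ^ 2 < 1) → Real.pi * ∑ l, ‖z (e (.inr l))‖ ^ 2 < S → z ∈ D := by
    intro z h1 h2
    refine ⟨fun j hj => by simpa [he1] using h1 ⟨j, hj⟩, ?_⟩
    rw [Finset.sum_subtype (p := fun j : Fin n => ¬ (j : ℕ) < n - k) _ (fun j => by simp) fun j => ‖z j‖ ^ 2]
    simp only [he2] at h2
    exact h2.trans_le hk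
  obtain ⟨q, r, hq1, hqa, hr, hr0, hb⟩ := DispEnergy.exists_support_bound (e := e) (a := 1 + ε) hHsupp
    (fun t z h i => by rw [he1]; exact (hsupp h).2 i i.2) (by linarith) S
  have hHt := DispEnergy.eq_zero_of_notMem_Ioo hHsmooth.continuous fun t z h => (hsupp h).1
  by_contra! hlt
  set N := ∫ t in (0:ℝ)..1, ((⨆ x : CE n, H t x) - ⨅ x : CE n, H t x) with hN
  obtain ⟨S', hS'1, hS'2⟩ := exists_between (max_lt hlt (show 0 < S by linarith))
  have hS'N : N < S' := (le_max_left _ _).trans_lt hS'1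
  have hS'0 : 0 < S' := (le_max_right _ _).trans_lt hS'1
  obtain ⟨S₃, hS₃1, hS₃2⟩ := exists_between hS'2
  obtain ⟨S'', hS''1, hS''2⟩ := exists_between hS₃1
  obtain ⟨c₁, hc₁1, hc₁2⟩ := exists_between (show (1 + ε) / 2 < 1 by linarith)
  obtain ⟨δ, hδ, hδ1⟩ := exists_between (show 0 < min (1 / 3) ((S' - N) / (3 * S')) from
    lt_min (by norm_num) (div_pos (by linarith) (by linarith)))
  have hδ3 : 3 * δ ≤ 1 := by linarith [hδ1.trans_le (min_le_left _ _)]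
  have hδN : N < S' * (1 - 3 * δ) := by
    have := hδ1.trans_le (min_le_right _ _)
    rw [lt_div_iff₀ (by linarith)] at this
    linarith
  refine absurd (DispEnergy.hofer_bound_of_transport (e := e) (r := r) (g := fun t z => DispEnergy.cutD e c₁ S₃ S ((φ t).symm z))
    hδ hδ3 (by linarith) hS'0.le hS''1 hS''2 hc₁1 hqa hHsmooth hHsupp
    ((DispEnergy.contDiff_cutD c₁ S₃ S).comp hφ.smooth_symm) hHt
    (DispEnergy.fderiv_transport hφ (DispEnergy.contDiff_cutD c₁ S₃ S))
    (fun t z h => (hb t z (subset_tsupport _ h)).2)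
    (DispEnergy.transport_support hφ hc₁2 hS₃2 hq1 hr hr0 hb) ?_ ?_) (not_le.2 hδN)
  · intro z h1 h2
    have h0 : (φ 0).symm z = z := by rw [Equiv.symm_apply_eq, hφ.init]
    show DispEnergy.cutD e c₁ S₃ S ((φ 0).symm z) = 1
    rw [h0, DispEnergy.cutD_eq_one hc₁2 hS₃2 h1 h2]
  · intro z h1 h2
    by_contra h
    obtain ⟨h3, h4⟩ := DispEnergy.lt_of_cutD_ne_zero hc₁2 hS₃2 h
    have h5 : z ∈ (fun x => φ 1 x) '' D ∩ closure D :=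
      ⟨⟨_, hmemD _ h3 h4, (φ 1).apply_symm_apply z⟩,
        subset_closure (hmemD z (fun i => (h1 i).trans_lt hc₁2) (h2.trans_lt hS₃2))⟩
    rw [hdisp] at h5
    exact h5

end
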